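/- Fix ε ∈ (0,1). There exists x₀ = x₀(ε) such that for all x ≥ x₀ and all y with exp((log log x)^{5/3+ε}) ≤ y ≤ (1−ε)x, one has Ψ(x,y) ≥ x · ρ(log x / log y). -/

import Mathlib

open Finset (Icc Icc_subset_Icc_right Ico Ioc Ioc_union_Ioc_eq_Ioc card_filter_le card_le_card card_le_card_of_injOn card_le_mul_card_image_of_maps_to card_product coe_filter disjoint_left exists_subset_card_eq induction_on insertNone mem_Icc mem_Ico mem_Ioc mem_filter mem_image mem_insert mem_product mem_range mem_univ mul_sum prod_insert prod_univ_sum sum_Icc_succ_top sum_add_distrib sum_comm sum_congr sum_const sum_fiberwise_of_maps_to sum_filter sum_insert sum_le_card_nsmul sum_le_sum sum_le_sum_of_subset_of_nonneg sum_mul sum_mul_sum sum_nonneg sum_prod_piFinset sum_product sum_range_succ sum_sdiff sum_sub_distrib sum_union)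
open Complex (I abs_im_le_norm abs_re_le_norm add_im add_re conj_ofReal continuous_re cpow_add cpow_neg differentiableOn_dslope mul_conj neg_re normSq_apply normSq_eq_norm_sq norm_I norm_conj norm_cpow_eq_rpow_re_of_pos norm_le_abs_re_add_abs_im norm_real ofReal_cpow ofReal_natCast ofReal_one ofReal_pow ofReal_re ofReal_sub ofReal_sum re_ofReal_mul sq_norm sub_re)
open Real Filter

/-- `Psi x y` is the number of `y`-friable integers up to `x`. -/
noncomputable def Psi (x y : ℝ) : ℕ :=
  Set.ncard {n : ℕ | 1 ≤ n ∧ (n : ℝ) ≤ x ∧ ∀ p : ℕ, p.Prime → p ∣ n → (p : ℝ) ≤ y}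

namespace VK
open MeasureTheory UnitAddTorus

noncomputable section

local instance instMS : MeasureSpace UnitAddCircle := ⟨AddCircle.haarAddCircle⟩
local instance instHaar : Measure.IsAddHaarMeasure (volume : Measure UnitAddCircle) :=
  inferInstanceAs (Measure.IsAddHaarMeasure AddCircle.haarAddCircle)
local instance instProb : IsProbabilityMeasure (volume : Measure UnitAddCircle) :=
  inferInstanceAs (IsProbabilityMeasure AddCircle.haarAddCircle)

variable {k : ℕ}

abbrev Tor (k : ℕ) := UnitAddTorus (Fin k)

/-- exponential sum -/
def es {ι : Type*} (S : Finset ι) (φ : ι → (Fin k → ℤ)) (x : Tor k) : ℂ :=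
  ∑ i ∈ S, mFourier (φ i) x

lemma es_cont {ι : Type*} (S : Finset ι) (φ : ι → (Fin k → ℤ)) : Continuous (es S φ) := by
  unfold es; fun_prop

lemma cint {f : Tor k → ℝ} (hf : Continuous f) : Integrable f :=
  hf.integrable_of_hasCompactSupport (HasCompactSupport.of_compactSpace _)

lemma cintC {f : Tor k → ℂ} (hf : Continuous f) : Integrable f :=
  hf.integrable_of_hasCompactSupport (HasCompactSupport.of_compactSpace _)

lemma cint_sq {ι : Type*} (S : Finset ι) (φ : ι → (Fin k → ℤ)) :
    Integrable (fun x => ‖es S φ x‖ ^ 2) := cint ((es_cont S φ).norm.pow 2)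

lemma int_mF (n : Fin k → ℤ) : ∫ x : Tor k, mFourier n x = if n = 0 then 1 else 0 := by
  have h := (orthonormal_iff_ite.mp (orthonormal_mFourier (d := Fin k))) 0 n
  simp only [ContinuousMap.inner_toLp, ← mFourier_neg, ← mFourier_add] at h
  simp only [neg_zero, add_zero] at h
  rw [h]
  simp [eq_comm]

lemma es_sq_int {ι κ : Type*} (S : Finset ι) (φ : ι → (Fin k → ℤ)) (R : Finset κ)
    (ψ : κ → (Fin k → ℤ)) :
    ∫ x, mFourier (-0) x * es S φ x * (starRingEnd ℂ) (es R ψ x) =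
      (((S ×ˢ R).filter (fun a => φ a.1 = ψ a.2)).card : ℂ) := by
  have : ∀ x : Tor k, mFourier (-0) x * es S φ x * (starRingEnd ℂ) (es R ψ x) =
      ∑ a ∈ S ×ˢ R, mFourier (φ a.1 - ψ a.2) x := by
    intro x
    simp only [es, map_sum, ← mFourier_neg, neg_zero, mFourier_zero, ContinuousMap.one_apply, one_mul,
      sum_mul_sum, sum_product, ← mFourier_add, sub_eq_add_neg]
  simp_rw [this]
  rw [integral_finsetSum _ (fun i _ => cintC (by fun_prop))]
  simp_rw [int_mF, sub_eq_zero]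
  rw [Finset.sum_ite]; simp

/-- energy -/
def En {ι : Type*} (S : Finset ι) (φ : ι → (Fin k → ℤ)) : ℕ :=
  ((S ×ˢ S).filter (fun a => φ a.1 = φ a.2)).card

lemma En_eq {ι : Type*} (S : Finset ι) (φ : ι → (Fin k → ℤ)) :
    (En S φ : ℝ) = ∫ x, ‖es S φ x‖ ^ 2 := by
  have h := es_sq_int S φ S φ
  simp only [neg_zero, mFourier_zero, ContinuousMap.one_apply, one_mul, mul_conj] at h
  rw [integral_complex_ofReal] at h
  have h2 : (∫ x, Complex.normSq (es S φ x)) = (En S φ : ℝ) := by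
    unfold En; exact_mod_cast h
  rw [← h2]; simp_rw [normSq_eq_norm_sq]

lemma En_mono {ι : Type*} {S R : Finset ι} (h : S ⊆ R) (φ : ι → (Fin k → ℤ)) : En S φ ≤ En R φ :=
  card_le_card (Finset.filter_subset_filter _ (Finset.product_subset_product h h))

/-- shifted energy is at most energy -/
lemma En_shift {ι : Type*} (S : Finset ι) (φ : ι → (Fin k → ℤ)) (c : Fin k → ℤ) :
    ((S ×ˢ S).filter (fun a => φ a.1 + c = φ a.2)).card ≤ En S φ := by
  have h := es_sq_int S (fun i => φ i + c) S φ
  have hc : ∀ x : Tor k, es S (fun i => φ i + c) x = mFourier c x * es S φ x := by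
    intro x; simp only [es, mFourier_add, mul_sum, mul_comm]
  have h1 : ∀ x : Tor k, ‖mFourier c x‖ ≤ 1 := fun x =>
    ((mFourier c).norm_coe_le_norm x).trans mFourier_norm.le
  have h3 : ((((S ×ˢ S).filter (fun a => φ a.1 + c = φ a.2)).card : ℕ) : ℝ) ≤ En S φ := by
    rw [En_eq, ← Complex.norm_natCast, ← h]
    refine norm_integral_le_of_norm_le (cint (by have := es_cont S φ; fun_prop)) (ae_of_all _ fun x => ?_)
    simp only [neg_zero, mFourier_zero, ContinuousMap.one_apply, one_mul, hc, norm_mul, RCLike.norm_conj]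
    rw [mul_assoc, ← sq]
    exact mul_le_of_le_one_left (by positivity) (h1 x)
  exact_mod_cast h3

/-- energy of a union -/
lemma En_union {ι κ : Type*} [DecidableEq κ] (S : Finset ι) (φ : ι → (Fin k → ℤ)) (I : Finset κ) (A : κ → Finset ι)
    (h : ∀ a ∈ S, ∃ i ∈ I, a ∈ A i) : (En S φ : ℝ) ≤ I.card * ∑ i ∈ I, (En (A i) φ : ℝ) := by
  rcases S.eq_empty_or_nonempty with rfl | ⟨a0, ha0⟩
  · simp only [En, Finset.empty_product, Finset.filter_empty, Finset.card_empty, Nat.cast_zero]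
    positivity
  have : Nonempty κ := ⟨(h a0 ha0).choose⟩
  choose! c hc hc' using h
  have hsub : ∀ i, S.filter (fun a => c a = i) ⊆ A i := by
    intro i a ha
    rw [mem_filter] at ha
    rw [← ha.2]; exact hc' a ha.1
  have hs : ∀ x, es S φ x = ∑ i ∈ I, es (S.filter (fun a => c a = i)) φ x := by
    intro x; unfold es
    exact (sum_fiberwise_of_maps_to hc _).symm
  calc (En S φ : ℝ) = ∫ x, ‖es S φ x‖ ^ 2 := En_eq _ _
    _ ≤ ∫ x, (I.card : ℝ) * ∑ i ∈ I, ‖es (S.filter (fun a => c a = i)) φ x‖ ^ 2 := by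
        refine integral_mono (cint (by have := es_cont S φ; fun_prop))
          (cint ?_) fun x => ?_
        · refine continuous_const.mul (continuous_finsetSum _ fun i _ => ?_)
          exact (es_cont _ _).norm.pow 2
        · simp only [hs]
          calc _ ≤ (∑ i ∈ I, ‖es (S.filter (fun a => c a = i)) φ x‖) ^ 2 := by
                gcongr; exact norm_sum_le _ _
            _ ≤ _ := sq_sum_le_card_mul_sum_sq
    _ = I.card * ∑ i ∈ I, (En (S.filter (fun a => c a = i)) φ : ℝ) := by
        rw [integral_const_mul, integral_finsetSum _ fun i _ => ?_]
        · simp_rw [En_eq]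
        · exact cint ((es_cont _ _).norm.pow 2)
    _ ≤ _ := by gcongr with i hi; exact En_mono (hsub i) φ

/-- power vector -/
def pv (k : ℕ) (n : ℤ) : Fin k → ℤ := fun j => n ^ (j.1 + 1)

def pw (k : ℕ) {ι : Type*} [Fintype ι] (w : ι → ℤ) : Fin k → ℤ := ∑ i, pv k (w i)

def tup (ι : Type*) [Fintype ι] [DecidableEq ι] (A : Finset ℤ) : Finset (ι → ℤ) :=
  Fintype.piFinset (fun _ => A)

lemma mF_sum {ι : Type*} (s : Finset ι) (f : ι → Fin k → ℤ) (x : Tor k) :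
    mFourier (∑ i ∈ s, f i) x = ∏ i ∈ s, mFourier (f i) x := by
  classical
  induction s using induction_on with
  | empty => simp [mFourier_zero]
  | insert a s ha ih => rw [sum_insert ha, mFourier_add, ih, prod_insert ha]

lemma es_tup {ι : Type*} [Fintype ι] [DecidableEq ι] (A : Finset ℤ) (x : Tor k) :
    es (tup ι A) (pw k) x = (es A (pv k) x) ^ Fintype.card ι := by
  simp only [es, pw, mF_sum, tup]
  rw [sum_prod_piFinset A (fun _ n => mFourier (pv k n) x)]
  simp

lemma es_prod {ι κ : Type*} (S : Finset ι) (R : Finset κ) (φ : ι → (Fin k → ℤ))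
    (ψ : κ → (Fin k → ℤ)) (x : Tor k) :
    es (S ×ˢ R) (fun a => φ a.1 + ψ a.2) x = es S φ x * es R ψ x := by
  simp only [es, mFourier_add, sum_mul_sum, sum_product]

/-- Vinogradov integral -/
def J (s k : ℕ) (A : Finset ℤ) : ℕ := En (tup (Fin s) A) (pw k)

lemma En_holder {ι κ : Type*} [DecidableEq κ] (D : Finset ι) (φ : ι → (Fin k → ℤ)) (A : Finset ℤ) (g : ℤ → κ)
    (R : Finset κ) (hg : ∀ a ∈ A, g a ∈ R) (s : ℕ) :
    (En (D ×ˢ tup (Fin (s+1)) A) (fun a => φ a.1 + pw k a.2) : ℝ) ≤ (R.card : ℝ) ^ (2 * s + 1) *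
      ∑ r ∈ R, (En (D ×ˢ tup (Fin (s+1)) (A.filter (fun n => g n = r))) (fun a => φ a.1 + pw k a.2) : ℝ) := by
  simp_rw [En_eq]
  rw [← integral_finsetSum _ fun i _ => cint_sq _ _, ← integral_const_mul]
  refine integral_mono (cint ((es_cont _ _).norm.pow 2)) (cint ?_) fun x => ?_
  · refine continuous_const.mul (continuous_finsetSum _ fun i _ => ?_)
    exact (es_cont _ _).norm.pow 2
  simp only [es_prod, es_tup, Fintype.card_fin, norm_mul, norm_pow]
  have hs : es A (pv k) x = ∑ r ∈ R, es (A.filter (fun a => g a = r)) (pv k) x :=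
    (sum_fiberwise_of_maps_to hg _).symm
  have h1 : ‖es A (pv k) x‖ ≤ ∑ r ∈ R, ‖es (A.filter (fun a => g a = r)) (pv k) x‖ := by
    rw [hs]; exact norm_sum_le _ _
  have h2 : (∑ r ∈ R, ‖es (A.filter (fun a => g a = r)) (pv k) x‖) ^ (2 * s + 1 + 1) ≤
     (R.card : ℝ) ^ (2 * s + 1) * ∑ r ∈ R, ‖es (A.filter (fun a => g a = r)) (pv k) x‖ ^ (2 * s + 1 + 1) :=
    pow_sum_le_card_mul_sum_pow (fun _ _ => norm_nonneg _) _
  calc _ = ‖es D φ x‖ ^ 2 * ‖es A (pv k) x‖ ^ (2 * s + 1 + 1) := by ring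
    _ ≤ ‖es D φ x‖ ^ 2 * ((R.card : ℝ) ^ (2 * s + 1) * ∑ r ∈ R, ‖es (A.filter (fun a => g a = r)) (pv k) x‖ ^ (2 * s + 1 + 1)) := by
        gcongr; exact (pow_le_pow_left₀ (norm_nonneg _) h1 _).trans h2
    _ = _ := by
        rw [mul_left_comm, mul_sum]
        congr 1; refine sum_congr rfl fun r _ => ?_; ring

end
end VK

namespace VK

lemma newton_prod {R : Type*} [CommRing R] (k : ℕ) (x y : Fin k → R)
    (h : ∀ j, 1 ≤ j → j ≤ k → ∑ i, x i ^ j = ∑ i, y i ^ j)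
    (hu : ∀ j : ℕ, 1 ≤ j → j ≤ k → IsUnit (j : R)) (t : R) :
    ∏ i, (t - x i) = ∏ i, (t - y i) := by
  have key : ∀ j, j ≤ k → MvPolynomial.aeval x (MvPolynomial.esymm (Fin k) R j) =
      MvPolynomial.aeval y (MvPolynomial.esymm (Fin k) R j) := by
    intro j
    induction j using Nat.strong_induction_on with
    | _ j ih =>
      intro hj
      rcases Nat.eq_zero_or_pos j with rfl | hpos
      · simp
      refine (hu j hpos hj).mul_left_cancel ?_
      have e := fun z : Fin k → R => congrArg (MvPolynomial.aeval z) (MvPolynomial.mul_esymm_eq_sum (Fin k) R j)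
      simp only [map_mul, map_natCast, map_sum, map_pow, map_neg, map_one] at e
      rw [e x, e y]
      congr 1
      refine sum_congr rfl fun a ha => ?_
      rw [mem_filter, Finset.HasAntidiagonal.mem_antidiagonal] at ha
      rw [ih a.1 ha.2 (by omega)]
      congr 1
      simp only [MvPolynomial.psum, map_sum, map_pow, MvPolynomial.aeval_X]
      exact h _ (by omega) (by omega)
  have e : ∀ z : Fin k → R, ∏ i, (t - z i) =
      ∑ j ∈ Finset.range (k + 1), (-1) ^ j * (MvPolynomial.aeval z (MvPolynomial.esymm (Fin k) R j) * t ^ (k - j)) := by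
    intro z
    have := congrArg (Polynomial.eval t) (Multiset.prod_X_sub_X_eq_sum_esymm (Finset.univ.val.map z))
    simp only [Multiset.card_map, Finset.card_val, Finset.card_univ, Fintype.card_fin] at this
    simp only [MvPolynomial.aeval_esymm_eq_multiset_esymm]
    rw [Polynomial.eval_finsetSum] at this
    simp only [Polynomial.eval_mul, Polynomial.eval_pow, Polynomial.eval_neg, Polynomial.eval_one, Polynomial.eval_C, Polynomial.eval_X, Multiset.map_map, Function.comp_def] at this
    rw [← this]
    change _ = Polynomial.eval t (∏ i, (Polynomial.X - Polynomial.C (z i)))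
    rw [Polynomial.eval_prod]; simp
  rw [e x, e y]
  refine sum_congr rfl fun j hj => ?_
  rw [key j (by rw [mem_range] at hj; omega)]

/-- two solutions: each coordinate matches -/
lemma linnik_fiber (p k : ℕ) (hp : p.Prime) (hpk : k < p) (x y : Fin k → ℤ)
    (hx : ∀ i i', (p : ℤ) ∣ x i - x i' → i = i')
    (h : ∀ j, (p : ℤ) ^ k ∣ pw k x j - pw k y j) (i : Fin k) : ∃ i', (p : ℤ) ^ k ∣ y i - x i' := by
  have hk : 0 < k := i.pos
  have h1 := newton_prod (R := ZMod (p ^ k)) k (fun i => (x i : ZMod (p ^ k))) (fun i => (y i : ZMod (p ^ k)))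
    (by
      intro j h1 h2
      have := h ⟨j - 1, by omega⟩
      have e := (ZMod.intCast_eq_intCast_iff_dvd_sub (pw k y ⟨j - 1, by omega⟩) (pw k x ⟨j - 1, by omega⟩) (p ^ k)).2
        (by push_cast; exact this)
      simp only [pw, pv, Finset.sum_apply, show j - 1 + 1 = j by omega] at e
      push_cast at e
      exact e.symm)
    (by
      intro j h1 h2
      rw [ZMod.isUnit_iff_coprime]
      refine Nat.Coprime.pow_right k ?_
      exact (Nat.coprime_of_lt_prime (by omega) (by omega) hp).symm) (y i)
  rw [Finset.prod_eq_zero (f := fun j => ((y i : ZMod (p ^ k)) - (y j : ZMod (p ^ k)))) (mem_univ i) (sub_self _)] at h1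
  have h2 : ((p ^ k : ℕ) : ℤ) ∣ ∏ j, (y i - x j) := by
    rw [← ZMod.intCast_zmod_eq_zero_iff_dvd]; push_cast; exact h1
  push_cast at h2
  have hpz : Prime (p : ℤ) := Nat.prime_iff_prime_int.1 hp
  have h3 : (p : ℤ) ∣ ∏ j, (y i - x j) := (dvd_pow_self _ hk.ne').trans h2
  obtain ⟨j, -, hj⟩ := hpz.exists_mem_finset_dvd h3
  refine ⟨j, ?_⟩
  rw [← Finset.mul_prod_erase _ _ (mem_univ j)] at h2
  refine hpz.pow_dvd_of_dvd_mul_right k ?_ h2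
  intro h4
  obtain ⟨j', hj', h5⟩ := hpz.exists_mem_finset_dvd h4
  refine Finset.ne_of_mem_erase hj' (hx _ _ ?_)
  have := dvd_sub hj h5
  simpa using this

lemma linnik (p k : ℕ) (hp : p.Prime) (hpk : k < p) (A : Finset ℤ)
    (hA : ∀ m ∈ A, ∀ n ∈ A, (p : ℤ) ^ k ∣ m - n → m = n) (h : Fin k → ℤ) :
    ((tup (Fin k) A).filter (fun x => (∀ i i', (p : ℤ) ∣ x i - x i' → i = i') ∧
      ∀ j : Fin k, (p : ℤ) ^ (j.1 + 1) ∣ pw k x j - h j)).card ≤ k ^ k * p ^ (k * (k - 1) / 2) := by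
  classical
  have hp0 : (0 : ℤ) < p := by exact_mod_cast hp.pos
  set T : Finset (Fin k → ℤ) := Fintype.piFinset (fun j : Fin k => Ico (0 : ℤ) ((p ^ (k - 1 - j.1) : ℕ) : ℤ)) with hT
  have hTc : T.card = p ^ (k * (k - 1) / 2) := by
    simp only [hT, Fintype.card_piFinset, Int.card_Ico, sub_zero, Int.toNat_natCast]
    rw [Finset.prod_pow_eq_pow_sum, Fin.sum_univ_eq_sum_range (fun i => k - 1 - i),
      Finset.sum_range_reflect (fun i => i), Finset.sum_range_id]
  rw [← hTc]
  refine card_le_mul_card_image_of_maps_to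
    (f := fun x j => ((pw k x j - h j) / (p : ℤ) ^ (j.1 + 1)) % ((p ^ (k - 1 - j.1) : ℕ) : ℤ)) ?_ _ ?_
  · intro x hx
    rw [hT, Fintype.mem_piFinset]
    intro j
    rw [mem_Ico]
    have : (0 : ℤ) < ((p ^ (k - 1 - j.1) : ℕ) : ℤ) := by push_cast; positivity
    exact ⟨Int.emod_nonneg _ this.ne', Int.emod_lt_of_pos _ this⟩
  · intro b hb
    rcases Finset.eq_empty_or_nonempty (Finset.filter (fun x => (fun j : Fin k => ((pw k x j - h j) / (p : ℤ) ^ (j.1 + 1)) % ((p ^ (k - 1 - j.1) : ℕ) : ℤ)) = b) ((tup (Fin k) A).filter (fun x => (∀ i i', (p : ℤ) ∣ x i - x i' → i = i') ∧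
      ∀ j : Fin k, (p : ℤ) ^ (j.1 + 1) ∣ pw k x j - h j))) with h0 | ⟨x0, hx0⟩
    · rw [h0]; simp
    have hsub : Finset.filter (fun x => (fun j : Fin k => ((pw k x j - h j) / (p : ℤ) ^ (j.1 + 1)) % ((p ^ (k - 1 - j.1) : ℕ) : ℤ)) = b) ((tup (Fin k) A).filter (fun x => (∀ i i', (p : ℤ) ∣ x i - x i' → i = i') ∧
      ∀ j : Fin k, (p : ℤ) ^ (j.1 + 1) ∣ pw k x j - h j)) ⊆
        Finset.image (fun g : Fin k → Fin k => x0 ∘ g) Finset.univ := by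
      intro x hx
      simp only [mem_filter] at hx hx0
      obtain ⟨⟨hxA, hx1, hx2⟩, hx3⟩ := hx
      obtain ⟨⟨hA0, h01, h02⟩, h03⟩ := hx0
      have hd : ∀ j, (p : ℤ) ^ k ∣ pw k x0 j - pw k x j := by
        intro j
        have e : ((pw k x0 j - h j) / (p : ℤ) ^ (j.1 + 1)) ≡ ((pw k x j - h j) / (p : ℤ) ^ (j.1 + 1)) [ZMOD ((p ^ (k - 1 - j.1) : ℕ) : ℤ)] :=
          (congrFun h03 j).trans (congrFun hx3 j).symm
        obtain ⟨c, hc⟩ := h02 j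
        obtain ⟨d, hd⟩ := hx2 j
        have hpp : (p : ℤ) ^ (j.1 + 1) ≠ 0 := by positivity
        rw [hc, hd, Int.mul_ediv_cancel_left _ hpp, Int.mul_ediv_cancel_left _ hpp] at e
        have e2 := e.symm.dvd
        have : pw k x0 j - pw k x j = (p : ℤ) ^ (j.1 + 1) * (c - d) := by linear_combination hc - hd
        rw [this, show (p : ℤ) ^ k = (p : ℤ) ^ (j.1 + 1) * (p : ℤ) ^ (k - 1 - j.1) by
          rw [← pow_add]; congr 1; have := j.2; omega]
        exact mul_dvd_mul_left _ (by push_cast at e2; exact e2)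
      have := linnik_fiber p k hp hpk x0 x h01 hd
      choose g hg using this
      rw [mem_image]
      refine ⟨g, mem_univ _, funext fun i => ?_⟩
      rw [tup, Fintype.mem_piFinset] at hxA hA0
      exact (hA _ (hxA i) _ (hA0 _) (hg i)).symm
    refine (card_le_card hsub).trans (Finset.card_image_le.trans ?_)
    simp

end VK

namespace VK

lemma pw_apply (k : ℕ) {ι : Type*} [Fintype ι] (w : ι → ℤ) (j : Fin k) :
    pw k w j = ∑ i, w i ^ (j.1 + 1) := by simp [pw, pv]

lemma pw_trans (k : ℕ) {ι : Type*} [Fintype ι] (w w' : ι → ℤ) (a : ℤ) (h : pw k w = pw k w') :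
    pw k (fun i => w i - a) = pw k (fun i => w' i - a) := by
  have h' : ∀ m, m ≤ k → ∑ i, w i ^ m = ∑ i, w' i ^ m := by
    intro m hm
    rcases m with _ | m
    · simp
    · have := congrFun h ⟨m, by omega⟩
      simpa [pw_apply] using this
  funext j
  simp only [pw_apply, sub_eq_add_neg, add_pow]
  rw [sum_comm, sum_comm (s := Finset.univ)]
  refine sum_congr rfl fun m hm => ?_
  rw [← sum_mul, ← sum_mul, ← sum_mul, ← sum_mul, h' m (by have := j.2; rw [mem_range] at hm; omega)]

lemma pw_elim (k : ℕ) {ι κ : Type*} [Fintype ι] [Fintype κ] (x : ι → ℤ) (u : κ → ℤ) :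
    pw k (Sum.elim x u) = pw k x + pw k u := by simp [pw, Fintype.sum_sum_type]

lemma pw_trans2 (k : ℕ) {ι κ : Type*} [Fintype ι] [Fintype κ] (x x' : ι → ℤ) (u u' : κ → ℤ) (a : ℤ)
    (h : pw k x + pw k u = pw k x' + pw k u') :
    pw k (fun i => x i - a) + pw k (fun i => u i - a) = pw k (fun i => x' i - a) + pw k (fun i => u' i - a) := by
  rw [← pw_elim, ← pw_elim] at h
  have := pw_trans k _ _ a h
  rw [← pw_elim, ← pw_elim]
  convert this using 1 <;> congr 1 <;> ext i <;> cases i <;> rfl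

lemma tup_card (ι : Type*) [Fintype ι] [DecidableEq ι] (A : Finset ℤ) : (tup ι A).card = A.card ^ Fintype.card ι := by
  simp [tup]

/-- distinct mod p -/
def Dp (k p : ℕ) (A : Finset ℤ) : Finset (Fin k → ℤ) :=
  (tup (Fin k) A).filter (fun x => ∀ i i', (p : ℤ) ∣ x i - x i' → i = i')

lemma Z_card (p k : ℕ) (hp : p.Prime) (hpk : k < p) (X : ℕ) (hX : X ≤ p ^ k) (a : ℤ) :
    ((Dp k p (Ico 0 (X:ℤ)) ×ˢ Dp k p (Ico 0 (X:ℤ))).filter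
      (fun z => ∀ j : Fin k, (p : ℤ) ^ (j.1 + 1) ∣ pw k (fun i => z.1 i - a) j - pw k (fun i => z.2 i - a) j)).card
      ≤ k ^ k * p ^ (k * (k - 1) / 2) * X ^ k := by
  classical
  have hc : (Dp k p (Ico 0 (X:ℤ))).card ≤ X ^ k := by
    refine (card_filter_le _ _).trans ?_
    rw [tup_card]; simp
  refine le_trans (card_le_mul_card_image_of_maps_to (f := Prod.snd) (t := Dp k p (Ico 0 (X:ℤ))) ?_
    (k ^ k * p ^ (k * (k - 1) / 2)) ?_) (Nat.mul_le_mul_left _ hc)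
  · intro z hz
    exact (mem_product.1 (mem_filter.1 hz).1).2
  · intro x' hx'
    refine le_trans ?_ (linnik p k hp hpk (Ico (-a) (X - a)) ?_ (pw k (fun i => x' i - a)))
    · refine card_le_card_of_injOn (fun z i => z.1 i - a) ?_ ?_
      · intro z hz
        simp only [coe_filter, Set.mem_ofPred_eq, mem_filter, mem_product, Dp, tup, Fintype.mem_piFinset, mem_Ico] at hz ⊢
        obtain ⟨⟨⟨⟨h1, h2⟩, h3⟩, h4⟩, rfl⟩ := hz
        refine ⟨fun i => ?_, fun i i' h => h2 i i' (by simpa using h), h4⟩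
        have := h1 i
        constructor <;> linarith
      · intro z hz z' hz' h
        simp only [coe_filter, Set.mem_ofPred_eq] at hz hz'
        refine Prod.ext (funext fun i => ?_) (hz.2.trans hz'.2.symm)
        have := congrFun h i
        simpa using this
    · intro m hm n hn h
      rw [mem_Ico] at hm hn
      have : (X : ℤ) ≤ (p : ℤ) ^ k := by exact_mod_cast hX
      have := Int.eq_zero_of_abs_lt_dvd h (by rw [abs_lt]; constructor <;> linarith)
      linarith

lemma step_p (p k s : ℕ) (hp : p.Prime) (hpk : k < p) (X : ℕ) (hX : X ≤ p ^ k) (a : ℤ)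
    (ha : 0 ≤ a) (hap : a < p) :
    En (Dp k p (Ico 0 (X:ℤ)) ×ˢ tup (Fin s) ((Ico 0 (X:ℤ)).filter (fun n => n % p = a)))
      (fun z => pw k z.1 + pw k z.2) ≤
      J s k (Ico 0 ((X / p + 1 : ℕ) : ℤ)) * (k ^ k * p ^ (k * (k - 1) / 2) * X ^ k) := by
  classical
  have hp0 : (0 : ℤ) < p := by exact_mod_cast hp.pos
  refine le_trans ?_ (Nat.mul_le_mul_left _ (Z_card p k hp hpk X hX a))
  have hu : ∀ u : Fin s → ℤ, u ∈ tup (Fin s) ((Ico 0 (X:ℤ)).filter (fun n => n % p = a)) →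
      ∀ i, u i - a = p * ((u i - a) / p) := by
    intro u hu i
    simp only [tup, Fintype.mem_piFinset, mem_filter] at hu
    have := (hu i).2
    rw [Int.mul_ediv_cancel' ]
    rw [← this]; exact Int.dvd_self_sub_emod
  have hpw : ∀ u : Fin s → ℤ, u ∈ tup (Fin s) ((Ico 0 (X:ℤ)).filter (fun n => n % p = a)) →
      ∀ j : Fin k, pw k (fun i => u i - a) j = (p : ℤ) ^ (j.1 + 1) * pw k (fun i => (u i - a) / p) j := by
    intro u h j
    simp only [pw_apply, mul_sum, ← mul_pow]
    exact sum_congr rfl fun i _ => by rw [← hu u h i]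
  have hmem : ∀ u : Fin s → ℤ, u ∈ tup (Fin s) ((Ico 0 (X:ℤ)).filter (fun n => n % p = a)) →
      (fun i => (u i - a) / p) ∈ tup (Fin s) (Ico 0 ((X / p + 1 : ℕ) : ℤ)) := by
    intro u h
    have h' := hu u h
    simp only [tup, Fintype.mem_piFinset, mem_filter, mem_Ico] at h ⊢
    intro i
    obtain ⟨⟨h1, h2⟩, h3⟩ := h i
    have h4 := h' i
    set v := (u i - a) / p
    have hlow : 0 ≤ v := by
      by_contra hc
      push Not at hc
      nlinarith
    refine ⟨hlow, ?_⟩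
    push_cast
    have : v ≤ (X : ℤ) / p := by
      rw [Int.le_ediv_iff_mul_le hp0]; linarith
    linarith
  refine card_le_mul_card_image_of_maps_to (f := fun q => (q.1.1, q.2.1)) ?_ _ ?_
  · intro q hq
    simp only [mem_filter, mem_product] at hq ⊢
    refine ⟨⟨hq.1.1.1, hq.1.2.1⟩, fun j => ?_⟩
    have h1 := congrFun (pw_trans2 k _ _ _ _ a hq.2) j
    simp only [Pi.add_apply] at h1
    rw [hpw _ hq.1.1.2, hpw _ hq.1.2.2] at h1
    exact ⟨pw k (fun i => (q.2.2 i - a) / p) j - pw k (fun i => (q.1.2 i - a) / p) j, by linear_combination h1⟩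
  · rintro ⟨x, x'⟩ hx
    simp only [mem_filter, mem_product] at hx
    choose c hc using hx.2
    refine le_trans ?_ (En_shift (tup (Fin s) (Ico 0 ((X / p + 1 : ℕ) : ℤ))) (pw k) c)
    refine card_le_card_of_injOn (fun q => ((fun i => (q.1.2 i - a) / p), (fun i => (q.2.2 i - a) / p))) ?_ ?_
    · intro q hq
      simp only [coe_filter, Set.mem_ofPred_eq, mem_filter, mem_product, Prod.mk.injEq] at hq ⊢
      obtain ⟨⟨⟨⟨h1, h2⟩, h3, h4⟩, h5⟩, h6, h7⟩ := hq
      refine ⟨⟨hmem _ h2, hmem _ h4⟩, funext fun j => ?_⟩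
      have h8 := congrFun (pw_trans2 k _ _ _ _ a h5) j
      simp only [Pi.add_apply] at h8 ⊢
      rw [hpw _ h2, hpw _ h4, h6, h7] at h8
      have := hc j
      have hpp : (p : ℤ) ^ (j.1 + 1) ≠ 0 := by positivity
      apply mul_left_cancel₀ hpp
      linear_combination h8 - this
    · intro q hq q' hq' h
      simp only [coe_filter, Set.mem_ofPred_eq, mem_filter, mem_product, Prod.mk.injEq] at hq hq' h
      obtain ⟨⟨⟨⟨h1, h2⟩, h3, h4⟩, h5⟩, h6, h7⟩ := hq
      obtain ⟨⟨⟨⟨h1', h2'⟩, h3', h4'⟩, h5'⟩, h6', h7'⟩ := hq'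
      refine Prod.ext (Prod.ext (h6.trans h6'.symm) (funext fun i => ?_)) (Prod.ext (h7.trans h7'.symm) (funext fun i => ?_))
      · have := congrFun h.1 i
        have e1 := hu _ h2 i
        have e2 := hu _ h2' i
        rw [this] at e1; linarith
      · have := congrFun h.2 i
        have e1 := hu _ h4 i
        have e2 := hu _ h4' i
        rw [this] at e1; linarith

/-- energy with the first block distinct mod p -/
lemma step_good (p k s : ℕ) (hp : p.Prime) (hpk : k < p) (X : ℕ) (hX : X ≤ p ^ k) :
    (En (Dp k p (Ico 0 (X:ℤ)) ×ˢ tup (Fin (s+1)) (Ico 0 (X:ℤ))) (fun z => pw k z.1 + pw k z.2) : ℝ) ≤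
      (p : ℝ) ^ (2 * (s + 1)) * (J (s+1) k (Ico 0 ((X / p + 1 : ℕ) : ℤ)) * (k ^ k * p ^ (k * (k - 1) / 2) * X ^ k)) := by
  have hp0 : (0 : ℤ) < p := by exact_mod_cast hp.pos
  refine (En_holder (Dp k p (Ico 0 (X:ℤ))) (pw k) (Ico 0 (X:ℤ)) (fun n => n % p) (Ico 0 (p:ℤ))
    (fun a _ => by rw [mem_Ico]; exact ⟨Int.emod_nonneg _ hp0.ne', Int.emod_lt_of_pos _ hp0⟩) s).trans ?_
  refine (mul_le_mul_of_nonneg_left (sum_le_card_nsmul _ _ _ fun r hr => ?_) (by positivity)).trans (b := ((Ico 0 (p:ℤ)).card : ℝ) ^ (2 * s + 1) * ((Ico 0 (p:ℤ)).card • ((J (s+1) k (Ico 0 ((X / p + 1 : ℕ) : ℤ)) * (k ^ k * p ^ (k * (k - 1) / 2) * X ^ k) : ℕ) : ℝ))) ?_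
  · rw [mem_Ico] at hr
    exact_mod_cast step_p p k (s+1) hp hpk X hX r hr.1 hr.2
  · simp only [Int.card_Ico, sub_zero, Int.toNat_natCast, nsmul_eq_mul]
    push_cast
    apply le_of_eq; ring

end VK

namespace VK

lemma J_eq {k : ℕ} {ι : Type*} [Fintype ι] [DecidableEq ι] (A : Finset ℤ) :
    En (tup ι A) (pw k) = J (Fintype.card ι) k A := by
  have : (En (tup ι A) (pw k) : ℝ) = J (Fintype.card ι) k A := by
    unfold J; simp_rw [En_eq, es_tup]; simp
  exact_mod_cast this

lemma En_inj {k : ℕ} {ι κ : Type*} (S : Finset ι) (φ : ι → (Fin k → ℤ)) (R : Finset κ) (ψ : κ → (Fin k → ℤ))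
    (f : ι → κ) (hf : ∀ a ∈ S, f a ∈ R) (hinj : Function.Injective f) (h : ∀ a, ψ (f a) = φ a) :
    En S φ ≤ En R ψ := by
  refine card_le_card_of_injOn (fun q => (f q.1, f q.2)) ?_ ?_
  · intro q hq
    simp only [coe_filter, Set.mem_ofPred_eq, mem_product] at hq ⊢
    exact ⟨⟨hf _ hq.1.1, hf _ hq.1.2⟩, by rw [h, h]; exact hq.2⟩
  · intro q _ q' _ h
    simp only [Prod.mk.injEq] at h
    exact Prod.ext (hinj h.1) (hinj h.2)

lemma En_le_sq {k : ℕ} {ι : Type*} (S : Finset ι) (φ : ι → (Fin k → ℤ)) : En S φ ≤ S.card ^ 2 := by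
  refine (card_filter_le _ _).trans ?_
  rw [card_product, sq]

lemma bad_card (k : ℕ) {ι : Type*} [Fintype ι] [DecidableEq ι] [Nonempty ι] (A : Finset ℤ) :
    ((tup ι A).filter (fun w => (Finset.univ.image w).card < k)).card ≤
      (k - 1) ^ Fintype.card ι * A.card ^ (k - 1) := by
  classical
  have hsub : (tup ι A).filter (fun w => (Finset.univ.image w).card < k) ⊆
      ((Finset.univ : Finset (ι → Fin (k - 1))) ×ˢ tup (Fin (k - 1)) A).image (fun q => q.2 ∘ q.1) := by
    intro w hw
    rw [mem_filter] at hw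
    obtain ⟨hw, hc⟩ := hw
    simp only [tup, Fintype.mem_piFinset] at hw
    obtain ⟨i0⟩ := ‹Nonempty ι›
    set e := (Finset.univ.image w).equivFin
    have hm : ∀ i, w i ∈ Finset.univ.image w := fun i => Finset.mem_image_of_mem _ (mem_univ _)
    rw [mem_image]
    refine ⟨(fun i => ⟨e ⟨w i, hm i⟩, by have := (e ⟨w i, hm i⟩).2; omega⟩,
      fun j => if h : j.1 < (Finset.univ.image w).card then (e.symm ⟨j, h⟩ : ℤ) else w i0), ?_, ?_⟩
    · simp only [mem_product, mem_univ, true_and, tup, Fintype.mem_piFinset]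
      intro j
      split_ifs with h
      · have := (e.symm ⟨j, h⟩).2
        rw [mem_image] at this
        obtain ⟨i, -, hi⟩ := this
        rw [← hi]; exact hw i
      · exact hw i0
    · funext i
      simp
  refine (card_le_card hsub).trans (Finset.card_image_le.trans ?_)
  rw [card_product, tup_card]
  simp

lemma exists_perm (k s : ℕ) (e : Fin k → Fin k ⊕ Fin s) (he : Function.Injective e) :
    ∃ pm : Equiv.Perm (Fin k ⊕ Fin s), ∀ i, pm (Sum.inl i) = e i := by
  classical
  let f : {x : Fin k ⊕ Fin s // x ∈ Set.range (Sum.inl : Fin k → Fin k ⊕ Fin s)} ≃ {x // x ∈ Set.range e} :=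
    (Equiv.ofInjective _ Sum.inl_injective).symm.trans (Equiv.ofInjective e he)
  refine ⟨f.extendSubtype, fun i => ?_⟩
  rw [Equiv.extendSubtype_apply_of_mem _ _ ⟨i, rfl⟩]
  simp only [f, Equiv.trans_apply]
  have : (Equiv.ofInjective (Sum.inl : Fin k → Fin k ⊕ Fin s) Sum.inl_injective).symm ⟨Sum.inl i, ⟨i, rfl⟩⟩ = i := by
    rw [Equiv.symm_apply_eq]; rfl
  rw [this]; rfl

lemma exists_inj {k : ℕ} {ι : Type*} [Fintype ι] [DecidableEq ι] (w : ι → ℤ) (h : k ≤ (Finset.univ.image w).card) :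
    ∃ e : Fin k → ι, Function.Injective (w ∘ e) := by
  obtain ⟨t, ht, hc⟩ := exists_subset_card_eq h
  have : ∀ i : Fin k, ∃ j, w j = t.orderEmbOfFin hc i := by
    intro i
    have := ht (Finset.orderEmbOfFin_mem t hc i)
    simpa using this
  choose e he using this
  exact ⟨e, fun a b hab => (t.orderEmbOfFin hc).injective (by rw [← he, ← he]; exact hab)⟩

lemma exists_prime_sep (k X Y : ℕ) (hk : 1 ≤ k) (hY : 2 ≤ Y) (hXY : X ≤ Y ^ k) (P : Finset ℕ) (hP : ∀ p ∈ P, p.Prime ∧ Y < p)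
    (hc : k ^ 3 ≤ P.card) (x : Fin k → ℤ) (hx : ∀ i, x i ∈ Ico 0 (X:ℤ)) (hinj : Function.Injective x) :
    ∃ p ∈ P, ∀ i i', (p : ℤ) ∣ x i - x i' → i = i' := by
  classical
  by_contra hcon
  push Not at hcon
  set Q : ℕ := ∏ q ∈ (Finset.univ : Finset (Fin k)).offDiag, (x q.1 - x q.2).natAbs with hQ
  have h1 : ∏ p ∈ P, p ∣ Q := by
    refine Finset.prod_primes_dvd _ (fun p hp => (hP p hp).1.prime) fun p hp => ?_
    obtain ⟨i, i', h, hne⟩ := hcon p hp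
    refine (Int.natCast_dvd.1 h).trans (Finset.dvd_prod_of_mem (fun q : Fin k × Fin k => (x q.1 - x q.2).natAbs) (a := (i, i')) ?_)
    simp [hne]
  have h2 : Q ≠ 0 := by
    rw [hQ, Finset.prod_ne_zero_iff]
    intro q hq
    simp only [Finset.mem_offDiag, mem_univ, true_and] at hq
    rw [Int.natAbs_ne_zero, sub_ne_zero]
    exact fun h => hq (hinj h)
  have h3 : Q ≤ (Y ^ k) ^ (k * k - k) := by
    have : (Finset.univ : Finset (Fin k)).offDiag.card = k * k - k := by simp
    rw [← this]
    refine Finset.prod_le_pow_card _ _ _ fun q _ => ?_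
    have a := hx q.1
    have b := hx q.2
    rw [mem_Ico] at a b
    omega
  have h4 : Y ^ (k ^ 3) ≤ ∏ p ∈ P, p :=
    (Nat.pow_le_pow_right (by omega) hc).trans (Finset.pow_card_le_prod _ _ _ fun p hp => (hP p hp).2.le)
  have h5 := (h4.trans (Nat.le_of_dvd (Nat.pos_of_ne_zero h2) h1)).trans h3
  rw [← pow_mul, Nat.pow_le_pow_iff_right (by omega)] at h5
  have : k * (k * k - k) < k ^ 3 := by
    rw [pow_succ, sq, mul_comm]
    refine Nat.mul_lt_mul_of_pos_right ?_ hk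
    have : 0 < k * k := by positivity
    omega
  omega

lemma J_step (k s X Y : ℕ) (hk : 1 ≤ k) (hY : 2 ≤ Y) (hkY : k ≤ Y) (hXY : X ≤ Y ^ k) (P : Finset ℕ)
    (hP : ∀ p ∈ P, p.Prime ∧ Y < p) (hc : k ^ 3 ≤ P.card) (B : ℝ)
    (hB : ∀ p ∈ P, (p : ℝ) ^ (2 * (s + 1)) * (J (s+1) k (Ico 0 ((X / p + 1 : ℕ) : ℤ)) * (k ^ k * p ^ (k * (k - 1) / 2) * X ^ k)) ≤ B) :
    (J (k + (s + 1)) k (Ico 0 (X:ℤ)) : ℝ) ≤ (1 + (k + (s + 1)).factorial * P.card : ℕ) *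
      ((((k - 1) ^ (k + (s + 1)) * X ^ (k - 1) : ℕ) : ℝ) ^ 2 + ((k + (s + 1)).factorial * P.card : ℕ) * B) := by
  classical
  have hJ : J (k + (s + 1)) k (Ico 0 (X:ℤ)) = En (tup (Fin k ⊕ Fin (s+1)) (Ico 0 (X:ℤ))) (pw k) := by
    rw [J_eq]; simp
  rw [hJ]
  have : Nonempty (Fin k ⊕ Fin (s+1)) := ⟨Sum.inl ⟨0, hk⟩⟩
  set T := tup (Fin k ⊕ Fin (s+1)) (Ico 0 (X:ℤ)) with hT
  let Aset : Option (Equiv.Perm (Fin k ⊕ Fin (s+1)) × ℕ) → Finset (Fin k ⊕ Fin (s+1) → ℤ) := fun o =>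
    o.elim (T.filter (fun w => (Finset.univ.image w).card < k))
      (fun q => T.filter (fun w => ∀ i i' : Fin k, (q.2 : ℤ) ∣ w (q.1 (Sum.inl i)) - w (q.1 (Sum.inl i')) → i = i'))
  refine (En_union T (pw k) (insertNone (Finset.univ ×ˢ P)) Aset ?_).trans ?_
  · intro w hw
    by_cases hb : (Finset.univ.image w).card < k
    · exact ⟨none, Finset.none_mem_insertNone, mem_filter.2 ⟨hw, hb⟩⟩
    · push Not at hb
      obtain ⟨e, he⟩ := exists_inj w hb
      obtain ⟨pm, hpm⟩ := exists_perm k (s+1) e he.of_comp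
      have hw' := hw
      rw [hT, tup, Fintype.mem_piFinset] at hw'
      obtain ⟨p, hp, h⟩ := exists_prime_sep k X Y hk hY hXY P hP hc (w ∘ e) (fun i => hw' _) he
      refine ⟨some (pm, p), by simp [hp], mem_filter.2 ⟨hw, fun i i' h' => h i i' ?_⟩⟩
      simpa [hpm] using h'
  · have hcard : (insertNone ((Finset.univ : Finset (Equiv.Perm (Fin k ⊕ Fin (s+1)))) ×ˢ P)).card = 1 + (k + (s + 1)).factorial * P.card := by
      simp [Fintype.card_perm]; ring
    rw [hcard, Finset.sum_insertNone]
    refine mul_le_mul_of_nonneg_left (add_le_add ?_ ?_) (by positivity)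
    · have h1 := En_le_sq (T.filter (fun w => (Finset.univ.image w).card < k)) (pw k)
      have h2 := bad_card k (ι := Fin k ⊕ Fin (s+1)) (Ico 0 (X:ℤ))
      simp only [Fintype.card_sum, Fintype.card_fin, Int.card_Ico, sub_zero, Int.toNat_natCast] at h2
      exact_mod_cast h1.trans (Nat.pow_le_pow_left h2 2)
    · have hcard2 : ((Finset.univ : Finset (Equiv.Perm (Fin k ⊕ Fin (s+1)))) ×ˢ P).card = (k + (s + 1)).factorial * P.card := by
        simp [Fintype.card_perm]
      rw [← hcard2, ← nsmul_eq_mul]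
      refine sum_le_card_nsmul _ _ _ fun q hq => ?_
      rw [mem_product] at hq
      have hp := hP _ hq.2
      refine le_trans ?_ (hB _ hq.2)
      refine le_trans ?_ (step_good q.2 k s hp.1 (by omega) X (hXY.trans (Nat.pow_le_pow_left hp.2.le _)))
      norm_cast
      refine En_inj _ _ _ _ (fun w => (fun i => w (q.1 (Sum.inl i)), fun i => w (q.1 (Sum.inr i)))) ?_ ?_ ?_
      · intro w hw
        have hw := mem_filter.1 hw
        have hw1 := hw.1
        rw [hT, tup, Fintype.mem_piFinset] at hw1
        rw [mem_product, Dp, mem_filter, tup, tup, Fintype.mem_piFinset, Fintype.mem_piFinset]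
        exact ⟨⟨fun i => hw1 _, hw.2⟩, fun i => hw1 _⟩
      · intro w w' h
        simp only [Prod.mk.injEq] at h
        funext i
        obtain ⟨j, rfl⟩ := q.1.surjective i
        rcases j with j | j
        · exact congrFun h.1 j
        · exact congrFun h.2 j
      · intro w
        rw [← pw_elim]
        unfold pw
        rw [← Equiv.sum_comp q.1 (fun i => pv k (w i)), Fintype.sum_sum_type, Fintype.sum_sum_type]
        rfl

end VK

namespace VK

lemma primes_many (Y : ℕ) (hY : 2 ^ 24 ≤ Y) (m : ℕ) (hm : m ^ 2 ≤ Y) :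
    ∃ P : Finset ℕ, P.card = m ∧ ∀ p ∈ P, p.Prime ∧ Y < p ∧ p ≤ 4 * Y := by
  set P := (Ioc Y (4 * Y)).filter Nat.Prime with hP
  suffices h : m ≤ P.card by
    obtain ⟨t, ht, hc⟩ := exists_subset_card_eq h
    refine ⟨t, hc, fun p hp => ?_⟩
    have := ht hp
    rw [hP, mem_filter, mem_Ioc] at this
    exact ⟨this.2, this.1⟩
  have hY0 : (2:ℝ) ^ 24 ≤ Y := by exact_mod_cast hY
  have h1 := Chebyshev.theta_ge (4 * Y)
  have h2 := Chebyshev.theta_le_log4_mul_x (x := (Y:ℝ)) (by positivity)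
  have h3 : Chebyshev.theta ((4 * Y : ℕ) : ℝ) - Chebyshev.theta Y ≤ P.card * log (4 * Y) := by
    have e1 : Chebyshev.theta ((4 * Y : ℕ) : ℝ) = Chebyshev.theta Y + ∑ p ∈ P, log p := by
      unfold Chebyshev.theta
      rw [Nat.floor_natCast, Nat.floor_natCast, hP, ← sum_union]
      · rw [← Finset.filter_union, Ioc_union_Ioc_eq_Ioc (by omega) (by omega)]
      · refine Finset.disjoint_filter_filter (disjoint_left.2 fun a ha hb => ?_)
        rw [mem_Ioc] at ha hb; omega
    rw [e1, add_sub_cancel_left, ← nsmul_eq_mul]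
    refine sum_le_card_nsmul _ _ _ fun p hp => ?_
    rw [hP, mem_filter, mem_Ioc] at hp
    exact log_le_log (by exact_mod_cast hp.2.pos) (by exact_mod_cast hp.1.2)
  set r := √√(Y:ℝ) with hr
  have hr2 : r ^ 2 = √(Y:ℝ) := sq_sqrt (sqrt_nonneg _)
  have hr4 : r ^ 4 = Y := by
    rw [show r ^ 4 = (r ^ 2) ^ 2 by ring, hr2]; exact sq_sqrt (by positivity)
  have hr64 : 64 ≤ r := by
    refine le_sqrt_of_sq_le (le_sqrt_of_sq_le (le_trans (by norm_num) hY0))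
  have hlog : log (4 * Y) ≤ 5 * r := by
    rw [← hr4]
    calc log (4 * r ^ 4) ≤ log (r ^ 5) := by
          apply log_le_log (by positivity); nlinarith [pow_pos (show 0 < r by linarith) 4]
      _ = 5 * log r := by rw [log_pow]; norm_num
      _ ≤ 5 * r := by linarith [log_le_sub_one_of_pos (show 0 < r by linarith)]
  have hlog0 : 0 < log (4 * Y) := log_pos (by linarith)
  have hlog1 : log (4 * Y + 1) ≤ 2 * log (4 * Y) := by
    rw [← log_rpow (by linarith)]
    apply log_le_log (by linarith)
    norm_cast; nlinarith
  have hs4 : √((4 * Y : ℕ) : ℝ) = 2 * r ^ 2 := by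
    push_cast
    rw [sqrt_mul (by norm_num), hr2, show (4:ℝ) = 2 ^ 2 by norm_num, sqrt_sq (by norm_num)]
  have hl4 : log 4 = 2 * log 2 := by rw [show (4:ℝ) = 2 ^ 2 by norm_num, log_pow]; norm_num
  have hmr : (m : ℝ) ≤ r ^ 2 := by
    rw [hr2]; apply le_sqrt_of_sq_le; exact_mod_cast hm
  have hl2 := log_two_gt_d9
  by_contra hcon
  push Not at hcon
  have hc : (P.card : ℝ) ≤ r ^ 2 := le_trans (by exact_mod_cast hcon.le) hmr
  rw [hs4] at h1
  push_cast at h1 h3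
  have h5 : (P.card : ℝ) * log (4 * Y) ≤ r ^ 2 * log (4 * Y) := by gcongr
  have h6 : r ^ 2 * log (4 * Y) ≤ r ^ 2 * (5 * r) := by gcongr
  have h7 : log (4 * Y) * 2 ≤ r ^ 2 * log (4 * Y) := by nlinarith
  have h8 : r ^ 3 * 64 ≤ r ^ 4 := by nlinarith [pow_pos (show 0 < r by linarith) 3]
  have h9 : 2 * Y * log 2 ≥ 2 * Y * 0.6 := by gcongr; linarith
  nlinarith

lemma exp3 : (8:ℝ) ≤ exp 3 := by
  have h : exp 3 = exp 1 ^ 3 := by rw [← exp_nat_mul]; norm_num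
  have h2 := exp_one_gt_d9
  rw [h]
  nlinarith [pow_le_pow_left₀ (by norm_num) (show (2:ℝ) ≤ exp 1 by linarith) 3]

lemma fact_le (k τ : ℕ) (hk : 1 ≤ k) (hτ : τ ≤ 10 * k) :
    ((1 + (k * (τ + 2)).factorial * k ^ 3 : ℕ) : ℝ) ≤ exp (172 * (k:ℝ) ^ 3) := by
  have hk' : (1:ℝ) ≤ k := by exact_mod_cast hk
  have h1 : k * (τ + 2) ≤ 12 * k ^ 2 := by nlinarith
  have h2 : (k * (τ + 2)).factorial ≤ (12 * k ^ 2) ^ (12 * k ^ 2) :=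
    (Nat.factorial_le h1).trans (Nat.factorial_le_pow _)
  have hke : (k : ℝ) ≤ exp k := by linarith [add_one_le_exp (k:ℝ)]
  have h3 : ((12 * k ^ 2 : ℕ) : ℝ) ≤ exp (14 * k) := by
    push_cast
    calc (12:ℝ) * k ^ 2 ≤ exp 12 * exp k ^ 2 := by gcongr; linarith [add_one_le_exp (12:ℝ)]
      _ = exp (12 + 2 * k) := by rw [exp_add, ← exp_nat_mul]; norm_num
      _ ≤ _ := by apply exp_le_exp.2; linarith
  have h4 : (((12 * k ^ 2) ^ (12 * k ^ 2) : ℕ) : ℝ) ≤ exp (168 * (k:ℝ) ^ 3) := by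
    rw [Nat.cast_pow]
    calc _ ≤ exp (14 * k) ^ (12 * k ^ 2) := by gcongr
      _ = _ := by rw [← exp_nat_mul]; congr 1; push_cast; ring
  have h5 : ((k * (τ + 2)).factorial : ℝ) ≤ exp (168 * (k:ℝ) ^ 3) := le_trans (by exact_mod_cast h2) h4
  have h6 : (1:ℝ) ≤ exp (168 * (k:ℝ) ^ 3) := one_le_exp (by positivity)
  push_cast
  have hk3 : (k:ℝ) ≤ k ^ 3 := by nlinarith [sq_nonneg ((k:ℝ) - 1)]
  calc (1 + ((k * (τ + 2)).factorial : ℝ) * k ^ 3) ≤ exp (168 * (k:ℝ) ^ 3) * (1 + k ^ 3) := by nlinarith [pow_pos (show (0:ℝ) < k by linarith) 3]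
    _ ≤ exp (168 * (k:ℝ) ^ 3) * exp (k ^ 3) := by gcongr; linarith [add_one_le_exp ((k:ℝ) ^ 3)]
    _ ≤ _ := by rw [← exp_add]; apply exp_le_exp.2; nlinarith [pow_pos (show (0:ℝ) < k by linarith) 3]

/-- exponent -/
noncomputable def ve (k τ : ℕ) : ℝ := 2 * k * (τ + 1) - k * (k + 1) / 2 + k * (k + 1) / 2 * (1 - 1 / k) ^ τ

lemma J_triv (s k X : ℕ) : J s k (Ico 0 (X:ℤ)) ≤ X ^ (2 * s) := by
  refine (En_le_sq _ _).trans ?_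
  rw [tup_card]; simp [← pow_mul, mul_comm]

set_option maxHeartbeats 1000000 in
theorem vmvt (k : ℕ) (hk : 1 ≤ k) (τ : ℕ) (hτ : τ ≤ 10 * k) (X : ℕ) (hX : 1 ≤ X) :
    (J (k * (τ + 1)) k (Ico 0 (X:ℤ)) : ℝ) ≤ exp (500 * (k ^ 4 + k ^ 3 * τ)) * (X:ℝ) ^ ve k τ := by
  have hk' : (1:ℝ) ≤ k := by exact_mod_cast hk
  have hk0 : (0:ℝ) < k := by linarith
  have hinv : (1:ℝ) / k ≤ 1 := by rw [div_le_one hk0]; exact hk'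
  have hinv0 : (0:ℝ) < 1 / k := by positivity
  have small : ∀ τ : ℕ, ∀ X : ℕ, 1 ≤ X → X < (2 ^ 24 * k ^ 6) ^ k → (J (k * (τ + 1)) k (Ico 0 (X:ℤ)) : ℝ) ≤ exp (500 * (k ^ 4 + k ^ 3 * τ)) * (X:ℝ) ^ ve k τ := by
    intro τ X hX hs
    have hX' : (1:ℝ) ≤ X := by exact_mod_cast hX
    have h1 : (J (k * (τ + 1)) k (Ico 0 (X:ℤ)) : ℝ) ≤ (X:ℝ) ^ ((2 * (k * (τ + 1)) : ℕ) : ℝ) := by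
      rw [rpow_natCast]; exact_mod_cast J_triv _ _ _
    have hd : 0 ≤ (1 - 1 / (k:ℝ)) ^ τ := pow_nonneg (by linarith) _
    refine h1.trans ?_
    rw [show ((2 * (k * (τ + 1)) : ℕ) : ℝ) = (k * (k + 1) / 2 - k * (k + 1) / 2 * (1 - 1 / k) ^ τ) + ve k τ by
      unfold ve; push_cast; ring, rpow_add (by linarith)]
    refine mul_le_mul_of_nonneg_right ?_ (by positivity)
    calc (X:ℝ) ^ ((k:ℝ) * (k + 1) / 2 - k * (k + 1) / 2 * (1 - 1 / k) ^ τ) ≤ (X:ℝ) ^ ((k:ℝ) ^ 2) := by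
          apply rpow_le_rpow_of_exponent_le hX'
          have : 0 ≤ (k:ℝ) * (k + 1) / 2 * (1 - 1 / k) ^ τ := by positivity
          nlinarith
      _ ≤ (exp (30 * k * k)) ^ ((k:ℝ) ^ 2) := by
          apply rpow_le_rpow (by positivity) _ (by positivity)
          have h2 : (X:ℝ) ≤ ((2 ^ 24 * k ^ 6) ^ k : ℕ) := by exact_mod_cast hs.le
          refine h2.trans ?_
          rw [Nat.cast_pow, Nat.cast_mul, Nat.cast_pow, Nat.cast_pow, Nat.cast_ofNat]
          have hke : (k : ℝ) ≤ exp k := by linarith [add_one_le_exp (k:ℝ)]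
          calc ((2:ℝ) ^ 24 * k ^ 6) ^ k ≤ (exp 1 ^ 24 * exp k ^ 6) ^ k := by
                gcongr; linarith [add_one_le_exp (1:ℝ)]
            _ = exp ((24 + 6 * k) * k) := by
                rw [← exp_nat_mul, ← exp_nat_mul, ← exp_add, ← exp_nat_mul]; congr 1; push_cast; ring
            _ ≤ _ := by apply exp_le_exp.2; nlinarith
      _ ≤ _ := by
          rw [← exp_mul]; apply exp_le_exp.2
          have : 0 ≤ (k:ℝ) ^ 3 * τ := by positivity
          nlinarith [pow_pos hk0 4]
  induction τ generalizing X with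
  | zero =>
    have h1 : (J (k * (0 + 1)) k (Ico 0 (X:ℤ)) : ℝ) ≤ (X:ℝ) ^ (2 * k) := by
      have := J_triv (k * (0 + 1)) k X
      rw [zero_add, mul_one] at this ⊢
      exact_mod_cast this
    refine h1.trans ?_
    have : ve k 0 = ((2 * k : ℕ) : ℝ) := by unfold ve; push_cast; ring
    rw [this, rpow_natCast]
    exact le_mul_of_one_le_left (by positivity) (one_le_exp (by positivity))
  | succ τ ih =>
    by_cases hs : X < (2 ^ 24 * k ^ 6) ^ k
    · exact small _ X hX hs
    push Not at hs
    have ih := ih (by omega)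
    have hX' : (0:ℝ) < X := by exact_mod_cast hX
    set q : ℝ := log X / k with hq
    have hXq : (X:ℝ) = exp (k * q) := by rw [hq, mul_div_cancel₀ _ hk0.ne', exp_log hX']
    have hQ : ((2 ^ 24 * k ^ 6 : ℕ) : ℝ) ≤ exp q := by
      have h1 : (((2 ^ 24 * k ^ 6) ^ k : ℕ) : ℝ) ≤ X := by exact_mod_cast hs
      rw [hXq, Nat.cast_pow, exp_nat_mul] at h1
      exact le_of_pow_le_pow_left₀ (by omega) (by positivity) h1
    have hQ1 : (1:ℝ) ≤ exp q := le_trans (by exact_mod_cast Nat.one_le_iff_ne_zero.2 (by positivity)) hQ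
    have hq0 : 0 ≤ q := by rw [← one_le_exp_iff]; exact hQ1
    set Y := ⌈exp q⌉₊ with hY
    have hYl : exp q ≤ Y := Nat.le_ceil _
    have hYu : (Y:ℝ) ≤ 2 * exp q := by linarith [Nat.ceil_lt_add_one (exp_pos q).le]
    have hYk : 2 ^ 24 * k ^ 6 ≤ Y := by exact_mod_cast hQ.trans hYl
    have hk6 : 1 ≤ k ^ 6 := Nat.one_le_pow _ _ hk
    obtain ⟨P, hPc, hP⟩ := primes_many Y (by omega) (k ^ 3) (by rw [← pow_mul]; norm_num; omega)
    have hkk : k ≤ k ^ 6 := Nat.le_self_pow (by omega) k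
    have hXY : X ≤ Y ^ k := by
      have : (X:ℝ) ≤ (Y:ℝ) ^ k := by
        rw [hXq, exp_nat_mul]; gcongr
      exact_mod_cast this
    set E := 500 * ((k:ℝ) ^ 4 + k ^ 3 * τ) with hE
    set κ := k * (k - 1) / 2 with hκ
    have hκ2 : (κ : ℝ) = k * (k - 1) / 2 := by
      have : κ * 2 = k * (k - 1) := Nat.div_mul_cancel (Nat.even_mul_pred_self k).two_dvd
      have h2 : ((κ * 2 : ℕ) : ℝ) = ((k * (k - 1) : ℕ) : ℝ) := by rw [this]
      push_cast [Nat.cast_sub hk] at h2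
      linarith
    have hS : k * (τ + 1) = (k * (τ + 1) - 1) + 1 := by
      have : 0 < k * (τ + 1) := by positivity
      omega
    have hτ' : (τ:ℝ) + 1 ≤ 10 * k := by exact_mod_cast hτ
    have hd0 : 0 ≤ (1 - 1 / (k:ℝ)) ^ τ := pow_nonneg (by linarith) _
    have hd1 : (1 - 1 / (k:ℝ)) ^ τ ≤ 1 := pow_le_one₀ (by linarith) (by linarith)
    have hve : 0 ≤ ve k τ := by
      have hb := one_add_mul_le_pow (show (-2:ℝ) ≤ -(1 / k) by linarith) τ
      rw [← sub_eq_add_neg] at hb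
      have : (k:ℝ) * (k + 1) / 2 * (1 + τ * -(1/k)) ≤ k * (k + 1) / 2 * (1 - 1 / k) ^ τ := by gcongr
      have e : (k:ℝ) * (k + 1) / 2 * (1 + τ * -(1/k)) = k * (k + 1) / 2 - τ * (k + 1) / 2 := by field_simp; ring
      have hτk : (τ:ℝ) ≤ τ * k := le_mul_of_one_le_right (by positivity) hk'
      unfold ve; nlinarith
    have hve1 : (2 * k - 2 : ℝ) ≤ ve k (τ + 1) := by
      have hb := one_add_mul_le_pow (show (-2:ℝ) ≤ -(1 / k) by linarith) (τ + 1)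
      rw [← sub_eq_add_neg] at hb
      have : (k:ℝ) * (k + 1) / 2 * (1 + (τ + 1 : ℕ) * -(1/k)) ≤ k * (k + 1) / 2 * (1 - 1 / k) ^ (τ + 1) := by gcongr
      have e : (k:ℝ) * (k + 1) / 2 * (1 + (τ + 1 : ℕ) * -(1/k)) = k * (k + 1) / 2 - (τ + 1) * (k + 1) / 2 := by push_cast; field_simp; ring
      have hτk : (τ:ℝ) ≤ τ * k := le_mul_of_one_le_right (by positivity) hk'
      unfold ve; push_cast; nlinarith
    have hveu : ve k τ ≤ 20 * k ^ 2 := by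
      have : (k:ℝ) * (k + 1) / 2 * (1 - 1 / k) ^ τ ≤ k * (k + 1) / 2 * 1 := by gcongr
      unfold ve; nlinarith
    have hrec : (2 * (k * (τ + 1)) : ℝ) * q + ve k τ * ((k - 1) * q) + κ * q + k * (k * q) = ve k (τ + 1) * (k * q) := by
      rw [hκ2]; unfold ve; push_cast; rw [pow_succ]; field_simp; ring
    have hke : (k : ℝ) ≤ exp k := by linarith [add_one_le_exp (k:ℝ)]
    have hB : ∀ p ∈ P, (p : ℝ) ^ (2 * (k * (τ + 1))) * (J (k * (τ + 1)) k (Ico 0 ((X / p + 1 : ℕ) : ℤ)) * (k ^ k * p ^ κ * X ^ k)) ≤ exp (E + 100 * k ^ 3 + ve k (τ + 1) * (k * q)) := by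
      intro p hp
      obtain ⟨hp1, hp2, hp3⟩ := hP p hp
      have hpu : (p:ℝ) ≤ exp (q + 3) := by
        have : (p:ℝ) ≤ 4 * Y := by exact_mod_cast hp3
        rw [exp_add]
        calc (p:ℝ) ≤ exp q * 8 := by linarith
          _ ≤ _ := by gcongr; exact exp3
      have hXp : ((X / p + 1 : ℕ) : ℝ) ≤ exp (1 + (k - 1) * q) := by
        have h1 : ((X / p : ℕ) : ℝ) ≤ X / p := Nat.cast_div_le
        have h2 : (X:ℝ) / p ≤ X / exp q := by
          apply div_le_div_of_nonneg_left hX'.le (exp_pos _)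
          exact hYl.trans (by exact_mod_cast hp2.le)
        have h3 : X / exp q = exp ((k - 1) * q) := by rw [hXq, ← exp_sub]; congr 1; ring
        have h4 : 1 ≤ exp ((k - 1) * q) := one_le_exp (mul_nonneg (by linarith) hq0)
        rw [exp_add, Nat.cast_add, Nat.cast_one]
        calc _ ≤ 2 * exp ((k - 1) * q) := by linarith
          _ ≤ _ := by gcongr; linarith [add_one_le_exp (1:ℝ)]
      have hJ := ih (X / p + 1) (Nat.succ_pos _)
      have hJ2 : (J (k * (τ + 1)) k (Ico 0 ((X / p + 1 : ℕ) : ℤ)) : ℝ) ≤ exp E * exp ((1 + (k - 1) * q) * ve k τ) := by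
        refine hJ.trans (mul_le_mul_of_nonneg_left ?_ (exp_pos _).le)
        rw [exp_mul]
        exact rpow_le_rpow (by positivity) hXp hve
      calc _ ≤ exp (q + 3) ^ (2 * (k * (τ + 1))) * ((exp E * exp ((1 + (k - 1) * q) * ve k τ)) * (exp k ^ k * exp (q + 3) ^ κ * exp (k * q) ^ k)) := by
            rw [← hXq]
            gcongr
        _ = exp ((2 * (k * (τ + 1))) * (q + 3) + (E + (1 + (k - 1) * q) * ve k τ + (k * k + κ * (q + 3) + k * (k * q)))) := by
            simp only [← exp_nat_mul, ← exp_add]; congr 1; push_cast; ring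
        _ ≤ _ := by
            apply exp_le_exp.2
            have h1 : (k:ℝ) ^ 2 ≤ k ^ 3 := by nlinarith
            have h2 : (κ:ℝ) ≤ k ^ 2 := by rw [hκ2]; nlinarith
            have h3 : (k:ℝ) * (τ + 1) ≤ k * (10 * k) := by gcongr
            linarith
    have hJs := J_step k (k * (τ + 1) - 1) X Y hk (by omega) (by omega) hXY P (fun p hp => ⟨(hP p hp).1, (hP p hp).2.1⟩)
      hPc.ge (exp (E + 100 * k ^ 3 + ve k (τ + 1) * (k * q))) (by rw [← hS]; exact hB)
    rw [← hS, hPc, show k + k * (τ + 1) = k * (τ + 1 + 1) by ring] at hJs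
    have hM := fact_le k τ hk (by omega)
    rw [show k * (τ + 2) = k * (τ + 1 + 1) by ring] at hM
    set M : ℝ := ((1 + (k * (τ + 1 + 1)).factorial * k ^ 3 : ℕ) : ℝ) with hMdef
    have hM2 : (((k * (τ + 1 + 1)).factorial * k ^ 3 : ℕ) : ℝ) ≤ exp (172 * (k:ℝ) ^ 3) := by
      refine le_trans ?_ hM; rw [hMdef]; exact_mod_cast Nat.le_add_left _ _
    have hbad : (((k - 1) ^ (k * (τ + 1 + 1)) * X ^ (k - 1) : ℕ) : ℝ) ^ 2 ≤ exp (24 * k ^ 3 + ve k (τ + 1) * (k * q)) := by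
      have h1 : (((k - 1) ^ (k * (τ + 1 + 1)) * X ^ (k - 1) : ℕ) : ℝ) ≤ exp k ^ (k * (τ + 1 + 1)) * exp (k * q) ^ (k - 1) := by
        rw [← hXq, Nat.cast_mul, Nat.cast_pow, Nat.cast_pow]
        gcongr
        exact le_trans (by exact_mod_cast Nat.sub_le k 1) hke
      calc _ ≤ (exp k ^ (k * (τ + 1 + 1)) * exp (k * q) ^ (k - 1)) ^ 2 := by gcongr
        _ = exp (2 * (k * (τ + 1 + 1) * k + (k - 1) * (k * q))) := by
            simp only [← exp_nat_mul, ← exp_add]; congr 1; push_cast [Nat.cast_sub hk]; ring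
        _ ≤ _ := by
            apply exp_le_exp.2
            have : (2 * k - 2) * (k * q) ≤ ve k (τ + 1) * (k * q) := by gcongr
            have h1 : (k:ℝ) * (τ + 1 + 1) * k ≤ k * (12 * k) * k := by gcongr; linarith
            nlinarith
    have hL : (0:ℝ) < k ^ 3 := by positivity
    have hL1 : (1:ℝ) ≤ k ^ 3 := one_le_pow₀ hk'
    have hE0 : 0 ≤ E := by positivity
    refine hJs.trans ?_
    calc _ ≤ exp (172 * k ^ 3) * (exp (24 * k ^ 3 + ve k (τ + 1) * (k * q)) + exp (172 * k ^ 3) * exp (E + 100 * k ^ 3 + ve k (τ + 1) * (k * q))) := by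
          gcongr
      _ ≤ exp (172 * k ^ 3) * (exp (E + 272 * k ^ 3 + ve k (τ + 1) * (k * q)) + exp (E + 272 * k ^ 3 + ve k (τ + 1) * (k * q))) := by
          rw [← exp_add (172 * (k:ℝ) ^ 3) (E + 100 * k ^ 3 + _)]
          refine mul_le_mul_of_nonneg_left (add_le_add (exp_le_exp.2 ?_) (exp_le_exp.2 ?_)) (exp_pos _).le <;> linarith
      _ = 2 * exp (E + 444 * k ^ 3 + ve k (τ + 1) * (k * q)) := by
          rw [← two_mul, mul_left_comm, ← exp_add]; congr 2; ring
      _ ≤ exp 1 * exp (E + 444 * k ^ 3 + ve k (τ + 1) * (k * q)) := by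
          gcongr; linarith [add_one_le_exp (1:ℝ)]
      _ ≤ _ := by
          rw [hXq, ← exp_mul, ← exp_add, ← exp_add]
          apply exp_le_exp.2
          rw [hE]; push_cast
          nlinarith

end VK

namespace VK

noncomputable def ee (θ : ℝ) : ℂ := Complex.exp ((2 * π * θ : ℝ) * I)

lemma ee_norm (θ : ℝ) : ‖ee θ‖ = 1 := Complex.norm_exp_ofReal_mul_I _

lemma ee_add (a b : ℝ) : ee (a + b) = ee a * ee b := by
  unfold ee; rw [← Complex.exp_add]; congr 1; push_cast; ring

lemma ee_zero : ee 0 = 1 := by simp [ee]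

lemma ee_sum {ι : Type*} (s : Finset ι) (f : ι → ℝ) : ee (∑ i ∈ s, f i) = ∏ i ∈ s, ee (f i) := by
  classical
  induction s using induction_on with
  | empty => simp [ee_zero]
  | insert a s ha ih => rw [sum_insert ha, prod_insert ha, ee_add, ih]

lemma ee_neg (a : ℝ) : ee (-a) = (starRingEnd ℂ) (ee a) := by
  unfold ee
  rw [← Complex.exp_conj]; congr 1
  rw [map_mul, conj_ofReal, Complex.conj_I]; push_cast; ring

/-- dot product -/
noncomputable def dt {k : ℕ} (β : Fin k → ℝ) (m : Fin k → ℤ) : ℝ := ∑ j, β j * m j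

lemma dt_add {k : ℕ} (β : Fin k → ℝ) (m n : Fin k → ℤ) : dt β (m + n) = dt β m + dt β n := by
  simp [dt, mul_add, sum_add_distrib]

lemma dt_sub {k : ℕ} (β : Fin k → ℝ) (m n : Fin k → ℤ) : dt β (m - n) = dt β m - dt β n := by
  simp [dt, mul_sub, sum_sub_distrib]

noncomputable def FF {k : ℕ} (A : Finset ℤ) (β : Fin k → ℝ) : ℂ := ∑ y ∈ A, ee (dt β (pv k y))

lemma FF_pow {k : ℕ} (A : Finset ℤ) (β : Fin k → ℝ) (s : ℕ) :
    ((‖FF A β‖ ^ (2 * s) : ℝ) : ℂ) = ∑ z ∈ tup (Fin s) A ×ˢ tup (Fin s) A, ee (dt β (pw k z.1 - pw k z.2)) := by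
  have h1 : (FF A β) ^ s = ∑ u ∈ tup (Fin s) A, ee (dt β (pw k u)) := by
    have h2 : ∀ u : Fin s → ℤ, ee (dt β (pw k u)) = ∏ i, ee (dt β (pv k (u i))) := by
      intro u
      rw [← ee_sum]; congr 1
      unfold dt pw
      rw [sum_comm]
      refine sum_congr rfl fun j _ => ?_
      simp [mul_sum]
    simp_rw [h2, tup]
    rw [sum_prod_piFinset A (fun _ n => ee (dt β (pv k n)))]
    simp [FF]
  rw [pow_mul, ← normSq_eq_norm_sq, ofReal_pow, ← mul_conj, mul_pow, ← map_pow, h1, map_sum,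
    sum_mul_sum, sum_product]
  refine sum_congr rfl fun u _ => sum_congr rfl fun v _ => ?_
  rw [← ee_neg, ← ee_add, dt_sub, sub_eq_add_neg]

noncomputable def Box (k s q : ℕ) : Finset (Fin k → ℤ) :=
  Fintype.piFinset (fun j : Fin k => Icc (-((s * q ^ (j.1 + 1) : ℕ) : ℤ)) ((s * q ^ (j.1 + 1) : ℕ) : ℤ))

lemma pw_bd (k s q : ℕ) (u : Fin s → ℤ) (hu : u ∈ tup (Fin s) (Ico 0 (q:ℤ))) (j : Fin k) :
    0 ≤ pw k u j ∧ pw k u j ≤ ((s * q ^ (j.1 + 1) : ℕ) : ℤ) := by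
  simp only [tup, Fintype.mem_piFinset, mem_Ico] at hu
  rw [pw_apply]
  refine ⟨sum_nonneg fun i _ => pow_nonneg (hu i).1 _, ?_⟩
  refine (sum_le_card_nsmul _ _ ((q:ℤ) ^ (j.1 + 1)) fun i _ => pow_le_pow_left₀ (hu i).1 (hu i).2.le _).trans ?_
  simp

lemma box_sum (k s q : ℕ) (g : (Fin k → ℤ) → ℝ) (hg : ∀ m, 0 ≤ g m) :
    ∑ z ∈ tup (Fin s) (Ico 0 (q:ℤ)) ×ˢ tup (Fin s) (Ico 0 (q:ℤ)), g (pw k z.1 - pw k z.2) ≤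
      J s k (Ico 0 (q:ℤ)) * ∑ m ∈ Box k s q, g m := by
  classical
  rw [← sum_fiberwise_of_maps_to (t := Box k s q) (g := fun z => pw k z.1 - pw k z.2), mul_sum]
  · refine sum_le_sum fun m _ => ?_
    rw [sum_congr rfl (g := fun _ => g m) (fun z hz => by rw [(mem_filter.1 hz).2]), sum_const, nsmul_eq_mul]
    refine mul_le_mul_of_nonneg_right ?_ (hg m)
    have := En_shift (tup (Fin s) (Ico 0 (q:ℤ))) (pw k) (-m)
    norm_cast
    refine le_trans (le_of_eq ?_) this
    congr 1
    refine Finset.filter_congr fun z _ => ?_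
    rw [← sub_eq_add_neg, sub_eq_iff_eq_add, sub_eq_iff_eq_add, add_comm]
  · intro z hz
    rw [mem_product] at hz
    rw [Box, Fintype.mem_piFinset]
    intro j
    have h1 := pw_bd k s q _ hz.1 j
    have h2 := pw_bd k s q _ hz.2 j
    rw [mem_Icc, Pi.sub_apply]
    omega

noncomputable def TT (c : ℝ) (L : ℕ) : ℝ :=
  ∑ m ∈ Icc (-(L:ℤ)) L, ‖∑ l ∈ Icc (-(L:ℤ)) L, ee (c * l * m)‖

lemma card_Ico0 (q : ℕ) : (Ico 0 (q:ℤ)).card = q := by simp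

theorem bilinear (k s q : ℕ) (hs : 1 ≤ s) (α : Fin k → ℝ) :
    ‖∑ x ∈ Ico 0 (q:ℤ), ∑ y ∈ Ico 0 (q:ℤ), ee (dt α (pv k (x * y)))‖ ^ (4 * s ^ 2) ≤
      (q:ℝ) ^ (8 * s ^ 2 - 4 * s) * (J s k (Ico 0 (q:ℤ)) : ℝ) ^ 2 * ∏ j : Fin k, TT (α j) (s * q ^ (j.1 + 1)) := by
  set A := Ico 0 (q:ℤ) with hA
  set T := tup (Fin s) A with hT
  have hTc : (T ×ˢ T).card = q ^ (2 * s) := by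
    rw [card_product, hT, tup_card, hA, card_Ico0, Fintype.card_fin]; ring
  obtain ⟨s', hs'⟩ : ∃ s', 2 * s = s' + 1 := ⟨2 * s - 1, by omega⟩
  let d : (Fin s → ℤ) × (Fin s → ℤ) → Fin k → ℤ := fun z => pw k z.1 - pw k z.2
  have hsym : ∀ m : Fin k → ℤ, ∀ x : ℤ, dt (fun j => α j * ((x:ℝ) ^ (j.1 + 1))) m = dt (fun j => α j * m j) (pv k x) := by
    intro m x; unfold dt; refine sum_congr rfl fun j _ => ?_
    simp only [pv]; push_cast; ring
  have step1 : ‖∑ x ∈ A, ∑ y ∈ A, ee (dt α (pv k (x * y)))‖ ^ (2 * s) ≤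
      (q:ℝ) ^ s' * ∑ z ∈ T ×ˢ T, ‖FF A (fun j => α j * d z j)‖ := by
    calc _ ≤ (∑ x ∈ A, ‖FF A (fun j : Fin k => α j * ((x:ℝ) ^ (j.1 + 1)))‖) ^ (2 * s) := by
          refine pow_le_pow_left₀ (norm_nonneg _) ((norm_sum_le _ _).trans (sum_le_sum fun x _ => le_of_eq ?_)) _
          unfold FF; congr 1; refine sum_congr rfl fun y _ => ?_
          congr 1; unfold dt; refine sum_congr rfl fun j _ => ?_
          simp only [pv]; push_cast; ring
      _ ≤ (q:ℝ) ^ s' * ∑ x ∈ A, ‖FF A (fun j : Fin k => α j * ((x:ℝ) ^ (j.1 + 1)))‖ ^ (2 * s) := by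
          have := pow_sum_le_card_mul_sum_pow (s := A) (f := fun x : ℤ => ‖FF A (fun j : Fin k => α j * ((x:ℝ) ^ (j.1 + 1)))‖) (fun _ _ => norm_nonneg _) s'
          rw [hA, card_Ico0] at this
          rw [hs']; exact this
      _ ≤ _ := by
          refine mul_le_mul_of_nonneg_left ?_ (by positivity)
          have h1 : ((∑ x ∈ A, ‖FF A (fun j : Fin k => α j * ((x:ℝ) ^ (j.1 + 1)))‖ ^ (2 * s) : ℝ) : ℂ) =
              ∑ z ∈ T ×ˢ T, FF A (fun j => α j * d z j) := by
            rw [ofReal_sum]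
            simp_rw [FF_pow]
            rw [sum_comm]
            refine sum_congr rfl fun z _ => sum_congr rfl fun x _ => ?_
            rw [hsym]
          have h2 : (0:ℝ) ≤ ∑ x ∈ A, ‖FF A (fun j : Fin k => α j * ((x:ℝ) ^ (j.1 + 1)))‖ ^ (2 * s) := by positivity
          rw [← Complex.norm_of_nonneg h2, h1]
          exact norm_sum_le _ _
  have step2 : (∑ z ∈ T ×ˢ T, ‖FF A (fun j => α j * d z j)‖) ^ (2 * s) ≤
      (q:ℝ) ^ (2 * s * s') * (J s k A * (J s k A * ∏ j : Fin k, TT (α j) (s * q ^ (j.1 + 1)))) := by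
    calc _ ≤ (q:ℝ) ^ (2 * s * s') * ∑ z ∈ T ×ˢ T, ‖FF A (fun j => α j * d z j)‖ ^ (2 * s) := by
          have := pow_sum_le_card_mul_sum_pow (s := T ×ˢ T) (f := fun z => ‖FF A (fun j => α j * d z j)‖) (fun _ _ => norm_nonneg _) s'
          rw [hTc] at this
          push_cast at this
          rw [pow_mul (q:ℝ) (2 * s) s']
          have h9 : ∀ n, n = s' + 1 → (∑ z ∈ T ×ˢ T, ‖FF A (fun j => α j * d z j)‖) ^ n ≤ ((q:ℝ) ^ (2 * s)) ^ s' * ∑ z ∈ T ×ˢ T, ‖FF A (fun j => α j * d z j)‖ ^ n := by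
            rintro n rfl; exact this
          exact h9 _ hs'
      _ ≤ (q:ℝ) ^ (2 * s * s') * (J s k A * ∑ m ∈ Box k s q, ‖FF A (fun j => α j * m j)‖ ^ (2 * s)) := by
          refine mul_le_mul_of_nonneg_left ?_ (by positivity)
          exact box_sum k s q (fun m => ‖FF A (fun j => α j * m j)‖ ^ (2 * s)) (fun _ => by positivity)
      _ ≤ (q:ℝ) ^ (2 * s * s') * (J s k A * ∑ z ∈ T ×ˢ T, ‖∑ m ∈ Box k s q, ee (dt (fun j => α j * m j) (d z))‖) := by
          refine mul_le_mul_of_nonneg_left (mul_le_mul_of_nonneg_left ?_ (by positivity)) (by positivity)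
          have h1 : ((∑ m ∈ Box k s q, ‖FF A (fun j => α j * m j)‖ ^ (2 * s) : ℝ) : ℂ) =
              ∑ z ∈ T ×ˢ T, ∑ m ∈ Box k s q, ee (dt (fun j => α j * m j) (d z)) := by
            rw [ofReal_sum]
            simp_rw [FF_pow]
            rw [sum_comm]
          have h2 : (0:ℝ) ≤ ∑ m ∈ Box k s q, ‖FF A (fun j => α j * m j)‖ ^ (2 * s) := by positivity
          rw [← Complex.norm_of_nonneg h2, h1]
          exact norm_sum_le _ _
      _ ≤ (q:ℝ) ^ (2 * s * s') * (J s k A * (J s k A * ∑ n ∈ Box k s q, ‖∑ m ∈ Box k s q, ee (dt (fun j => α j * m j) n)‖)) := by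
          refine mul_le_mul_of_nonneg_left (mul_le_mul_of_nonneg_left ?_ (by positivity)) (by positivity)
          exact box_sum k s q (fun n => ‖∑ m ∈ Box k s q, ee (dt (fun j => α j * m j) n)‖) (fun _ => norm_nonneg _)
      _ = _ := by
          congr 3
          unfold TT Box
          rw [prod_univ_sum]
          refine sum_congr rfl fun n _ => ?_
          rw [← norm_prod, prod_univ_sum]
          congr 1
          refine sum_congr rfl fun m _ => ?_
          unfold dt
          rw [ee_sum]
  have h4 : 4 * s ^ 2 = 2 * s * (2 * s) := by ring
  have hss : 8 * s ^ 2 - 4 * s = s' * (2 * s) + 2 * s * s' := by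
    have : s' = 2 * s - 1 := by omega
    rw [this]
    zify [show 1 ≤ 2 * s by omega, show 4 * s ≤ 8 * s ^ 2 by nlinarith]
    ring
  rw [h4, pow_mul]
  calc _ ≤ ((q:ℝ) ^ s' * ∑ z ∈ T ×ˢ T, ‖FF A (fun j => α j * d z j)‖) ^ (2 * s) := pow_le_pow_left₀ (by positivity) step1 _
    _ ≤ ((q:ℝ) ^ s') ^ (2 * s) * ((q:ℝ) ^ (2 * s * s') * (J s k A * (J s k A * ∏ j : Fin k, TT (α j) (s * q ^ (j.1 + 1))))) := by
        rw [mul_pow]; exact mul_le_mul_of_nonneg_left step2 (by positivity)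
    _ = _ := by rw [hss, pow_add, pow_mul]; ring

end VK

namespace VK

lemma ee_int_mul (θ : ℝ) (l : ℤ) : ee (θ * l) = ee θ ^ l := by
  unfold ee; rw [← Complex.exp_int_mul]; congr 1; push_cast; ring

lemma ee_int (h : ℤ) : ee h = 1 := by
  unfold ee
  rw [Complex.exp_eq_one_iff]; exact ⟨h, by push_cast; ring⟩

lemma ee_sub_one (θ : ℝ) (δ : ℝ) (hδ : δ ≤ |θ - round θ|) : 4 * δ ≤ ‖ee θ - 1‖ := by
  have h1 : ee θ = ee (θ - round θ) := by
    have : ee θ = ee (θ - round θ) * ee (round θ) := by rw [← ee_add]; congr 1; ring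
    rw [this, ee_int, mul_one]
  set r := θ - round θ with hr
  have h2 : |r| ≤ 1 / 2 := abs_sub_round θ
  rw [h1]
  unfold ee
  rw [mul_comm _ I, Complex.norm_exp_I_mul_ofReal_sub_one, norm_mul, Real.norm_eq_abs, Real.norm_eq_abs]
  have h3 : |2 * π * r / 2| ≤ π / 2 := by
    rw [show 2 * π * r / 2 = π * r by ring, abs_mul, abs_of_pos pi_pos]
    nlinarith [pi_pos]
  have h4 := Real.mul_abs_le_abs_sin h3
  rw [show 2 * π * r / 2 = π * r by ring, abs_mul, abs_of_pos pi_pos] at h4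
  rw [show 2 * π * r / 2 = π * r by ring, abs_two]
  have : 2 / π * (π * |r|) = 2 * |r| := by field_simp
  linarith

lemma geom_bd (θ δ : ℝ) (hδ0 : 0 < δ) (hδ : δ ≤ |θ - round θ|) (L : ℕ) :
    ‖∑ l ∈ Icc (-(L:ℤ)) L, ee (θ * l)‖ ≤ 1 / δ := by
  have h1 := ee_sub_one θ δ hδ
  set S := ∑ l ∈ Icc (-(L:ℤ)) L, ee (θ * l) with hS
  have hne : ee θ ≠ 0 := by rw [← norm_pos_iff, ee_norm]; norm_num
  have h2 : ∀ M : ℕ, (ee θ - 1) * ∑ l ∈ Icc (-(M:ℤ)) M, ee (θ * l) = ee θ ^ ((M:ℤ) + 1) - ee θ ^ (-(M:ℤ)) := by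
    intro M
    induction M with
    | zero => simp [ee_zero]
    | succ M ih =>
      have : Icc (-((M+1:ℕ):ℤ)) ((M+1:ℕ):ℤ) = insert (-((M+1:ℕ):ℤ)) (insert (((M+1:ℕ):ℤ)) (Icc (-(M:ℤ)) M)) := by
        ext a; simp only [mem_Icc, mem_insert]; omega
      rw [this, sum_insert (by simp; omega), sum_insert (by simp), mul_add, mul_add, ih, ee_int_mul, ee_int_mul]
      rw [sub_mul, sub_mul, ← zpow_one_add₀ hne, ← zpow_one_add₀ hne]
      push_cast
      rw [show (1:ℤ) + -((M:ℤ)+1) = -M by ring, show (1:ℤ) + ((M:ℤ)+1) = M + 1 + 1 by ring]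
      ring
  have h3 : ‖ee θ - 1‖ * ‖S‖ ≤ 2 := by
    rw [← norm_mul, h2]
    refine (norm_sub_le _ _).trans ?_
    rw [norm_zpow, norm_zpow, ee_norm, one_zpow, one_zpow]; norm_num
  rw [le_div_iff₀ hδ0]
  nlinarith [norm_nonneg S]

lemma norm_sum_ee_le {ι : Type*} (s : Finset ι) (f : ι → ℝ) : ‖∑ i ∈ s, ee (f i)‖ ≤ s.card := by
  refine (norm_sum_le _ _).trans ?_
  simp [ee_norm]

lemma cardIcc (L : ℕ) : ((Icc (-(L:ℤ)) L).card : ℝ) = 2 * L + 1 := by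
  rw [Int.card_Icc]
  have : ((L:ℤ) + 1 - -(L:ℤ)).toNat = 2 * L + 1 := by omega
  rw [this]; push_cast; ring

lemma TT_triv (c : ℝ) (L : ℕ) : TT c L ≤ (2 * L + 1) ^ 2 := by
  unfold TT
  refine (sum_le_card_nsmul _ _ (2 * (L:ℝ) + 1) fun m _ => ?_).trans ?_
  · refine (norm_sum_ee_le _ _).trans (cardIcc L).le
  · rw [nsmul_eq_mul, cardIcc]; exact (sq _).ge

lemma card_int_le (S : Finset ℤ) (D : ℝ) (hD : 0 ≤ D) (h : ∀ a ∈ S, ∀ b ∈ S, ((b:ℝ) - a) ≤ D) : (S.card : ℝ) ≤ D + 1 := by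
  rcases S.eq_empty_or_nonempty with rfl | hne
  · simp; linarith
  · have h1 : S ⊆ Icc (S.min' hne) (S.max' hne) := fun a ha => mem_Icc.2 ⟨S.min'_le a ha, S.le_max' a ha⟩
    have h2 := card_le_card h1
    rw [Int.card_Icc] at h2
    have h3 := h _ (S.min'_mem hne) _ (S.max'_mem hne)
    have h4 : S.min' hne ≤ S.max' hne := S.min'_le _ (S.max'_mem hne)
    have h5 : (S.card : ℤ) ≤ S.max' hne + 1 - S.min' hne := by omega
    have h6 : (S.card : ℝ) ≤ S.max' hne + 1 - S.min' hne := by exact_mod_cast h5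
    linarith

lemma bad_count (c δ : ℝ) (hc : c ≠ 0) (hδ : 0 < δ) (L : ℕ) :
    (((Icc (-(L:ℤ)) L).filter (fun m : ℤ => |c * m - round (c * m)| < δ)).card : ℝ) ≤
      (2 * |c| * L + 3) * (2 * δ / |c| + 1) := by
  classical
  have hc' : 0 < |c| := abs_pos.2 hc
  set B := (Icc (-(L:ℤ)) L).filter (fun m : ℤ => |c * m - round (c * m)| < δ) with hB
  set H := B.image (fun m : ℤ => round (c * m)) with hH
  have hm : ∀ m ∈ B, |(m:ℝ)| ≤ L ∧ |c * m - round (c * m)| < δ := by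
    intro m hm
    rw [hB, mem_filter, mem_Icc] at hm
    refine ⟨abs_le.2 ⟨by exact_mod_cast hm.1.1, by exact_mod_cast hm.1.2⟩, hm.2⟩
  have hHb : ∀ h ∈ H, |(h:ℝ)| ≤ |c| * L + 1 / 2 := by
    intro h hh
    obtain ⟨m, hmB, rfl⟩ := mem_image.1 hh
    have h1 := abs_sub_round (c * m)
    have h2 : |c * m| ≤ |c| * L := by rw [abs_mul]; exact mul_le_mul_of_nonneg_left (hm m hmB).1 hc'.le
    have h3 := abs_sub_abs_le_abs_sub ((round (c * m) : ℤ) : ℝ) (c * m)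
    rw [abs_sub_comm] at h3
    linarith
  have hHc : (H.card : ℝ) ≤ (2 * (|c| * L + 1 / 2)) + 1 := by
    refine card_int_le _ _ (by positivity) fun a ha b hb => ?_
    have h1 := abs_le.1 (hHb a ha); have h2 := abs_le.1 (hHb b hb)
    linarith
  have hfib : ∀ h ∈ H, ((B.filter (fun m : ℤ => round (c * m) = h)).card : ℝ) ≤ 2 * δ / |c| + 1 := by
    intro h _
    refine card_int_le _ _ (by positivity) fun a ha b hb => ?_
    rw [mem_filter] at ha hb
    have h1 := (hm a ha.1).2; have h2 := (hm b hb.1).2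
    rw [ha.2] at h1; rw [hb.2] at h2
    rw [le_div_iff₀ hc']
    have h3 : |c * (b - a)| ≤ 2 * δ := by
      rw [show c * ((b:ℝ) - a) = (c * b - h) - (c * a - h) by ring]
      refine (abs_sub _ _).trans ?_
      linarith
    rw [abs_mul] at h3
    nlinarith [le_abs_self ((b:ℝ) - a)]
  have h1 : B.card = ∑ h ∈ H, (B.filter (fun m : ℤ => round (c * m) = h)).card :=
    Finset.card_eq_sum_card_image _ _
  rw [h1]; push_cast
  refine (sum_le_card_nsmul _ _ _ hfib).trans ?_
  rw [nsmul_eq_mul]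
  refine mul_le_mul_of_nonneg_right ?_ (by positivity)
  linarith

lemma TT_bd (c δ : ℝ) (hc : c ≠ 0) (hδ : 0 < δ) (L : ℕ) :
    TT c L ≤ (2 * L + 1) * ((2 * |c| * L + 3) * (2 * δ / |c| + 1) + 1 / δ) := by
  classical
  unfold TT
  rw [← Finset.sum_filter_add_sum_filter_not _ (fun m : ℤ => |c * m - round (c * m)| < δ), mul_add]
  have he : ∀ l m : ℤ, ee (c * l * m) = ee ((c * m) * l) := fun l m => by congr 1; ring
  refine add_le_add ?_ ?_
  · refine (sum_le_card_nsmul _ _ (2 * (L:ℝ) + 1) fun m _ => (norm_sum_ee_le _ _).trans (cardIcc L).le).trans ?_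
    rw [nsmul_eq_mul, mul_comm]
    exact mul_le_mul_of_nonneg_left (bad_count c δ hc hδ L) (by positivity)
  · refine (sum_le_card_nsmul _ _ (1 / δ) fun m hm => ?_).trans ?_
    · rw [mem_filter, not_lt] at hm
      simp_rw [he]
      exact geom_bd _ _ hδ hm.2 L
    · rw [nsmul_eq_mul, ← cardIcc]
      refine mul_le_mul_of_nonneg_right ?_ (by positivity)
      exact_mod_cast card_le_card (Finset.filter_subset _ _)

lemma aux100 (j : ℕ) (hj : 1 ≤ j) : 15 + 2 * π * j * 8 ^ j ≤ 3 * 100 ^ j := by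
  have hj2 : (j:ℝ) ≤ 2 ^ j := by exact_mod_cast (Nat.lt_two_pow_self).le
  have h16 : (2:ℝ) ^ j * 8 ^ j = 16 ^ j := by rw [← mul_pow]; norm_num
  have h1 : 2 * π * j * 8 ^ j ≤ 8 * 16 ^ j := by
    rw [← h16, ← mul_assoc]
    refine mul_le_mul_of_nonneg_right ?_ (by positivity)
    have := pi_lt_four
    have : (0:ℝ) ≤ j := by positivity
    nlinarith
  have h6 : (6:ℝ) ^ j * 16 ^ j ≤ 100 ^ j := by rw [← mul_pow]; exact pow_le_pow_left₀ (by norm_num) (by norm_num) _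
  have h66 : (6:ℝ) ≤ 6 ^ j := by simpa using pow_le_pow_right₀ (by norm_num : (1:ℝ) ≤ 6) hj
  have h16' : (16:ℝ) ≤ 16 ^ j := by simpa using pow_le_pow_right₀ (by norm_num : (1:ℝ) ≤ 16) hj
  have := mul_le_mul_of_nonneg_right h66 (by positivity : (0:ℝ) ≤ 16 ^ j)
  linarith

lemma TT_good (j q s : ℕ) (ℓ κ n c : ℝ) (hj : 1 ≤ j) (hs : 1 ≤ s) (hℓ : 2 ≤ ℓ) (hκ1 : 2 * κ ≤ j) (hκ2 : j ≤ 6 * κ)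
    (hq1 : exp (9 / 20 * ℓ) / 2 ≤ q) (hq2 : q ≤ exp (9 / 20 * ℓ)) (hn1 : exp ℓ ≤ n) (hn2 : n ≤ 2 * exp ℓ)
    (hc : |c| = exp (κ * ℓ) / (2 * π * j * n ^ j)) :
    TT c (s * q ^ j) ≤ (3 * (s * q ^ j)) ^ 2 * (100 ^ j * exp (-(j * ℓ / 50))) := by
  have hj0 : (1:ℝ) ≤ j := by exact_mod_cast hj
  have hs0 : (1:ℝ) ≤ s := by exact_mod_cast hs
  have hn0 : 0 < n := (exp_pos _).trans_le hn1
  have hc0 : 0 < |c| := by rw [hc]; have := pi_pos; positivity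
  have hq0 : (0:ℝ) < q := lt_of_lt_of_le (by positivity) hq1
  have hqj1 : exp (9 / 20 * (j * ℓ)) / 2 ^ j ≤ (q:ℝ) ^ j := by
    rw [show exp (9 / 20 * (j * ℓ)) = exp (9 / 20 * ℓ) ^ j by rw [← exp_nat_mul]; congr 1; ring, ← div_pow]
    exact pow_le_pow_left₀ (by positivity) hq1 j
  have hqj2 : (q:ℝ) ^ j ≤ exp (9 / 20 * (j * ℓ)) := by
    rw [show exp (9 / 20 * (j * ℓ)) = exp (9 / 20 * ℓ) ^ j by rw [← exp_nat_mul]; congr 1; ring]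
    exact pow_le_pow_left₀ (by positivity) hq2 j
  have hnj1 : exp (j * ℓ) ≤ n ^ j := by
    rw [exp_nat_mul]; exact pow_le_pow_left₀ (by positivity) hn1 j
  have hnj2 : n ^ j ≤ 2 ^ j * exp (j * ℓ) := by
    rw [exp_nat_mul, ← mul_pow]; exact pow_le_pow_left₀ (by positivity) hn2 j
  set Q : ℝ := (q:ℝ) ^ j with hQ
  set η := exp (-(j * ℓ / 50)) with hη
  have hQ0 : 0 < Q := by positivity
  have hη0 : 0 < η := exp_pos _
  have hjl : 2 * (j:ℝ) ≤ j * ℓ := by nlinarith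
  have hηQ : 1 ≤ η * Q := by
    have h2 : (2:ℝ) ^ j ≤ exp (j * 0.7) := by
      rw [exp_nat_mul]; refine pow_le_pow_left₀ (by norm_num) ?_ _
      have := Real.log_two_lt_d9
      rw [← Real.log_le_iff_le_exp (by norm_num)]; linarith
    have h3 : (2:ℝ) ^ j * 1 ≤ (2:ℝ) ^ j * (η * Q) := by
      calc (2:ℝ) ^ j * 1 ≤ exp (j * 0.7) := by linarith
        _ ≤ η * exp (9 / 20 * (j * ℓ)) := by
            rw [hη, ← exp_add]; apply exp_le_exp.2; linarith
        _ ≤ η * (2 ^ j * Q) := by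
            refine mul_le_mul_of_nonneg_left ?_ hη0.le
            rw [div_le_iff₀ (by positivity)] at hqj1; linarith
        _ = _ := by ring
    exact le_of_mul_le_mul_left h3 (by positivity)
  have hcQ : |c| * Q ≤ 1 := by
    rw [hc, div_mul_eq_mul_div, div_le_one (by have := pi_pos; positivity)]
    calc exp (κ * ℓ) * Q ≤ exp (κ * ℓ) * exp (9 / 20 * (j * ℓ)) := by gcongr
      _ ≤ exp (j * ℓ) := by rw [← exp_add]; apply exp_le_exp.2; nlinarith
      _ ≤ 1 * n ^ j := by linarith
      _ ≤ 2 * π * j * n ^ j := by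
          refine mul_le_mul_of_nonneg_right ?_ (by positivity)
          nlinarith [pi_gt_three]
  set δ := η * |c| * Q with hδ
  have hδ0 : 0 < δ := by positivity
  have h1δ : 1 / δ ≤ (2 * π * j * 8 ^ j) * (η * Q) := by
    rw [div_le_iff₀ hδ0, hδ, hc]
    rw [show 2 * π * ↑j * 8 ^ j * (η * Q) * (η * (exp (κ * ℓ) / (2 * π * ↑j * n ^ j)) * Q) =
      (8 ^ j * (η * η) * (Q * Q) * exp (κ * ℓ)) / n ^ j by field_simp]
    rw [le_div_iff₀ (by positivity), one_mul]
    calc n ^ j ≤ 2 ^ j * exp (j * ℓ) := hnj2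
      _ ≤ 8 ^ j * (η * η) * (exp (9 / 20 * (j * ℓ)) / 2 ^ j * (exp (9 / 20 * (j * ℓ)) / 2 ^ j)) * exp (κ * ℓ) := by
          have h8 : (8:ℝ) ^ j = 2 ^ j * 2 ^ j * 2 ^ j := by rw [← mul_pow, ← mul_pow]; norm_num
          rw [h8]
          rw [show (2:ℝ) ^ j * 2 ^ j * 2 ^ j * (η * η) * (exp (9 / 20 * (j * ℓ)) / 2 ^ j * (exp (9 / 20 * (j * ℓ)) / 2 ^ j)) * exp (κ * ℓ)
            = 2 ^ j * (η * η * (exp (9 / 20 * (j * ℓ)) * exp (9 / 20 * (j * ℓ))) * exp (κ * ℓ)) by field_simp]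
          refine mul_le_mul_of_nonneg_left ?_ (by positivity)
          rw [hη, ← exp_add, ← exp_add, ← exp_add, ← exp_add]
          apply exp_le_exp.2; nlinarith
      _ ≤ _ := by gcongr
  have hL : (((s * q ^ j : ℕ) : ℝ)) = s * Q := by push_cast; rfl
  have hsQ : 1 ≤ s * Q := by
    have : (1:ℕ) ≤ s * q ^ j := Nat.one_le_iff_ne_zero.2 (by
      have : (q:ℕ) ≠ 0 := by rintro rfl; simp at hq0
      positivity)
    rw [← hL]; exact_mod_cast this
  have hb := TT_bd c δ (abs_pos.1 hc0) hδ0 (s * q ^ j)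
  rw [hL] at hb
  refine hb.trans ?_
  have h2δ : 2 * δ / |c| = 2 * (η * Q) := by rw [hδ]; field_simp
  rw [h2δ]
  have hA : (2 * |c| * (s * Q) + 3) * (2 * (η * Q) + 1) ≤ 15 * s * (η * Q) := by
    have h1 : 2 * |c| * (s * Q) + 3 ≤ 5 * s := by nlinarith
    have h2 : 2 * (η * Q) + 1 ≤ 3 * (η * Q) := by linarith
    calc _ ≤ (5 * s) * (3 * (η * Q)) := by gcongr
      _ = _ := by ring
  have h100 := aux100 j hj
  calc _ ≤ (3 * (s * Q)) * (15 * s * (η * Q) + s * ((2 * π * j * 8 ^ j) * (η * Q))) := by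
        refine mul_le_mul (by linarith) (add_le_add hA (h1δ.trans ?_)) (by positivity) (by positivity)
        refine le_mul_of_one_le_left ?_ hs0
        have := pi_pos; positivity
    _ = 3 * (s * Q) ^ 2 * η * (15 + 2 * π * j * 8 ^ j) := by ring
    _ ≤ 3 * (s * Q) ^ 2 * η * (3 * 100 ^ j) := by gcongr
    _ = _ := by ring

end VK

namespace VK

noncomputable def gw (κ ℓ : ℝ) (j : ℕ) : ℝ := if 2 * κ ≤ j ∧ (j:ℝ) ≤ 6 * κ then j * (5 - ℓ / 50) else 0

lemma gw_sum (κ ℓ : ℝ) (hκ : 1 / 2 ≤ κ) (hℓ : 0 ≤ ℓ) (k : ℕ) (hk : 6 * κ ≤ k) :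
    ∑ j ∈ Finset.range k, gw κ ℓ (j + 1) ≤ 5 * k ^ 2 - 4 * κ ^ 2 * ℓ / 50 := by
  classical
  have h1 : ∀ j ∈ Finset.range k, gw κ ℓ (j + 1) ≤ 5 * k - (if 2 * κ ≤ ((j+1:ℕ):ℝ) ∧ (((j+1:ℕ):ℝ)) ≤ 6 * κ then 2 * κ * (ℓ / 50) else 0) := by
    intro j hj
    have hj' : ((j+1:ℕ):ℝ) ≤ k := by exact_mod_cast mem_range.1 hj
    unfold gw
    split_ifs with h
    · have : 2 * κ * (ℓ / 50) ≤ ((j+1:ℕ):ℝ) * (ℓ / 50) := by gcongr; exact h.1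
      linarith
    · have : (0:ℝ) ≤ k := by positivity
      linarith
  refine (sum_le_sum h1).trans ?_
  rw [sum_sub_distrib, sum_const, Finset.card_range, nsmul_eq_mul, ← sum_filter, sum_const, nsmul_eq_mul]
  set G := (Finset.range k).filter (fun j => 2 * κ ≤ ((j+1:ℕ):ℝ) ∧ (((j+1:ℕ):ℝ)) ≤ 6 * κ)
  have hc : 4 * κ - 1 ≤ G.card := by
    have hsub : (Icc ⌈2 * κ⌉₊ ⌊6 * κ⌋₊).image (fun j => j - 1) ⊆ G := by
      intro a ha
      obtain ⟨j, hj, rfl⟩ := mem_image.1 ha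
      rw [mem_Icc] at hj
      have h2 : 2 * κ ≤ j := (Nat.le_ceil _).trans (by exact_mod_cast hj.1)
      have h3 : (j:ℝ) ≤ 6 * κ := (Nat.le_floor_iff (by positivity)).1 hj.2
      have hj1 : 1 ≤ j := by
        have : (1:ℝ) ≤ j := by linarith
        exact_mod_cast this
      have hjk : j ≤ k := by exact_mod_cast h3.trans hk
      rw [mem_filter, mem_range, Nat.sub_add_cancel hj1]
      exact ⟨by omega, h2, h3⟩
    have h4 := card_le_card hsub
    rw [Finset.card_image_of_injOn] at h4
    · rw [Nat.card_Icc] at h4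
      have h5 := Nat.ceil_lt_add_one (by positivity : 0 ≤ 2 * κ)
      have h6 := Nat.lt_floor_add_one (6 * κ)
      have h7 : ⌊6 * κ⌋₊ + 1 ≤ G.card + ⌈2 * κ⌉₊ := by omega
      have h8 : ((⌊6 * κ⌋₊ : ℝ)) + 1 ≤ G.card + ⌈2 * κ⌉₊ := by exact_mod_cast h7
      linarith
    · intro a ha b hb hab
      have hpos : 1 ≤ ⌈2 * κ⌉₊ := Nat.one_le_iff_ne_zero.2 (Nat.ceil_pos.2 (by linarith)).ne'
      simp only [Finset.coe_Icc, Set.mem_Icc] at ha hb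
      simp only at hab
      omega
  have h9 : 2 * κ * (4 * κ - 1) * (ℓ / 50) ≤ G.card * (2 * κ * (ℓ / 50)) := by
    rw [show G.card * (2 * κ * (ℓ / 50)) = 2 * κ * G.card * (ℓ / 50) by ring]
    gcongr
  have h10 : 4 * κ ^ 2 * (ℓ / 50) ≤ 2 * κ * (4 * κ - 1) * (ℓ / 50) := by
    refine mul_le_mul_of_nonneg_right ?_ (by positivity)
    nlinarith
  linarith [sq (k:ℝ)]

lemma pow_le_exp_of_nat (k s : ℕ) : ((3:ℝ) * s) ^ (2 * k) ≤ exp (6 * k * s) := by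
  have : (3:ℝ) * s ≤ exp (3 * s) := by linarith [add_one_le_exp (3 * (s:ℝ))]
  refine (pow_le_pow_left₀ (by positivity) this _).trans ?_
  rw [← exp_nat_mul]; push_cast; apply le_of_eq; congr 1; ring

lemma exp10 : (20000:ℝ) ≤ exp 10 := by
  have h := Real.exp_one_gt_d9
  have h2 : exp 10 = exp 1 ^ 10 := by rw [← exp_nat_mul]; norm_num
  rw [h2]
  calc (20000:ℝ) ≤ 2.7 ^ 10 := by norm_num
    _ ≤ _ := pow_le_pow_left₀ (by norm_num) (by linarith) _

lemma ve_le (k : ℕ) (hk : 1 ≤ k) : ve k (10 * k) ≤ 2 * (k * (10 * k + 1) : ℕ) - k * (k + 1) / 2 + k * (k + 1) / 40000 := by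
  have hk0 : (0:ℝ) < k := by exact_mod_cast hk
  have hk1 : (1:ℝ) ≤ k := by exact_mod_cast hk
  have h1 : (1 - 1 / (k:ℝ)) ^ (10 * k) ≤ exp (-10) := by
    have h : 1 - 1 / (k:ℝ) ≤ exp (-(1 / k)) := by linarith [add_one_le_exp (-(1 / (k:ℝ)))]
    have h0 : 0 ≤ 1 - 1 / (k:ℝ) := by rw [sub_nonneg, div_le_one hk0]; exact hk1
    refine (pow_le_pow_left₀ h0 h _).trans ?_
    rw [← exp_nat_mul]; apply le_of_eq; congr 1; push_cast; field_simp
  have h2 : exp (-10) ≤ 1 / 20000 := by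
    rw [exp_neg, ← one_div]; exact one_div_le_one_div_of_le (by norm_num) exp10
  unfold ve
  have h3 : (k:ℝ) * (k + 1) / 2 * (1 - 1 / (k:ℝ)) ^ (10 * k) ≤ k * (k + 1) / 2 * (1 / 20000) := by
    refine mul_le_mul_of_nonneg_left (h1.trans h2) (by positivity)
  push_cast
  linarith

lemma prod_q (k s q : ℕ) : ∏ j ∈ Finset.range k, ((3:ℝ) * (s * (q:ℝ) ^ (j + 1))) ^ 2 = (3 * s) ^ (2 * k) * (q:ℝ) ^ (k * (k + 1)) := by
  induction k with
  | zero => simp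
  | succ k ih => rw [Finset.prod_range_succ, ih]; ring

theorem W_bd (ℓ κ n : ℝ) (q k : ℕ) (hℓ : 2 ≤ ℓ) (hκ : 1 / 2 ≤ κ) (hk : k = ⌈10 * κ⌉₊ + 10)
    (hq1 : exp (9 / 20 * ℓ) / 2 ≤ q) (hq2 : q ≤ exp (9 / 20 * ℓ)) (hn1 : exp ℓ ≤ n) (hn2 : n ≤ 2 * exp ℓ)
    (α : Fin k → ℝ) (hα : ∀ j : Fin k, |α j| = exp (κ * ℓ) / (2 * π * (j.1 + 1 : ℕ) * n ^ (j.1 + 1))) :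
    ‖∑ x ∈ Ico 0 (q:ℤ), ∑ y ∈ Ico 0 (q:ℤ), ee (dt α (pv k (x * y)))‖ ≤
      (q:ℝ) ^ 2 * exp (28 - 1 / 10 ^ 11 * (ℓ / κ ^ 2)) := by
  have hk1 : 1 ≤ k := by omega
  have hkr : (1:ℝ) ≤ k := by exact_mod_cast hk1
  have hk6 : 10 * κ ≤ k := by
    rw [hk]; push_cast; linarith [Nat.le_ceil (10 * κ)]
  have hk32 : (k:ℝ) ≤ 32 * κ := by
    rw [hk]; push_cast; linarith [Nat.ceil_lt_add_one (by positivity : 0 ≤ 10 * κ)]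
  set s := k * (10 * k + 1) with hs
  have hs1 : 1 ≤ s := by rw [hs]; nlinarith
  have hq0 : (0:ℝ) < q := lt_of_lt_of_le (by positivity) hq1
  have hq1' : 1 ≤ q := by exact_mod_cast hq0
  set Lq := log q with hLq
  have hqe : (q:ℝ) = exp Lq := (exp_log hq0).symm
  have hLq0 : 0 ≤ Lq := log_nonneg (by exact_mod_cast hq1')
  have hLq2 : Lq ≤ 9 / 20 * ℓ := (log_le_iff_le_exp hq0).2 hq2
  have hb := bilinear k s q hs1 α
  have hprod : ∏ j : Fin k, TT (α j) (s * q ^ (j.1 + 1)) ≤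
      exp (6 * k * s + k * (k + 1) * Lq + (5 * k ^ 2 - 4 * κ ^ 2 * ℓ / 50)) := by
    calc _ ≤ ∏ j : Fin k, (((3:ℝ) * (s * (q:ℝ) ^ (j.1 + 1))) ^ 2 * exp (gw κ ℓ (j.1 + 1))) := by
          refine Finset.prod_le_prod (fun j _ => sum_nonneg fun _ _ => norm_nonneg _) fun j _ => ?_
          unfold gw
          split_ifs with h
          · refine (TT_good (j.1+1) q s ℓ κ n (α j) (by omega) hs1 hℓ h.1 h.2 hq1 hq2 hn1 hn2 (hα j)).trans ?_
            refine mul_le_mul_of_nonneg_left ?_ (by positivity)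
            have h100 : (100:ℝ) ≤ exp 5 := by
              have h2 : exp 5 = exp 1 ^ 5 := by rw [← exp_nat_mul]; norm_num
              rw [h2]
              have h := Real.exp_one_gt_d9
              calc (100:ℝ) ≤ 2.7 ^ 5 := by norm_num
                _ ≤ _ := pow_le_pow_left₀ (by norm_num) (by linarith) _
            calc _ ≤ exp 5 ^ (j.1 + 1) * exp (-(((j.1 + 1 : ℕ):ℝ) * ℓ / 50)) := by gcongr
              _ = _ := by rw [← exp_nat_mul, ← exp_add]; congr 1; ring
          · rw [exp_zero, mul_one]
            refine (TT_triv _ _).trans (pow_le_pow_left₀ (by positivity) ?_ 2)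
            have : (1:ℝ) ≤ s * (q:ℝ) ^ (j.1 + 1) := by
              have h1 : (1:ℕ) ≤ s * q ^ (j.1 + 1) := Nat.one_le_iff_ne_zero.2 (by positivity)
              exact_mod_cast h1
            push_cast; linarith
      _ = (∏ j ∈ Finset.range k, ((3:ℝ) * (s * (q:ℝ) ^ (j + 1))) ^ 2) * exp (∑ j ∈ Finset.range k, gw κ ℓ (j + 1)) := by
          rw [exp_sum, ← Finset.prod_mul_distrib]
          exact Fin.prod_univ_eq_prod_range (fun j => ((3:ℝ) * (s * (q:ℝ) ^ (j + 1))) ^ 2 * exp (gw κ ℓ (j + 1))) k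
      _ ≤ exp (6 * k * s) * exp (k * (k + 1) * Lq) * exp (5 * k ^ 2 - 4 * κ ^ 2 * ℓ / 50) := by
          rw [prod_q]
          have h1 : (q:ℝ) ^ (k * (k + 1)) = exp (k * (k + 1) * Lq) := by
            rw [hqe, ← exp_nat_mul]; push_cast; rfl
          rw [h1]
          refine mul_le_mul (mul_le_mul_of_nonneg_right (pow_le_exp_of_nat k s) (exp_pos _).le) (exp_le_exp.2 ?_) (exp_pos _).le (by positivity)
          exact gw_sum κ ℓ hκ (by linarith) k (by linarith)
      _ = _ := by rw [← exp_add, ← exp_add]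
  have hJ : (J s k (Ico 0 (q:ℤ)) : ℝ) ≤ exp (5500 * k ^ 4 + Lq * (2 * s - k * (k + 1) / 2 + k * (k + 1) / 40000)) := by
    refine (vmvt k hk1 (10 * k) le_rfl q hq1').trans ?_
    rw [hqe, ← exp_mul, ← exp_add]
    apply exp_le_exp.2
    have := mul_le_mul_of_nonneg_left (ve_le k hk1) hLq0
    rw [← hs] at this
    push_cast
    linarith
  have hq8 : (q:ℝ) ^ (8 * s ^ 2 - 4 * s) = exp (Lq * (8 * s ^ 2 - 4 * s)) := by
    rw [hqe, ← exp_nat_mul]; congr 1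
    rw [Nat.cast_sub (by nlinarith)]; push_cast; ring
  have hfin : ‖∑ x ∈ Ico 0 (q:ℤ), ∑ y ∈ Ico 0 (q:ℤ), ee (dt α (pv k (x * y)))‖ ^ (4 * s ^ 2) ≤
      ((q:ℝ) ^ 2 * exp (28 - 1 / 10 ^ 11 * (ℓ / κ ^ 2))) ^ (4 * s ^ 2) := by
    refine hb.trans ?_
    rw [hq8]
    refine (mul_le_mul (mul_le_mul_of_nonneg_left (pow_le_pow_left₀ (by positivity) hJ 2) (exp_pos _).le) hprod
      (Finset.prod_nonneg fun j _ => sum_nonneg fun _ _ => norm_nonneg _) (by positivity)).trans ?_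
    rw [hqe, ← exp_nat_mul, ← exp_nat_mul, ← exp_add, ← exp_add, ← exp_add, ← exp_nat_mul]
    apply exp_le_exp.2
    have hsr : (s:ℝ) = k * (10 * k + 1) := by rw [hs]; push_cast; ring
    have e1 : (k:ℝ) * (k + 1) / 20000 * Lq ≤ 0.03 * (κ ^ 2 * ℓ) := by
      have a1 : (k:ℝ) * (k + 1) ≤ 1120 * κ ^ 2 := by nlinarith
      calc (k:ℝ) * (k + 1) / 20000 * Lq ≤ 1120 * κ ^ 2 / 20000 * (9 / 20 * ℓ) := by gcongr
        _ ≤ _ := by nlinarith [mul_nonneg (sq_nonneg κ) (by linarith : 0 ≤ ℓ)]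
    have e2 : 6 * (k:ℝ) * s + 5 * k ^ 2 ≤ 71 * k ^ 4 := by
      rw [hsr]
      have b2 : (k:ℝ) ^ 2 ≤ k ^ 4 := pow_le_pow_right₀ hkr (by norm_num)
      have b3 : (k:ℝ) ^ 3 ≤ k ^ 4 := pow_le_pow_right₀ hkr (by norm_num)
      nlinarith
    have e3 : 400 * (k:ℝ) ^ 4 ≤ 4 * s ^ 2 := by
      rw [hsr]; have : 0 ≤ (k:ℝ) ^ 3 := by positivity
      nlinarith [sq_nonneg (k:ℝ)]
    have e4 : 4 * (s:ℝ) ^ 2 ≤ 484 * k ^ 4 := by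
      have : (s:ℝ) ≤ 11 * k ^ 2 := by rw [hsr]; nlinarith
      calc 4 * (s:ℝ) ^ 2 ≤ 4 * (11 * (k:ℝ) ^ 2) ^ 2 := by gcongr
        _ = _ := by ring
    have e5 : 4 * (s:ℝ) ^ 2 * (1 / 10 ^ 11 * (ℓ / κ ^ 2)) ≤ 0.05 * (κ ^ 2 * ℓ) := by
      calc 4 * (s:ℝ) ^ 2 * (1 / 10 ^ 11 * (ℓ / κ ^ 2)) ≤ 484 * (32 * κ) ^ 4 * (1 / 10 ^ 11 * (ℓ / κ ^ 2)) := by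
            refine mul_le_mul_of_nonneg_right (e4.trans ?_) (by positivity)
            gcongr
        _ = 484 * 32 ^ 4 / 10 ^ 11 * (κ ^ 2 * ℓ) := by field_simp
        _ ≤ _ := by
            refine mul_le_mul_of_nonneg_right (by norm_num) (by positivity)
    push_cast
    have e6 : (0:ℝ) ≤ k ^ 4 := by positivity
    linarith
  exact le_of_pow_le_pow_left₀ (by positivity) (by positivity) hfin

end VK

namespace VK

noncomputable def ff (t u : ℝ) : ℂ := ee (-(t / (2 * π)) * log u)

lemma ff_norm (t u : ℝ) : ‖ff t u‖ = 1 := ee_norm _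

lemma ee_lip (a b : ℝ) : ‖ee a - ee b‖ ≤ 2 * π * |a - b| := by
  have h : ee a - ee b = ee b * (ee (a - b) - 1) := by
    rw [mul_sub, ← ee_add, mul_one]; congr 2; ring
  rw [h, norm_mul, ee_norm, one_mul]
  unfold ee
  rw [mul_comm _ I]
  refine (Real.norm_exp_I_mul_ofReal_sub_one_le).trans ?_
  rw [Real.norm_eq_abs, abs_mul, abs_of_pos two_pi_pos]

lemma shift_bd (g : ℕ → ℂ) (hg : ∀ n, ‖g n‖ ≤ 1) (N M : ℕ) (hNM : N ≤ M) (h : ℕ) :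
    ‖∑ n ∈ Ioc N M, g n - ∑ n ∈ Ioc N M, g (n + h)‖ ≤ 2 * h := by
  induction h with
  | zero => simp
  | succ h ih =>
    have hs : ∀ M, N ≤ M → ∑ n ∈ Ioc N M, g (n + h) - ∑ n ∈ Ioc N M, g (n + (h + 1)) = g (N + 1 + h) - g (M + 1 + h) := by
      intro M hM
      induction M, hM using Nat.le_induction with
      | base => simp
      | succ M hM ih2 =>
        have hi : Ioc N (M + 1) = insert (M + 1) (Ioc N M) := by
          ext a; simp only [mem_Ioc, mem_insert]; omega
        rw [hi]
        rw [sum_insert (by simp), sum_insert (by simp)]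
        rw [show ∀ a b c d : ℂ, a + b - (c + d) = (b - d) + (a - c) by intros; ring, ih2]
        rw [show M + 1 + (h + 1) = M + 1 + 1 + h by ring]; ring
    calc _ = ‖(∑ n ∈ Ioc N M, g n - ∑ n ∈ Ioc N M, g (n + h)) + (g (N + 1 + h) - g (M + 1 + h))‖ := by
          rw [← hs M hNM]; congr 1; ring
      _ ≤ 2 * h + (1 + 1) := (norm_add_le _ _).trans (add_le_add ih ((norm_sub_le _ _).trans (add_le_add (hg _) (hg _))))
      _ = _ := by push_cast; ring

lemma inner_bd (ℓ κ : ℝ) (q k n : ℕ) (hℓ : 10 ≤ ℓ) (hκ : 1 / 2 ≤ κ) (hk : k = ⌈10 * κ⌉₊ + 10)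
    (hq1 : exp (9 / 20 * ℓ) / 2 ≤ q) (hq2 : q ≤ exp (9 / 20 * ℓ)) (hn1 : exp ℓ ≤ n) (hn2 : n ≤ 2 * exp ℓ) :
    ‖∑ x ∈ Ico 0 (q:ℤ), ∑ y ∈ Ico 0 (q:ℤ), ff (exp (κ * ℓ)) ((n:ℝ) + (x * y : ℤ))‖ ≤
      (q:ℝ) ^ 2 * (exp (28 - 1 / 10 ^ 11 * (ℓ / κ ^ 2)) + 2 * exp (-ℓ)) := by
  set t := exp (κ * ℓ) with ht
  have hn0 : (0:ℝ) < n := (exp_pos _).trans_le hn1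
  let α : Fin k → ℝ := fun j => -(t / (2 * π)) * ((-1) ^ j.1 / ((j.1 + 1 : ℕ) * (n:ℝ) ^ (j.1 + 1)))
  have hα : ∀ j : Fin k, |α j| = t / (2 * π * (j.1 + 1 : ℕ) * (n:ℝ) ^ (j.1 + 1)) := by
    intro j
    have hp : 0 < 2 * π := two_pi_pos
    have h1 : |(-1:ℝ) ^ j.1| = 1 := by rw [abs_pow]; simp
    simp only [α]
    rw [abs_mul, abs_neg, abs_div, abs_div, h1, abs_of_pos hp, abs_of_pos (exp_pos _), abs_of_pos (by positivity)]
    rw [div_mul_div_comm, mul_one, mul_assoc (2 * π)]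
  have hW := W_bd ℓ κ n q k (by linarith) hκ hk hq1 hq2 hn1 hn2 α hα
  have key : ∀ x ∈ Ico 0 (q:ℤ), ∀ y ∈ Ico 0 (q:ℤ),
      ‖ff t ((n:ℝ) + (x * y : ℤ)) - ff t n * ee (dt α (pv k (x * y)))‖ ≤ 2 * exp (-ℓ) := by
    intro x hx y hy
    rw [mem_Ico] at hx hy
    set m : ℝ := ((x * y : ℤ) : ℝ) with hm
    have hm0 : 0 ≤ m := by rw [hm]; exact_mod_cast mul_nonneg hx.1 hy.1
    have hm1 : m ≤ exp (9 / 10 * ℓ) := by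
      have h1 : (x:ℝ) ≤ q := by exact_mod_cast hx.2.le
      have h2 : (y:ℝ) ≤ q := by exact_mod_cast hy.2.le
      have h0 : (0:ℝ) ≤ x := by exact_mod_cast hx.1
      have h0' : (0:ℝ) ≤ y := by exact_mod_cast hy.1
      rw [hm]; push_cast
      calc (x:ℝ) * y ≤ exp (9 / 20 * ℓ) * exp (9 / 20 * ℓ) := mul_le_mul (h1.trans hq2) (h2.trans hq2) h0' (exp_pos _).le
        _ = _ := by rw [← exp_add]; congr 1; ring
    set z := m / n with hz
    have hz0 : 0 ≤ z := by positivity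
    have hz1 : z ≤ exp (-(ℓ / 10)) := by
      rw [hz, div_le_iff₀ hn0]
      calc m ≤ exp (9 / 10 * ℓ) := hm1
        _ = exp (-(ℓ / 10)) * exp ℓ := by rw [← exp_add]; congr 1; ring
        _ ≤ _ := by gcongr
    have hz2 : z ≤ 1 / 2 := by
      refine hz1.trans ?_
      calc exp (-(ℓ / 10)) ≤ exp (-1) := exp_le_exp.2 (by linarith)
        _ ≤ 1 / 2 := by
          rw [exp_neg, ← one_div]; refine one_div_le_one_div_of_le (by norm_num) ?_
          linarith [add_one_le_exp (1:ℝ)]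
    have hR := Real.abs_log_sub_add_sum_range_le (x := -z) (by rw [abs_neg, abs_of_nonneg hz0]; linarith) k
    rw [abs_neg, abs_of_nonneg hz0, sub_neg_eq_add] at hR
    have h1 : ff t ((n:ℝ) + m) = ff t n * ee (-(t / (2 * π)) * log (1 + z)) := by
      unfold ff
      rw [← ee_add, ← mul_add, ← log_mul hn0.ne' (by positivity)]
      congr 3; rw [hz]; field_simp
    rw [h1, ← mul_sub, norm_mul, ff_norm, one_mul]
    refine (ee_lip _ _).trans ?_
    have h2 : dt α (pv k (x * y)) = -(t / (2 * π)) * (-∑ i ∈ Finset.range k, (-z) ^ (i + 1) / (i + 1)) := by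
      unfold dt
      rw [← Fin.sum_univ_eq_sum_range (fun i => (-z) ^ (i + 1) / ((i:ℝ) + 1)) k, ← Finset.sum_neg_distrib, mul_sum]
      refine sum_congr rfl fun j _ => ?_
      simp only [α, pv]
      rw [Int.cast_pow, ← hm, mul_assoc]
      congr 1
      rw [hz, neg_pow (m / n), div_pow]; push_cast
      rw [pow_succ (-1:ℝ)]; field_simp
    rw [h2, ← mul_sub, abs_mul, abs_neg, abs_of_pos (by have := two_pi_pos; positivity : 0 < t / (2 * π))]
    rw [sub_neg_eq_add, add_comm (log (1 + z))]
    calc 2 * π * (t / (2 * π) * |∑ i ∈ Finset.range k, (-z) ^ (i + 1) / (i + 1) + log (1 + z)|)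
        ≤ 2 * π * (t / (2 * π) * (z ^ (k + 1) / (1 - z))) := by gcongr
      _ = t * (z ^ (k + 1) / (1 - z)) := by field_simp
      _ ≤ t * (2 * exp (-(ℓ / 10)) ^ (k + 1)) := by
          refine mul_le_mul_of_nonneg_left ?_ (exp_pos _).le
          rw [div_le_iff₀ (by linarith)]
          have : z ^ (k + 1) ≤ exp (-(ℓ / 10)) ^ (k + 1) := pow_le_pow_left₀ hz0 hz1 _
          have h3 : 0 ≤ exp (-(ℓ / 10)) ^ (k + 1) := by positivity
          nlinarith
      _ = 2 * exp (κ * ℓ - ℓ / 10 * (k + 1)) := by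
          rw [ht, ← exp_nat_mul, sub_eq_add_neg, exp_add]; push_cast; ring_nf
      _ ≤ 2 * exp (-ℓ) := by
          have : 10 * κ + 10 ≤ k := by rw [hk]; push_cast; linarith [Nat.le_ceil (10 * κ)]
          gcongr
          nlinarith
  have hdiff : ‖∑ x ∈ Ico 0 (q:ℤ), ∑ y ∈ Ico 0 (q:ℤ), ff t ((n:ℝ) + (x * y : ℤ)) -
      ff t n * ∑ x ∈ Ico 0 (q:ℤ), ∑ y ∈ Ico 0 (q:ℤ), ee (dt α (pv k (x * y)))‖ ≤ (q:ℝ) ^ 2 * (2 * exp (-ℓ)) := by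
    simp_rw [mul_sum]
    rw [← sum_sub_distrib]
    refine (norm_sum_le_of_le _ (f := fun x => _) (n := fun _ => (q:ℝ) * (2 * exp (-ℓ))) fun x hx => ?_).trans ?_
    · rw [← sum_sub_distrib]
      refine (norm_sum_le_of_le _ (n := fun _ => (2 * exp (-ℓ))) fun y hy => key x hx y hy).trans ?_
      simp
    · simp; apply le_of_eq; ring
  calc _ ≤ ‖ff t n * ∑ x ∈ Ico 0 (q:ℤ), ∑ y ∈ Ico 0 (q:ℤ), ee (dt α (pv k (x * y)))‖ + (q:ℝ) ^ 2 * (2 * exp (-ℓ)) := by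
        have := norm_le_norm_add_norm_sub' (∑ x ∈ Ico 0 (q:ℤ), ∑ y ∈ Ico 0 (q:ℤ), ff t ((n:ℝ) + (x * y : ℤ)))
          (ff t n * ∑ x ∈ Ico 0 (q:ℤ), ∑ y ∈ Ico 0 (q:ℤ), ee (dt α (pv k (x * y))))
        linarith
    _ ≤ _ := by rw [norm_mul, ff_norm, one_mul, mul_add]; linarith

theorem exp_sum_big (N M : ℕ) (t : ℝ) (hM : M ≤ 2 * N) (hNM : N ≤ M) (hℓ : 10 ≤ log N) (ht : log N / 2 ≤ log t) (ht0 : 0 < t) :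
    ‖∑ n ∈ Ioc N M, ff t n‖ ≤ exp 30 * N * exp (-(1 / 10 ^ 11 * (log N ^ 3 / log t ^ 2))) := by
  set ℓ := log N with hℓd
  set κ := log t / ℓ with hκd
  have hN0 : (0:ℝ) < N := by
    rcases Nat.eq_zero_or_pos N with h | h
    · rw [hℓd, h] at hℓ; simp at hℓ; linarith
    · exact_mod_cast h
  have hℓ0 : 0 < ℓ := by linarith
  have hκ : 1 / 2 ≤ κ := by rw [hκd, le_div_iff₀ hℓ0]; linarith
  have htk : exp (κ * ℓ) = t := by rw [hκd, div_mul_cancel₀ _ hℓ0.ne', exp_log ht0]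
  have heN : exp ℓ = N := exp_log hN0
  have hexp : log N ^ 3 / log t ^ 2 = ℓ / κ ^ 2 := by
    rw [← hℓd, hκd]; field_simp
  rw [← hℓd] at hexp
  rw [hexp]
  set q := ⌊exp (9 / 20 * ℓ)⌋₊ with hq
  have hq2 : (q:ℝ) ≤ exp (9 / 20 * ℓ) := Nat.floor_le (exp_pos _).le
  have hq1 : exp (9 / 20 * ℓ) / 2 ≤ q := by
    have := Nat.lt_floor_add_one (exp (9 / 20 * ℓ))
    have h2 : 9 / 20 * ℓ + 1 ≤ exp (9 / 20 * ℓ) := add_one_le_exp _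
    rw [← hq] at this
    linarith
  have hq0 : (0:ℝ) < q := lt_of_lt_of_le (by positivity) hq1
  set S := ∑ n ∈ Ioc N M, ff t n with hS
  set D := exp (28 - 1 / 10 ^ 11 * (ℓ / κ ^ 2)) + 2 * exp (-ℓ) with hD
  have hinner : ∀ n ∈ Ioc N M, ‖∑ x ∈ Ico 0 (q:ℤ), ∑ y ∈ Ico 0 (q:ℤ), ff t ((n:ℝ) + (x * y : ℤ))‖ ≤ (q:ℝ) ^ 2 * D := by
    intro n hn
    rw [mem_Ioc] at hn
    have := inner_bd ℓ κ q _ n hℓ hκ rfl hq1 hq2 (by rw [heN]; exact_mod_cast hn.1.le) (by rw [heN]; exact_mod_cast hn.2.trans hM)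
    rwa [htk] at this
  have hsh : ∀ x ∈ Ico 0 (q:ℤ), ∀ y ∈ Ico 0 (q:ℤ), ‖S - ∑ n ∈ Ioc N M, ff t ((n:ℝ) + (x * y : ℤ))‖ ≤ 2 * (q:ℝ) ^ 2 := by
    intro x hx y hy
    rw [mem_Ico] at hx hy
    obtain ⟨h, hh⟩ := Int.eq_ofNat_of_zero_le (mul_nonneg hx.1 hy.1)
    have h1 := shift_bd (fun n => ff t n) (fun n => (ff_norm _ _).le) N M hNM h
    rw [hh]
    push_cast at h1 ⊢
    refine h1.trans ?_
    have h2 : (h:ℤ) ≤ q * q := by rw [← hh]; exact mul_le_mul hx.2.le hy.2.le hy.1 (by positivity)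
    have h3 : (h:ℝ) ≤ q * q := by exact_mod_cast h2
    nlinarith
  have hsum : ‖(q:ℂ) ^ 2 * S - ∑ n ∈ Ioc N M, ∑ x ∈ Ico 0 (q:ℤ), ∑ y ∈ Ico 0 (q:ℤ), ff t ((n:ℝ) + (x * y : ℤ))‖ ≤ (q:ℝ) ^ 2 * (2 * (q:ℝ) ^ 2) := by
    have e1 : (q:ℂ) ^ 2 * S = ∑ x ∈ Ico 0 (q:ℤ), ∑ y ∈ Ico 0 (q:ℤ), S := by simp; ring
    have e2 : ∑ n ∈ Ioc N M, ∑ x ∈ Ico 0 (q:ℤ), ∑ y ∈ Ico 0 (q:ℤ), ff t ((n:ℝ) + (x * y : ℤ)) =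
        ∑ x ∈ Ico 0 (q:ℤ), ∑ y ∈ Ico 0 (q:ℤ), ∑ n ∈ Ioc N M, ff t ((n:ℝ) + (x * y : ℤ)) := by
      rw [sum_comm]; refine sum_congr rfl fun x _ => ?_; rw [sum_comm]
    rw [e1, e2, ← sum_sub_distrib]
    refine (norm_sum_le_of_le _ (f := fun x => _) (n := fun _ => (q:ℝ) * (2 * (q:ℝ) ^ 2)) fun x hx => ?_).trans ?_
    · rw [← sum_sub_distrib]
      refine (norm_sum_le_of_le _ (n := fun _ => (2 * (q:ℝ) ^ 2)) fun y hy => hsh x hx y hy).trans ?_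
      simp
    · simp; apply le_of_eq; ring
  have hall : ‖∑ n ∈ Ioc N M, ∑ x ∈ Ico 0 (q:ℤ), ∑ y ∈ Ico 0 (q:ℤ), ff t ((n:ℝ) + (x * y : ℤ))‖ ≤ N * ((q:ℝ) ^ 2 * D) := by
    refine (norm_sum_le_of_le _ hinner).trans ?_
    rw [sum_const, nsmul_eq_mul, Nat.card_Ioc]
    refine mul_le_mul_of_nonneg_right ?_ (by positivity)
    exact_mod_cast (by omega : M - N ≤ N)
  have hqS : (q:ℝ) ^ 2 * ‖S‖ ≤ (q:ℝ) ^ 2 * (N * D + 2 * (q:ℝ) ^ 2) := by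
    have h1 : (q:ℝ) ^ 2 * ‖S‖ = ‖(q:ℂ) ^ 2 * S‖ := by rw [norm_mul, norm_pow, Complex.norm_natCast]
    rw [h1]
    have h2 := norm_le_norm_add_norm_sub' ((q:ℂ) ^ 2 * S) (∑ n ∈ Ioc N M, ∑ x ∈ Ico 0 (q:ℤ), ∑ y ∈ Ico 0 (q:ℤ), ff t ((n:ℝ) + (x * y : ℤ)))
    linarith
  have hSb := le_of_mul_le_mul_left hqS (by positivity)
  set E := exp (-(1 / 10 ^ 11 * (ℓ / κ ^ 2))) with hE
  have hsmall : exp (-(ℓ / 10)) ≤ E := by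
    apply exp_le_exp.2
    have : ℓ / κ ^ 2 ≤ 4 * ℓ := by
      rw [div_le_iff₀ (by positivity)]
      have : 1 / 4 ≤ κ ^ 2 := by nlinarith
      nlinarith
    linarith
  have hq9 : (q:ℝ) ^ 2 ≤ N * E := by
    calc (q:ℝ) ^ 2 ≤ exp (9 / 20 * ℓ) ^ 2 := by gcongr
      _ = N * exp (-(ℓ / 10)) := by rw [← heN, ← exp_nat_mul, ← exp_add]; congr 1; push_cast; ring
      _ ≤ _ := by gcongr
  have hDE : D ≤ (exp 28 + 2) * E := by
    rw [hD, add_mul]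
    refine add_le_add (le_of_eq ?_) ?_
    · rw [hE, ← exp_add]; congr 1
    · gcongr; refine le_trans ?_ hsmall
      apply exp_le_exp.2; linarith
  have h30 : exp 28 + 4 ≤ exp 30 := by
    have h2 : exp 30 = exp 28 * exp 2 := by rw [← exp_add]; norm_num
    have h3 : (3:ℝ) ≤ exp 2 := by linarith [add_one_le_exp (2:ℝ)]
    have h4 : (29:ℝ) ≤ exp 28 := by linarith [add_one_le_exp (28:ℝ)]
    rw [h2]; nlinarith
  calc ‖S‖ ≤ N * ((exp 28 + 2) * E) + 2 * (N * E) := hSb.trans (by gcongr)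
    _ = (exp 28 + 4) * (N * E) := by ring
    _ ≤ exp 30 * (N * E) := by gcongr
    _ = _ := by ring

theorem exp_sum (N M : ℕ) (t : ℝ) (hM : M ≤ 2 * N) (ht : log N / 2 ≤ log t) (ht0 : 0 < t) :
    ‖∑ n ∈ Ioc N M, ff t n‖ ≤ exp 30 * N * exp (-(1 / 10 ^ 11 * (log N ^ 3 / log t ^ 2))) := by
  rcases le_total N M with hNM | hNM
  swap
  · rw [Finset.Ioc_eq_empty_of_le hNM]; simp; positivity
  rcases le_total 10 (log N) with h | h
  · exact exp_sum_big N M t hM hNM h ht ht0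
  have hL0 : 0 ≤ log N := log_natCast_nonneg N
  have h1 : log N ^ 3 / log t ^ 2 ≤ 40 := by
    rcases eq_or_lt_of_le hL0 with h0 | h0
    · rw [← h0]; norm_num
    rw [div_le_iff₀ (by have : 0 < log t := by linarith
                        positivity)]
    have : (log N / 2) ^ 2 ≤ log t ^ 2 := by gcongr
    nlinarith [sq_nonneg (log (N:ℝ))]
  have h2 : 1 ≤ exp 30 * exp (-(1 / 10 ^ 11 * (log N ^ 3 / log t ^ 2))) := by
    rw [← exp_add]; apply one_le_exp; linarith
  calc _ ≤ ((Ioc N M).card : ℝ) := norm_sum_ee_le _ _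
    _ ≤ N * 1 := by rw [Nat.card_Ioc, mul_one]; exact_mod_cast (by omega : M - N ≤ N)
    _ ≤ N * (exp 30 * exp (-(1 / 10 ^ 11 * (log N ^ 3 / log t ^ 2)))) := by gcongr
    _ = _ := by ring

end VK

namespace VK

lemma abel_bd (a : ℕ → ℂ) (w : ℕ → ℝ) (B : ℝ) (N : ℕ) (hw : ∀ n > N, w (n + 1) ≤ w n) (hw0 : ∀ n, 0 ≤ w n)
    (M : ℕ) (hM : N ≤ M) (hA : ∀ m, N ≤ m → m ≤ M → ‖∑ n ∈ Ioc N m, a n‖ ≤ B) :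
    ‖∑ n ∈ Ioc N M, (w n : ℂ) * a n‖ ≤ w (N + 1) * B := by
  have hins : ∀ m, N ≤ m → Ioc N (m + 1) = insert (m + 1) (Ioc N m) := by
    intro m hm; ext x; simp only [mem_Ioc, mem_insert]; omega
  have h1 : ∀ m, N ≤ m → ∑ n ∈ Ioc N m, (w n : ℂ) * a n = (w (m + 1) : ℂ) * ∑ n ∈ Ioc N m, a n +
      ∑ n ∈ Ioc N m, ((w n - w (n + 1) : ℝ) : ℂ) * ∑ i ∈ Ioc N n, a i := by
    intro m hm
    induction m, hm using Nat.le_induction with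
    | base => simp
    | succ m hm ih =>
      rw [hins m hm, sum_insert (by simp), sum_insert (by simp), sum_insert (by simp), ih, hins m hm,
        sum_insert (by simp)]
      push_cast; ring
  have h2 : ∀ m, N ≤ m → w (m + 1) + ∑ n ∈ Ioc N m, (w n - w (n + 1)) = w (N + 1) := by
    intro m hm
    induction m, hm using Nat.le_induction with
    | base => simp
    | succ m hm ih =>
      rw [hins m hm, sum_insert (by simp), ← ih]; ring
  rw [h1 M hM, ← h2 M hM, add_mul, sum_mul]
  refine (norm_add_le _ _).trans (add_le_add ?_ ?_)
  · rw [norm_mul, Complex.norm_of_nonneg (hw0 _)]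
    exact mul_le_mul_of_nonneg_left (hA M hM le_rfl) (hw0 _)
  · refine norm_sum_le_of_le _ fun n hn => ?_
    rw [mem_Ioc] at hn
    have := hw n hn.1
    rw [norm_mul, Complex.norm_of_nonneg (by linarith)]
    exact mul_le_mul_of_nonneg_left (hA n hn.1.le hn.2) (by linarith)

lemma cpow_ff (n : ℕ) (hn : 1 ≤ n) (σ t : ℝ) : (n:ℂ) ^ (-(⟨σ, t⟩ : ℂ)) = (((n:ℝ) ^ (-σ) : ℝ) : ℂ) * ff t n := by
  have hn0 : (0:ℝ) < n := by exact_mod_cast hn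
  have hn1 : (n:ℂ) ≠ 0 := by exact_mod_cast hn0.ne'
  rw [Complex.cpow_def_of_ne_zero hn1, Real.rpow_def_of_pos hn0, ff, ee, Complex.ofReal_exp, ← Complex.exp_add, ← Complex.natCast_log]
  congr 1
  have : 2 * π * (-(t / (2 * π)) * log n) = -(t * log n) := by field_simp
  rw [this]
  apply Complex.ext <;> simp <;> ring

noncomputable def zK : ℝ := exp (10 ^ 6 + 30)

lemma block_bd (X M : ℕ) (hX : 1 ≤ X) (hXM : X ≤ M) (hM : M ≤ 2 * X) (σ t : ℝ) (hσ0 : 0 ≤ σ) (ht : 1 ≤ log t) (ht0 : 0 < t)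
    (hXt : log X / 2 ≤ log t) (hσ : 1 - σ ≤ log t ^ (-(2 / 3) : ℝ)) :
    ‖∑ n ∈ Ioc X M, (n:ℂ) ^ (-(⟨σ, t⟩ : ℂ))‖ ≤ zK := by
  have hX0 : (0:ℝ) < X := by exact_mod_cast hX
  set T := log t with hT
  set L := log X with hL
  have hL0 : 0 ≤ L := log_natCast_nonneg X
  have h1 : ∑ n ∈ Ioc X M, (n:ℂ) ^ (-(⟨σ, t⟩ : ℂ)) = ∑ n ∈ Ioc X M, (((n:ℝ) ^ (-σ) : ℝ) : ℂ) * ff t n := by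
    refine sum_congr rfl fun n hn => cpow_ff n ?_ σ t
    rw [mem_Ioc] at hn; omega
  rw [h1]
  have h2 := abel_bd (fun n => ff t n) (fun n => (n:ℝ) ^ (-σ)) (exp 30 * X * exp (-(1 / 10 ^ 11 * (L ^ 3 / T ^ 2)))) X
    (fun n hn => by
      refine Real.rpow_le_rpow_of_nonpos (by exact_mod_cast (by omega : 0 < n)) (by push_cast; linarith) (by linarith))
    (fun n => by positivity) M hXM (fun m hm hm' => exp_sum X m t (by omega) hXt ht0)
  refine h2.trans ?_
  have h3 : ((X + 1 : ℕ) : ℝ) ^ (-σ) ≤ (X:ℝ) ^ (-σ) := Real.rpow_le_rpow_of_nonpos hX0 (by push_cast; linarith) (by linarith)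
  have h4 : (X:ℝ) ^ (-σ) * X = exp ((1 - σ) * L) := by
    rw [Real.rpow_def_of_pos hX0, ← hL, show (X:ℝ) = exp L from (exp_log hX0).symm, ← exp_add]; congr 1; ring
  calc _ ≤ (X:ℝ) ^ (-σ) * (exp 30 * X * exp (-(1 / 10 ^ 11 * (L ^ 3 / T ^ 2)))) := by gcongr
    _ = exp 30 * (((X:ℝ) ^ (-σ) * X) * exp (-(1 / 10 ^ 11 * (L ^ 3 / T ^ 2)))) := by ring
    _ = exp (30 + ((1 - σ) * L - 1 / 10 ^ 11 * (L ^ 3 / T ^ 2))) := by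
        rw [h4, ← exp_add, ← exp_add, ← sub_eq_add_neg]
    _ ≤ _ := by
        unfold zK
        apply exp_le_exp.2
        set v := T ^ (-(2 / 3) : ℝ) with hv
        have hT0 : 0 < T := by linarith
        have hv0 : 0 < v := by positivity
        have hv3 : v ^ 3 = 1 / T ^ 2 := by
          rw [hv, ← Real.rpow_natCast, ← Real.rpow_mul hT0.le]
          rw [show (-(2/3) : ℝ) * (3:ℕ) = -(2:ℕ) by push_cast; norm_num, Real.rpow_neg hT0.le, Real.rpow_natCast, one_div]
        have h5 : L ^ 3 / T ^ 2 = (v * L) ^ 3 := by rw [mul_pow, hv3]; ring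
        rw [h5]
        have h6 : (1 - σ) * L ≤ v * L := mul_le_mul_of_nonneg_right hσ hL0
        set y := v * L
        have hy : 0 ≤ y := by positivity
        have h7 : y - 1 / 10 ^ 11 * y ^ 3 ≤ 10 ^ 6 := by
          rcases le_total y (10 ^ 6) with h | h
          · have : 0 ≤ y ^ 3 := by positivity
            linarith
          · have : (10 ^ 6) ^ 2 * y ≤ y ^ 3 := by
              rw [show y ^ 3 = y ^ 2 * y by ring]; gcongr
            linarith
        linarith

lemma dyadic_bd (I : ℕ) (σ t : ℝ) (hσ0 : 0 ≤ σ) (ht : 1 ≤ log t) (ht0 : 0 < t)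
    (hI : log (2 ^ I) / 2 ≤ log t) (hσ : 1 - σ ≤ log t ^ (-(2 / 3) : ℝ)) :
    ‖∑ n ∈ Ioc (0:ℕ) (2 ^ I), (n:ℂ) ^ (-(⟨σ, t⟩ : ℂ))‖ ≤ 1 + I * zK := by
  induction I with
  | zero => rw [pow_zero, show Ioc 0 1 = {1} from rfl]; simp
  | succ I ih =>
    have h0 : log ((2:ℝ) ^ I) ≤ log (2 ^ (I + 1)) := log_le_log (by positivity) (pow_le_pow_right₀ (by norm_num) (by omega))
    have hle : 2 ^ I ≤ 2 ^ (I + 1) := Nat.pow_le_pow_right (by norm_num) (by omega)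
    have h1 : Ioc 0 (2 ^ (I + 1)) = Ioc 0 (2 ^ I) ∪ Ioc (2 ^ I) (2 ^ (I + 1)) := by
      rw [Ioc_union_Ioc_eq_Ioc (by positivity) hle]
    rw [h1, sum_union (disjoint_left.2 fun a ha hb => by simp only [mem_Ioc] at ha hb; omega)]
    have h2 := block_bd (2 ^ I) (2 ^ (I + 1)) (Nat.one_le_two_pow) hle (by rw [pow_succ]; omega) σ t hσ0 ht ht0
      (by push_cast; linarith) hσ
    refine (norm_add_le _ _).trans ?_
    push_cast
    linarith [ih (by linarith)]

end VK

namespace VK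

noncomputable def gz (n : ℕ) (s : ℂ) : ℂ :=
  (s - 1) * ((n + 1 : ℕ) : ℂ) ^ (-s) + ((n + 2 : ℕ) : ℂ) ^ (1 - s) - ((n + 1 : ℕ) : ℂ) ^ (1 - s)

lemma hasDeriv_cpow (c : ℂ) (x : ℝ) (hx : 0 < x) : HasDerivAt (fun y : ℝ => (y:ℂ) ^ c) (c * (x:ℂ) ^ (c - 1)) x := by
  have h := ((hasDerivAt_id (x:ℂ)).cpow_const (c := c) (by simp [Complex.slitPlane, hx])).comp_ofReal
  simpa using h

lemma cpow_lip (s : ℂ) (hs : 0 ≤ s.re) (m x : ℝ) (hm : 0 < m) (hx : m ≤ x) :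
    ‖(x:ℂ) ^ (-s) - (m:ℂ) ^ (-s)‖ ≤ ‖s‖ * m ^ (-s.re - 1) * (x - m) := by
  have h := Convex.norm_image_sub_le_of_norm_hasDerivWithin_le (f := fun y : ℝ => (y:ℂ) ^ (-s)) (f' := fun y => -s * (y:ℂ) ^ (-s - 1))
    (s := Set.Icc m x) (x := m) (y := x) (C := ‖s‖ * m ^ (-s.re - 1))
    (fun y hy => (hasDeriv_cpow (-s) y (hm.trans_le hy.1)).hasDerivWithinAt)
    (fun y hy => by
      have hy0 : 0 < y := hm.trans_le hy.1
      rw [norm_mul, norm_neg, norm_cpow_eq_rpow_re_of_pos hy0]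
      refine mul_le_mul_of_nonneg_left ?_ (norm_nonneg _)
      simp only [sub_re, neg_re, Complex.one_re]
      exact Real.rpow_le_rpow_of_nonpos hm hy.1 (by linarith)) (convex_Icc m x) ⟨le_rfl, hx⟩ ⟨hx, le_rfl⟩
  rwa [Real.norm_of_nonneg (by linarith)] at h

lemma gz_bd (n : ℕ) (s : ℂ) (hs : 0 ≤ s.re) : ‖gz n s‖ ≤ ‖s - 1‖ * ‖s‖ * ((n + 1 : ℕ) : ℝ) ^ (-s.re - 1) := by
  set m : ℝ := ((n + 1 : ℕ) : ℝ) with hm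
  have hm0 : 0 < m := by rw [hm]; positivity
  have hC : ∀ y ∈ Set.Icc m (m + 1), ‖(s - 1) * (m:ℂ) ^ (-s) + (1 - s) * (y:ℂ) ^ (1 - s - 1)‖ ≤ ‖s - 1‖ * (‖s‖ * m ^ (-s.re - 1)) := by
    intro y hy
    rw [show (s - 1) * (m:ℂ) ^ (-s) + (1 - s) * (y:ℂ) ^ (1 - s - 1) = -((s - 1) * ((y:ℂ) ^ (-s) - (m:ℂ) ^ (-s))) by
      rw [show 1 - s - 1 = -s by ring]; ring, norm_neg, norm_mul]
    refine mul_le_mul_of_nonneg_left ((cpow_lip s hs m y hm0 hy.1).trans ?_) (norm_nonneg _)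
    refine mul_le_of_le_one_right (by positivity) (by linarith [hy.2])
  have h := Convex.norm_image_sub_le_of_norm_hasDerivWithin_le (f := fun y : ℝ => (y:ℂ) * ((s - 1) * (m:ℂ) ^ (-s)) + (y:ℂ) ^ (1 - s))
    (f' := fun y => (s - 1) * (m:ℂ) ^ (-s) + (1 - s) * (y:ℂ) ^ (1 - s - 1)) (s := Set.Icc m (m + 1)) (x := m) (y := m + 1)
    (fun y hy => by
      have h1 := (hasDerivAt_id (y:ℂ)).comp_ofReal.mul_const ((s - 1) * (m:ℂ) ^ (-s))
      have h2 := h1.add (hasDeriv_cpow (1 - s) y (hm0.trans_le hy.1))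
      simp only [one_mul, id] at h2
      exact h2.hasDerivWithinAt) hC (convex_Icc _ _) ⟨le_rfl, by linarith⟩ ⟨by linarith, le_rfl⟩
  have e : gz n s = ((m + 1 : ℝ) : ℂ) * ((s - 1) * (m:ℂ) ^ (-s)) + ((m + 1 : ℝ) : ℂ) ^ (1 - s) - ((m:ℂ) * ((s - 1) * (m:ℂ) ^ (-s)) + (m:ℂ) ^ (1 - s)) := by
    have e2 : ((m + 1 : ℝ) : ℂ) = ((n + 2 : ℕ) : ℂ) := by rw [hm]; push_cast; ring
    have e1 : (m : ℂ) = ((n + 1 : ℕ) : ℂ) := by rw [hm]; push_cast; ring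
    have e3 : ((m + 1 : ℝ) : ℂ) = m + 1 := by push_cast; ring
    rw [gz, ← e2, ← e1, e3]; ring
  rw [e]
  refine h.trans (le_of_eq ?_)
  rw [add_sub_cancel_left, norm_one]; ring

lemma gz_partial (N : ℕ) (s : ℂ) : ∑ n ∈ Finset.range N, gz n s =
    (s - 1) * ∑ n ∈ Ioc 0 N, (n:ℂ) ^ (-s) + ((N + 1 : ℕ) : ℂ) ^ (1 - s) - 1 := by
  induction N with
  | zero => simp
  | succ N ih =>
    have hi : Ioc 0 (N + 1) = insert (N + 1) (Ioc 0 N) := by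
      ext a; simp only [mem_Ioc, mem_insert]; omega
    rw [sum_range_succ, ih, hi, sum_insert (by simp), gz]; ring

lemma gz_summable (s : ℂ) (hs : 0 < s.re) : Summable (fun n => gz n s) := by
  have h : Summable (fun n : ℕ => ‖s - 1‖ * ‖s‖ * ((n + 1 : ℕ) : ℝ) ^ (-s.re - 1)) := by
    refine Summable.mul_left _ ?_
    exact (summable_nat_add_iff 1).2 (Real.summable_nat_rpow.2 (by linarith))
  exact Summable.of_norm_bounded h (fun n => gz_bd n s hs.le)

lemma gz_tsum_one (s : ℂ) (hs : 1 < s.re) : ∑' n, gz n s = riemannZeta₁ s - 1 := by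
  have h1 := (gz_summable s (by linarith)).hasSum.tendsto_sum_nat
  refine tendsto_nhds_unique h1 ?_
  simp_rw [gz_partial]
  have hs1 : s ≠ 1 := by rintro rfl; simp at hs
  have hz : riemannZeta₁ s = (s - 1) * riemannZeta s + 0 := by
    rw [riemannZeta_eq_inv_sub_mul hs1, add_zero, mul_inv_cancel_left₀ (sub_ne_zero.2 hs1)]
  rw [hz]
  refine Tendsto.sub_const (Tendsto.add (Tendsto.const_mul _ ?_) ?_) 1
  · rw [zeta_eq_tsum_one_div_nat_add_one_cpow hs]
    have hsum : Summable (fun n : ℕ => 1 / ((n:ℂ) + 1) ^ s) := by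
      have := (summable_nat_add_iff 1).2 (Complex.summable_one_div_nat_cpow.2 hs)
      simpa using this
    have := hsum.hasSum.tendsto_sum_nat
    refine this.congr fun N => ?_
    induction N with
    | zero => simp
    | succ N ih =>
      rw [sum_range_succ, ih, ← Finset.insert_Ioc_right_eq_Ioc_add_one (Nat.zero_le N), sum_insert (by simp), add_comm, cpow_neg, one_div]
      push_cast; rfl
  · rw [tendsto_zero_iff_norm_tendsto_zero]
    have h2 : Tendsto (fun N : ℕ => ((N + 1 : ℕ) : ℝ) ^ (-(s.re - 1))) atTop (nhds 0) :=
      (tendsto_rpow_neg_atTop (by linarith)).comp (tendsto_natCast_atTop_atTop.comp (tendsto_add_atTop_nat 1))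
    refine h2.congr fun N => ?_
    have := norm_cpow_eq_rpow_re_of_pos (x := ((N + 1 : ℕ) : ℝ)) (by positivity) (1 - s)
    rw [ofReal_natCast] at this
    rw [this]; congr 1; simp

lemma gz_tsum (s : ℂ) (hs : 1 / 2 ≤ s.re) : ∑' n, gz n s = riemannZeta₁ s - 1 := by
  set R := ‖s‖ + 3 with hR
  set U : Set ℂ := {z | 1 / 4 < z.re} ∩ Metric.ball 0 R with hU
  have hUo : IsOpen U := (isOpen_lt continuous_const continuous_re).inter Metric.isOpen_ball
  have hUc : IsPreconnected U := ((convex_halfSpace_re_gt _).inter (convex_ball 0 R)).isPreconnected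
  have hsum : Summable (fun n : ℕ => (R + 1) * R * ((n + 1 : ℕ) : ℝ) ^ (-(5/4) : ℝ)) := by
    refine Summable.mul_left _ ?_
    exact (summable_nat_add_iff 1).2 (Real.summable_nat_rpow.2 (by norm_num))
  have hd : DifferentiableOn ℂ (fun z => ∑' n, gz n z) U := by
    refine Complex.differentiableOn_tsum_of_summable_norm hsum (fun n => ?_) hUo fun n z hz => ?_
    · unfold gz
      have h1 : ((n + 1 : ℕ) : ℂ) ≠ 0 := by exact_mod_cast Nat.succ_ne_zero n
      have h2 : ((n + 2 : ℕ) : ℂ) ≠ 0 := by exact_mod_cast Nat.succ_ne_zero (n+1)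
      intro z _
      refine DifferentiableAt.differentiableWithinAt ?_
      refine DifferentiableAt.sub (DifferentiableAt.add (DifferentiableAt.mul (by fun_prop) ?_) ?_) ?_
      · exact DifferentiableAt.const_cpow (by fun_prop) (Or.inl h1)
      · exact DifferentiableAt.const_cpow (by fun_prop) (Or.inl h2)
      · exact DifferentiableAt.const_cpow (by fun_prop) (Or.inl h1)
    · have hz1 : 1 / 4 < z.re := hz.1
      have hz2 : ‖z‖ < R := by simpa using hz.2
      refine (gz_bd n z (by linarith)).trans ?_
      refine mul_le_mul (mul_le_mul ?_ hz2.le (norm_nonneg _) (by positivity)) ?_ (by positivity) (by positivity)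
      · refine (norm_sub_le _ _).trans ?_; rw [norm_one]; linarith
      · exact Real.rpow_le_rpow_of_exponent_le (by exact_mod_cast Nat.le_add_left 1 _) (by linarith)
  have hn : 0 ≤ ‖s‖ := norm_nonneg s
  refine AnalyticOnNhd.eqOn_of_preconnected_of_eventuallyEq (hd.analyticOnNhd hUo)
    ((differentiable_riemannZeta₁.sub_const 1).differentiableOn.analyticOnNhd hUo) hUc (z₀ := 2) ?_ ?_ ?_
  · refine ⟨by norm_num [Set.mem_ofPred_eq], ?_⟩
    simp; linarith
  · have : {z : ℂ | 1 < z.re} ∈ nhds (2:ℂ) := (isOpen_lt continuous_const continuous_re).mem_nhds (by norm_num)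
    filter_upwards [this] with z hz using gz_tsum_one z hz
  · refine ⟨by show 1 / 4 < s.re; linarith, ?_⟩
    simp; linarith

lemma tail_aux (m : ℕ) (hm : 1 ≤ m) : ((m + 1 : ℕ) : ℝ) ^ (-(3/2) : ℝ) ≤ 2 * (1 / √(m:ℝ) - 1 / √((m + 1 : ℕ):ℝ)) := by
  set a := √(m:ℝ) with ha
  set b := √((m + 1 : ℕ):ℝ) with hb
  have ha0 : 0 < a := Real.sqrt_pos.2 (by exact_mod_cast hm)
  have hb0 : 0 < b := Real.sqrt_pos.2 (by positivity)
  have ha2 : a ^ 2 = m := Real.sq_sqrt (by positivity)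
  have hb2 : b ^ 2 = m + 1 := by rw [hb, Real.sq_sqrt (by positivity)]; push_cast; ring
  have hab : a ≤ b := Real.sqrt_le_sqrt (by push_cast; linarith)
  have h1 : ((m + 1 : ℕ) : ℝ) ^ (-(3/2) : ℝ) = 1 / b ^ 3 := by
    rw [Real.rpow_neg (by positivity), ← one_div]; congr 1
    rw [hb, Real.sqrt_eq_rpow, ← Real.rpow_natCast, ← Real.rpow_mul (by positivity)]; norm_num
  rw [h1]
  have h2 : 1 / a - 1 / b = 1 / (a * b * (a + b)) := by
    have : (b - a) * (a + b) = 1 := by nlinarith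
    field_simp; linarith
  rw [h2, mul_one_div, div_le_div_iff₀ (by positivity) (by positivity)]
  have : a * b * (a + b) ≤ b * b * (b + b) := by gcongr
  nlinarith

lemma tail_bd (s : ℂ) (hs : 1 / 2 ≤ s.re) (N : ℕ) (hN : 1 ≤ N) :
    ‖∑' n, gz (n + N) s‖ ≤ ‖s - 1‖ * ‖s‖ * (2 / √N) := by
  refine tsum_of_norm_bounded (g := fun n => ‖s - 1‖ * ‖s‖ * (2 * (1 / √((n + N : ℕ):ℝ) - 1 / √((n + 1 + N : ℕ):ℝ)))) ?_ fun n => ?_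
  · refine HasSum.mul_left _ ?_
    rw [show (2:ℝ) / √N = 2 * (1 / √((0 + N : ℕ):ℝ) - 0) by simp; ring]
    refine HasSum.mul_left _ ?_
    have hnn : ∀ n : ℕ, 0 ≤ 1 / √((n + N : ℕ):ℝ) - 1 / √((n + 1 + N : ℕ):ℝ) := by
      intro n
      rw [sub_nonneg]
      refine one_div_le_one_div_of_le (Real.sqrt_pos.2 (by exact_mod_cast (by omega : 0 < n + N))) (Real.sqrt_le_sqrt (by push_cast; linarith))
    rw [hasSum_iff_tendsto_nat_of_nonneg hnn]
    simp_rw [Finset.sum_range_sub' (fun n : ℕ => 1 / √((n + N : ℕ):ℝ))]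
    refine Tendsto.const_sub _ ?_
    simp_rw [one_div]
    refine tendsto_inv_atTop_zero.comp (Real.tendsto_sqrt_atTop.comp (tendsto_natCast_atTop_atTop.comp (tendsto_add_atTop_nat N)))
  · refine (gz_bd (n + N) s (by linarith)).trans (mul_le_mul_of_nonneg_left ?_ (by positivity))
    have h1 : ((n + N + 1 : ℕ):ℝ) ^ (-s.re - 1) ≤ ((n + N + 1 : ℕ):ℝ) ^ (-(3/2) : ℝ) :=
      Real.rpow_le_rpow_of_exponent_le (by exact_mod_cast Nat.le_add_left 1 _) (by linarith)
    refine (h1.trans (tail_aux (n + N) (by omega))).trans (le_of_eq ?_)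
    rw [show n + 1 + N = n + N + 1 by ring]

theorem zeta_approx (s : ℂ) (hs : 1 / 2 ≤ s.re) (hs1 : s ≠ 1) (N : ℕ) (hN : 1 ≤ N) :
    ‖riemannZeta s - ∑ n ∈ Ioc 0 N, (n:ℂ) ^ (-s)‖ ≤ ((N + 1 : ℕ):ℝ) ^ (1 - s.re) / ‖s - 1‖ + ‖s‖ * (2 / √N) := by
  have h1 := (gz_summable s (by linarith)).sum_add_tsum_nat_add N
  rw [gz_tsum s hs, gz_partial] at h1
  have hs2 : s - 1 ≠ 0 := sub_ne_zero.2 hs1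
  have hz : riemannZeta₁ s = (s - 1) * riemannZeta s := by
    rw [riemannZeta_eq_inv_sub_mul hs1, mul_inv_cancel_left₀ hs2]
  have h2 : riemannZeta s - ∑ n ∈ Ioc 0 N, (n:ℂ) ^ (-s) = (((N + 1 : ℕ) : ℂ) ^ (1 - s) + ∑' n, gz (n + N) s) / (s - 1) := by
    rw [eq_div_iff hs2]
    rw [hz] at h1
    linear_combination -h1
  have hpos : 0 < ‖s - 1‖ := norm_pos_iff.2 hs2
  rw [h2, norm_div, div_le_iff₀ hpos, add_mul, div_mul_cancel₀ _ hpos.ne']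
  refine (norm_add_le _ _).trans (add_le_add ?_ ((tail_bd s hs N hN).trans (le_of_eq (by ring))))
  have := norm_cpow_eq_rpow_re_of_pos (x := ((N + 1 : ℕ) : ℝ)) (by positivity) (1 - s)
  rw [ofReal_natCast] at this
  rw [this]; simp

theorem zeta_bd (σ t : ℝ) (hσ1 : 1 / 2 ≤ σ) (hσ3 : σ ≤ 3) (ht : 1 ≤ log t) (ht0 : 0 < t)
    (hσ : 1 - σ ≤ log t ^ (-(2 / 3) : ℝ)) : ‖riemannZeta ⟨σ, t⟩‖ ≤ 20 * zK * log t := by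
  have ht1 : 2 ≤ t := by
    have := exp_log ht0
    have h2 := add_one_le_exp (log t)
    linarith
  obtain ⟨I, hI1, hI2⟩ : ∃ I : ℕ, (2:ℝ) ^ I ≤ t ^ 2 ∧ t ^ 2 < (2:ℝ) ^ (I + 1) := exists_nat_pow_near (by nlinarith) (by norm_num)
  have hlI : log ((2:ℝ) ^ I) / 2 ≤ log t := by
    have := log_le_log (by positivity) hI1
    rw [log_pow t] at this; push_cast at this; linarith
  have hIb : (I:ℝ) ≤ 4 * log t := by
    rw [log_pow] at hlI
    have := Real.log_two_gt_d9
    have : (0:ℝ) ≤ I := by positivity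
    nlinarith
  have h1 := dyadic_bd I σ t (by linarith) ht ht0 hlI hσ
  have hne : (⟨σ, t⟩ : ℂ) ≠ 1 := by
    intro h; have := congrArg Complex.im h; simp at this; linarith
  have h2 := zeta_approx ⟨σ, t⟩ hσ1 hne (2 ^ I) Nat.one_le_two_pow
  have hs1 : t ≤ ‖(⟨σ, t⟩ : ℂ) - 1‖ := by
    have := abs_im_le_norm ((⟨σ, t⟩ : ℂ) - 1)
    simp at this; exact (le_abs_self t).trans this
  have hs : ‖(⟨σ, t⟩ : ℂ)‖ ≤ 3 * t := by
    have := norm_le_abs_re_add_abs_im (⟨σ, t⟩ : ℂ)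
    simp only at this
    rw [abs_of_pos (by linarith), abs_of_pos ht0] at this
    linarith
  have hA : (((2 ^ I + 1 : ℕ):ℝ)) ^ (1 - σ) / ‖(⟨σ, t⟩ : ℂ) - 1‖ ≤ 2 := by
    rw [div_le_iff₀ (by linarith)]
    have h3 : (((2 ^ I + 1 : ℕ):ℝ)) ≤ (2 * t) ^ 2 := by push_cast; nlinarith
    calc (((2 ^ I + 1 : ℕ):ℝ)) ^ (1 - σ) ≤ (((2 ^ I + 1 : ℕ):ℝ)) ^ (1 / 2 : ℝ) :=
          Real.rpow_le_rpow_of_exponent_le (by exact_mod_cast Nat.le_add_left 1 _) (by linarith)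
      _ ≤ ((2 * t) ^ 2) ^ (1 / 2 : ℝ) := Real.rpow_le_rpow (by positivity) h3 (by norm_num)
      _ = 2 * t := by rw [← Real.sqrt_eq_rpow, Real.sqrt_sq (by linarith)]
      _ ≤ _ := by linarith
  have hB : ‖(⟨σ, t⟩ : ℂ)‖ * (2 / √((2 ^ I : ℕ):ℝ)) ≤ 12 := by
    have h4 : t / 2 ≤ √((2 ^ I : ℕ):ℝ) := by
      apply Real.le_sqrt_of_sq_le; push_cast
      rw [pow_succ (2:ℝ) I] at hI2; nlinarith
    calc _ ≤ (3 * t) * (2 / (t / 2)) := by gcongr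
      _ = 12 := by field_simp; norm_num
  have hK : 1 ≤ zK := by unfold zK; apply one_le_exp; norm_num
  have h5 := norm_le_norm_add_norm_sub' (riemannZeta ⟨σ, t⟩) (∑ n ∈ Ioc (0:ℕ) (2 ^ I), (n:ℂ) ^ (-(⟨σ, t⟩ : ℂ)))
  have h6 : (I:ℝ) * zK ≤ 4 * log t * zK := by gcongr
  have h7 : 1 ≤ log t * zK := by nlinarith
  simp only at h2
  nlinarith

end VK

namespace VK

lemma nv_bd (f : ℂ → ℂ) (R M : ℝ) (hR : 0 < R) (hM : 0 < M) (hf : DifferentiableOn ℂ f (Metric.ball 0 R))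
    (h0 : ∀ z ∈ Metric.ball (0:ℂ) R, f z ≠ 0) (hb : ∀ z ∈ Metric.ball (0:ℂ) R, ‖f z‖ ≤ ‖f 0‖ * exp M)
    (z : ℂ) (hz : ‖z‖ ≤ R / 2) : ‖deriv f z / f z‖ ≤ 24 * M / R := by
  have hd : DifferentiableOn ℂ (fun z => deriv f z / f z) (Metric.ball 0 R) :=
    (hf.deriv Metric.isOpen_ball).div hf h0
  obtain ⟨g, hg0, hg⟩ := hd.isExactOn_ball.with_val_at 0 0
  have h00 : (0:ℂ) ∈ Metric.ball (0:ℂ) R := by simpa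
  have hfg : ∀ z ∈ Metric.ball (0:ℂ) R, f z = f 0 * Complex.exp (g z) := by
    have hc : ∀ z ∈ Metric.ball (0:ℂ) R, HasDerivAt (fun z => f z * Complex.exp (- g z)) 0 z := by
      intro z hz
      have h1 := (hf.differentiableAt (Metric.isOpen_ball.mem_nhds hz)).hasDerivAt.mul (hg z hz).neg.cexp
      have e : deriv f z * Complex.exp ((-g) z) + f z * (Complex.exp ((-g) z) * -(deriv f z / f z)) = 0 := by
        have := h0 z hz
        field_simp; ring
      rw [e] at h1; exact h1
    intro z hz
    have h2 := (convex_ball (0:ℂ) R).is_const_of_fderivWithin_eq_zero (𝕜 := ℂ) (f := fun z => f z * Complex.exp (- g z))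
      (fun z hz => (hc z hz).differentiableAt.differentiableWithinAt) (fun z hz => by
        rw [fderivWithin_of_isOpen Metric.isOpen_ball hz, (hc z hz).hasFDerivAt.fderiv]; ext; simp) hz h00
    simp only [hg0, neg_zero, Complex.exp_zero, mul_one] at h2
    rw [← h2, mul_assoc, ← Complex.exp_add]; simp
  have hre : Set.MapsTo g (Metric.ball 0 R) {z | z.re ≤ M} := by
    intro z hz
    have h1 := hb z hz
    rw [hfg z hz, norm_mul, Complex.norm_exp] at h1
    exact (exp_le_exp.1 (le_of_mul_le_mul_left h1 (norm_pos_iff.2 (h0 0 h00))))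
  have hgd : DifferentiableOn ℂ g (Metric.ball 0 R) := fun z hz => (hg z hz).differentiableAt.differentiableWithinAt
  have hzb : z ∈ Metric.ball (0:ℂ) R := by rw [mem_ball_zero_iff]; linarith
  rw [← (hg z hzb).deriv]
  have hsub : Metric.closedBall z (R / 4) ⊆ Metric.ball 0 R := fun w hw => by
    rw [mem_closedBall_iff_norm] at hw; rw [mem_ball_zero_iff]
    have := norm_le_norm_add_norm_sub' w z; linarith
  have := Complex.norm_deriv_le_of_forall_mem_sphere_norm_le (c := z) (R := R / 4) (C := 6 * M) (by linarith)
    (hgd.diffContOnCl_ball hsub) (fun w hw => ?_)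
  · refine this.trans_eq ?_; field_simp; norm_num
  · have hw1 : ‖w‖ ≤ 3 * R / 4 := by
      rw [mem_sphere_iff_norm] at hw
      have := norm_le_norm_add_norm_sub' w z; linarith
    have h3 := Complex.borelCaratheodory_zero hM hgd hre hR (hsub (Metric.sphere_subset_closedBall hw)) hg0
    refine h3.trans ?_
    rw [div_le_iff₀ (by linarith)]; nlinarith

lemma rem_zero (f : ℂ → ℂ) (R A : ℝ) (hR : 0 < R) (hf : DifferentiableOn ℂ f (Metric.closedBall 0 R))
    (hb : ∀ z ∈ Metric.closedBall (0:ℂ) R, ‖f z‖ ≤ A) (h0 : f 0 ≠ 0) (w : ℂ) (hw : ‖w‖ < R) (hfw : f w = 0) :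
    ∃ g : ℂ → ℂ, DifferentiableOn ℂ g (Metric.closedBall 0 R) ∧ (∀ z ∈ Metric.closedBall (0:ℂ) R, ‖g z‖ ≤ A) ∧
      g 0 ≠ 0 ∧ ‖g 0‖ = ‖f 0‖ * (R / ‖w‖) ∧ (∀ z ∈ Metric.closedBall (0:ℂ) R, g z = 0 → f z = 0) ∧
      deriv f 0 / f 0 = deriv g 0 / g 0 - 1 / w + (starRingEnd ℂ w) / R ^ 2 := by
  have hw0 : w ≠ 0 := by rintro rfl; exact h0 hfw
  have hRc : (R:ℂ) ≠ 0 := by exact_mod_cast hR.ne'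
  have hwb : Metric.closedBall (0:ℂ) R ∈ nhds w := Metric.closedBall_mem_nhds_of_mem (by simpa)
  have h0b : Metric.closedBall (0:ℂ) R ∈ nhds 0 := Metric.closedBall_mem_nhds 0 hR
  set cw := starRingEnd ℂ w with hcw
  have hds := (differentiableOn_dslope hwb).2 hf
  set g : ℂ → ℂ := fun z => dslope f w z * ((R ^ 2 - cw * z) / R) with hg
  have hgd : DifferentiableOn ℂ g (Metric.closedBall 0 R) := hds.mul (by fun_prop)
  have hfd : ∀ z, f z = (z - w) * dslope f w z := fun z => by
    have := sub_smul_dslope f w z; rw [hfw, sub_zero, smul_eq_mul] at this; exact this.symm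
  have hd0 : dslope f w 0 ≠ 0 := fun h => h0 (by rw [hfd, h, mul_zero])
  have hg0 : g 0 = dslope f w 0 * R := by simp only [hg, mul_zero, sub_zero]; field_simp
  have hnw : ∀ z ∈ Metric.closedBall (0:ℂ) R, (R:ℂ) ^ 2 - cw * z ≠ 0 := by
    intro z hz h
    rw [mem_closedBall_zero_iff] at hz
    have h1 : ‖(R:ℂ) ^ 2‖ = ‖cw * z‖ := by rw [sub_eq_zero.1 h]
    rw [norm_mul, norm_pow, norm_real, Real.norm_eq_abs, sq_abs, hcw, norm_conj] at h1
    nlinarith [norm_nonneg w, norm_nonneg z]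
  refine ⟨g, hgd, ?_, ?_, ?_, ?_, ?_⟩
  · intro z hz
    refine Complex.norm_le_of_forall_mem_frontier_norm_le (U := Metric.ball 0 R) Metric.isBounded_ball
      (hgd.diffContOnCl_ball subset_rfl) (fun z hz => ?_) (by rwa [closure_ball _ hR.ne'])
    rw [frontier_ball _ hR.ne'] at hz
    have h1 := Complex.norm_canonicalFactor_eval_circle_eq_one (w := w) (by simpa using hw) hz
    have hzw : z - w ≠ 0 := by
      intro h; rw [sub_eq_zero.1 h, mem_sphere_zero_iff_norm] at hz; linarith
    have : g z = f z * Complex.canonicalFactor R w z := by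
      rw [hfd, Complex.canonicalFactor_apply, hg]; simp only; rw [← hcw]; field_simp
    rw [this, norm_mul, h1, mul_one]
    exact hb z (Metric.sphere_subset_closedBall hz)
  · rw [hg0]; exact mul_ne_zero hd0 hRc
  · rw [hg0, hfd 0, norm_mul, norm_mul, norm_real, Real.norm_eq_abs, abs_of_pos hR, zero_sub, norm_neg]
    have := norm_pos_iff.2 hw0
    field_simp
  · intro z hz h
    rw [hfd]
    rcases mul_eq_zero.1 h with h | h
    · rw [h, mul_zero]
    · exact absurd h (div_ne_zero (hnw z hz) hRc)
  · have hdd := (hds.differentiableAt h0b).hasDerivAt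
    have h1 : HasDerivAt f (1 * dslope f w 0 + (0 - w) * deriv (dslope f w) 0) 0 := by
      have := ((hasDerivAt_id (0:ℂ)).sub_const w).mul hdd
      exact this.congr_of_eventuallyEq (Eventually.of_forall hfd)
    have h2 : HasDerivAt g (deriv (dslope f w) 0 * ((R ^ 2 - cw * 0) / R) + dslope f w 0 * ((0 - cw * 1) / R)) 0 :=
      hdd.mul ((((hasDerivAt_const (0:ℂ) ((R:ℂ) ^ 2)).sub ((hasDerivAt_id (0:ℂ)).const_mul cw))).div_const (R:ℂ))
    rw [h1.deriv, h2.deriv, hg0, hfd 0]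
    field_simp; ring

lemma landau_ind (R M A : ℝ) (hR : 0 < R) (hM : 0 < M) (n : ℕ) : ∀ f : ℂ → ℂ, DifferentiableOn ℂ f (Metric.closedBall 0 R) →
    (∀ z ∈ Metric.closedBall (0:ℂ) R, ‖f z‖ ≤ A) → f 0 ≠ 0 → A ≤ ‖f 0‖ * exp M → A ≤ ‖f 0‖ * 2 ^ n →
    (∀ z ∈ Metric.closedBall (0:ℂ) R, f z = 0 → z.re ≤ 0) → -(deriv f 0 / f 0).re ≤ 48 * M / R := by
  induction n with
  | zero =>
    intro f hf hb h0 hA hA2 hz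
    by_cases h : ∃ w : ℂ, ‖w‖ < R / 2 ∧ f w = 0
    · obtain ⟨w, hw, hfw⟩ := h
      obtain ⟨g, hgd, hgb, hg0, hgn, hgz, hgl⟩ := rem_zero f R A hR hf hb h0 w (by linarith) hfw
      exfalso
      have h1 := hgb 0 (by simp [hR.le])
      have hw0 : 0 < ‖w‖ := norm_pos_iff.2 (by rintro rfl; exact h0 hfw)
      have : 1 < R / ‖w‖ := by rw [lt_div_iff₀ hw0]; linarith
      have := norm_pos_iff.2 h0
      rw [hgn] at h1; nlinarith
    · push Not at h
      have := nv_bd f (R / 2) M (by linarith) hM (hf.mono (fun z hz => by simp at hz ⊢; linarith))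
        (fun z hz => h z (by simpa using hz)) (fun z hz => (hb z (by simp at hz ⊢; linarith)).trans hA) 0 (by simp; linarith)
      have h2 := (neg_le_abs _).trans ((abs_re_le_norm _).trans this)
      refine h2.trans_eq ?_; field_simp; norm_num
  | succ n ih =>
    intro f hf hb h0 hA hA2 hz
    by_cases h : ∃ w : ℂ, ‖w‖ < R / 2 ∧ f w = 0
    · obtain ⟨w, hw, hfw⟩ := h
      obtain ⟨g, hgd, hgb, hg0, hgn, hgz, hgl⟩ := rem_zero f R A hR hf hb h0 w (by linarith) hfw
      have hw0 : 0 < ‖w‖ := norm_pos_iff.2 (by rintro rfl; exact h0 hfw)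
      have h2 : 2 ≤ R / ‖w‖ := by rw [le_div_iff₀ hw0]; linarith
      have h3 : 2 * ‖f 0‖ ≤ ‖g 0‖ := by rw [hgn]; nlinarith [norm_nonneg (f 0)]
      have h4 := ih g hgd hgb hg0 (hA.trans (by gcongr; linarith [norm_nonneg (f 0)]))
        (hA2.trans (by rw [pow_succ]; nlinarith [pow_pos (two_pos (α := ℝ)) n])) (fun z hz1 hz2 => hz z hz1 (hgz z hz1 hz2))
      have hwr := hz w (by simp; linarith) hfw
      have h5 : (1 / w).re = w.re / ‖w‖ ^ 2 := by rw [one_div, Complex.inv_re, normSq_eq_norm_sq]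
      have h6 : (starRingEnd ℂ w / (R:ℂ) ^ 2).re = w.re / R ^ 2 := by
        rw [← ofReal_pow, Complex.div_ofReal_re, Complex.conj_re]
      rw [hgl, add_re, sub_re, h5, h6]
      have h7 : w.re / ‖w‖ ^ 2 ≤ w.re / R ^ 2 := by
        rw [div_le_div_iff₀ (by positivity) (by positivity)]
        have : ‖w‖ ^ 2 ≤ R ^ 2 := by gcongr; linarith
        nlinarith
      linarith
    · push Not at h
      have := nv_bd f (R / 2) M (by linarith) hM (hf.mono (fun z hz => by simp at hz ⊢; linarith))
        (fun z hz => h z (by simpa using hz)) (fun z hz => (hb z (by simp at hz ⊢; linarith)).trans hA) 0 (by simp; linarith)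
      have h2 := (neg_le_abs _).trans ((abs_re_le_norm _).trans this)
      refine h2.trans_eq ?_; field_simp; norm_num

lemma landau (R M : ℝ) (hR : 0 < R) (hM : 0 < M) (f : ℂ → ℂ) (hf : DifferentiableOn ℂ f (Metric.closedBall 0 R))
    (hb : ∀ z ∈ Metric.closedBall (0:ℂ) R, ‖f z‖ ≤ ‖f 0‖ * exp M) (h0 : f 0 ≠ 0)
    (hz : ∀ z ∈ Metric.closedBall (0:ℂ) R, f z = 0 → z.re ≤ 0) : -(deriv f 0 / f 0).re ≤ 48 * M / R := by
  obtain ⟨n, hn⟩ := pow_unbounded_of_one_lt (exp M) one_lt_two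
  exact landau_ind R M _ hR hM n f hf hb h0 le_rfl (by gcongr) hz

lemma landau' (R M : ℝ) (hR : 0 < R) (hM : 0 < M) (f : ℂ → ℂ) (hf : DifferentiableOn ℂ f (Metric.closedBall 0 R))
    (hb : ∀ z ∈ Metric.closedBall (0:ℂ) R, ‖f z‖ ≤ ‖f 0‖ * exp M) (h0 : f 0 ≠ 0)
    (hz : ∀ z ∈ Metric.closedBall (0:ℂ) R, f z = 0 → z.re ≤ 0) (d : ℝ) (hd : 0 < d) (hdR : d < R) (hfd : f (-d:ℝ) = 0) :
    -(deriv f 0 / f 0).re ≤ 48 * M / R - 1 / d + d / R ^ 2 := by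
  have hnd : ‖((-d:ℝ):ℂ)‖ = d := by rw [norm_real, Real.norm_eq_abs, abs_neg, abs_of_pos hd]
  obtain ⟨g, hgd, hgb, hg0, hgn, hgz, hgl⟩ := rem_zero f R _ hR hf hb h0 (-d:ℝ) (by rw [hnd]; exact hdR) hfd
  have h2 : 1 ≤ R / d := by rw [le_div_iff₀ hd]; linarith
  have h4 := landau R M hR hM g hgd (fun z hz => (hgb z hz).trans (by
    gcongr; rw [hgn, hnd]; nlinarith [norm_nonneg (f 0)])) hg0 (fun z hz1 hz2 => hz z hz1 (hgz z hz1 hz2))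
  have e : (1 / (((-d:ℝ)):ℂ) - starRingEnd ℂ ((-d:ℝ):ℂ) / (R:ℂ) ^ 2).re = -(1 / d) + d / R ^ 2 := by
    rw [conj_ofReal]
    have : (1 / (((-d:ℝ)):ℂ) - ((-d:ℝ):ℂ) / (R:ℂ) ^ 2) = ((-(1 / d) + d / R ^ 2 : ℝ):ℂ) := by
      push_cast; rw [div_neg]; ring
    rw [this, ofReal_re]
  have e2 : deriv f 0 / f 0 = deriv g 0 / g 0 - (1 / (((-d:ℝ)):ℂ) - starRingEnd ℂ ((-d:ℝ):ℂ) / (R:ℂ) ^ 2) := by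
    rw [hgl]; ring
  rw [e2, sub_re, e]
  linarith

end VK

namespace VK

lemma LS_le (f : ℕ → ℂ) (g : ℕ → ℝ) (s : ℂ) (hs : LSeriesSummable (fun n => (g n : ℂ)) (s.re : ℂ))
    (h : ∀ n, ‖f n‖ ≤ g n) : ‖LSeries f s‖ ≤ ‖LSeries (fun n => (g n : ℂ)) (s.re : ℂ)‖ := by
  have hg : ∀ n, 0 ≤ g n := fun n => (norm_nonneg _).trans (h n)
  have e : ∀ n, LSeries.term (fun n => (g n : ℂ)) (s.re : ℂ) n = ((‖LSeries.term (fun n => (g n : ℂ)) (s.re : ℂ) n‖ : ℝ) : ℂ) := by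
    intro n
    rw [LSeries.norm_term_eq, LSeries.term_def]
    split_ifs with h0
    · simp
    · rw [norm_real, Real.norm_eq_abs, abs_of_nonneg (hg n)]; push_cast
      rw [ofReal_cpow (by positivity)]; simp
  have h1 : ‖LSeries (fun n => (g n : ℂ)) (s.re : ℂ)‖ = ∑' n, ‖LSeries.term (fun n => (g n : ℂ)) (s.re : ℂ) n‖ := by
    rw [LSeries, tsum_congr e, ← Complex.ofReal_tsum, norm_real, Real.norm_eq_abs, abs_of_nonneg (tsum_nonneg fun n => norm_nonneg _)]
  rw [h1]
  refine tsum_of_norm_bounded hs.norm.hasSum fun n => ?_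
  rw [LSeries.norm_term_eq, LSeries.norm_term_eq]
  split_ifs with h0
  · rfl
  · rw [norm_real, Real.norm_eq_abs, abs_of_nonneg (hg n), ofReal_re]; gcongr; exact h n

lemma one_fun : (fun _ : ℕ => ((1:ℝ):ℂ)) = 1 := by ext; simp

lemma zeta_le_re (s : ℂ) (hs : 1 < s.re) : ‖riemannZeta s‖ ≤ ‖riemannZeta (s.re : ℂ)‖ := by
  have hs' : 1 < (s.re : ℂ).re := by simpa
  rw [← LSeries_one_eq_riemannZeta hs, ← LSeries_one_eq_riemannZeta hs']
  have := LS_le 1 (fun _ => 1) s (by rw [one_fun]; exact LSeriesSummable_one_iff.2 hs') (by simp)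
  rwa [one_fun] at this

lemma zeta_inv_le (s : ℂ) (hs : 1 < s.re) : 1 ≤ ‖riemannZeta s‖ * ‖riemannZeta (s.re : ℂ)‖ := by
  have hs' : 1 < (s.re : ℂ).re := by simpa
  have h := LSeries_one_mul_Lseries_moebius hs
  rw [LSeries_one_eq_riemannZeta hs] at h
  have h2 := LS_le (fun n => ((ArithmeticFunction.moebius n : ℤ) : ℂ)) (fun _ => 1) s (by rw [one_fun]; exact LSeriesSummable_one_iff.2 hs') (fun n => by
    rw [Complex.norm_intCast]; exact_mod_cast ArithmeticFunction.abs_moebius_le_one)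
  have h3 : LSeries (fun _ => ((1:ℝ):ℂ)) (s.re : ℂ) = riemannZeta (s.re : ℂ) := by
    rw [← LSeries_one_eq_riemannZeta hs', one_fun]
  rw [h3] at h2
  calc (1:ℝ) = ‖riemannZeta s‖ * ‖LSeries (fun n => ((ArithmeticFunction.moebius n : ℤ) : ℂ)) s‖ := by rw [← norm_mul, h, norm_one]
    _ ≤ _ := by gcongr

lemma vM_eq (s : ℂ) (hs : 1 < s.re) : LSeries (fun n => ((ArithmeticFunction.vonMangoldt n : ℝ) : ℂ)) s = -deriv riemannZeta s / riemannZeta s :=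
  ArithmeticFunction.LSeries_vonMangoldt_eq_deriv_riemannZeta_div hs

lemma zld_le_re (s : ℂ) (hs : 1 < s.re) :
    ‖deriv riemannZeta s / riemannZeta s‖ ≤ ‖deriv riemannZeta (s.re : ℂ) / riemannZeta (s.re : ℂ)‖ := by
  have hs' : 1 < (s.re : ℂ).re := by simpa
  have := LS_le (fun n => ((ArithmeticFunction.vonMangoldt n : ℝ) : ℂ)) _ s (ArithmeticFunction.LSeriesSummable_vonMangoldt hs')
    (fun n => by rw [norm_real, Real.norm_eq_abs, abs_of_nonneg ArithmeticFunction.vonMangoldt_nonneg])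
  rwa [vM_eq s hs, vM_eq _ hs', neg_div, neg_div, norm_neg, norm_neg] at this

lemma tfo (σ t : ℝ) (hσ : 1 < σ) : 0 ≤ 3 * (-(deriv riemannZeta (σ:ℂ) / riemannZeta (σ:ℂ)).re)
    + 4 * (-(deriv riemannZeta ⟨σ, t⟩ / riemannZeta ⟨σ, t⟩).re) + (-(deriv riemannZeta ⟨σ, 2 * t⟩ / riemannZeta ⟨σ, 2 * t⟩).re) := by
  have h : ∀ s : ℂ, s.re = σ → HasSum (fun n => (LSeries.term (fun n => ((ArithmeticFunction.vonMangoldt n : ℝ) : ℂ)) s n).re)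
      (-(deriv riemannZeta s / riemannZeta s).re) := by
    intro s hs
    rw [← neg_re, ← neg_div, ← vM_eq s (by rw [hs]; exact hσ)]
    exact Complex.hasSum_re (ArithmeticFunction.LSeriesSummable_vonMangoldt (by rw [hs]; exact hσ)).hasSum
  refine (((h (σ:ℂ) (by simp)).mul_left 3).add ((h ⟨σ, t⟩ rfl).mul_left 4)).add (h ⟨σ, 2 * t⟩ rfl) |>.nonneg fun n => ?_
  rcases eq_or_ne n 0 with rfl | hn
  · simp
  have hn0 : (n:ℂ) ≠ 0 := by exact_mod_cast hn
  rw [LSeries.term_of_ne_zero hn, LSeries.term_of_ne_zero hn, LSeries.term_of_ne_zero hn]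
  have e1 : (⟨σ, t⟩ : ℂ) = σ + t * I := by apply Complex.ext <;> simp
  have e2 : (⟨σ, 2 * t⟩ : ℂ) = σ + t * I + t * I := by apply Complex.ext <;> simp; ring
  rw [e1, e2, cpow_add (_ + _) _ hn0, cpow_add _ _ hn0]
  have hz : ‖((n:ℂ) ^ (t * I))⁻¹‖ = 1 := by
    rw [norm_inv, Complex.norm_natCast_cpow_of_pos (Nat.pos_of_ne_zero hn)]; simp
  set z := ((n:ℂ) ^ (t * I))⁻¹ with hzd
  have e3 : (n:ℂ) ^ (t * I) = z⁻¹ := by rw [hzd, inv_inv]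
  rw [e3]
  have e4 : (n:ℂ) ^ (σ:ℂ) = (((n:ℝ) ^ σ : ℝ) : ℂ) := by rw [ofReal_cpow (by positivity)]; simp
  rw [e4]
  set c : ℝ := ArithmeticFunction.vonMangoldt n / (n:ℝ) ^ σ with hc
  have hc0 : 0 ≤ c := div_nonneg ArithmeticFunction.vonMangoldt_nonneg (by positivity)
  have f1 : ((ArithmeticFunction.vonMangoldt n : ℝ) : ℂ) / (((n:ℝ) ^ σ : ℝ) : ℂ) = (c : ℂ) := by rw [hc]; push_cast; rfl
  have f2 : ((ArithmeticFunction.vonMangoldt n : ℝ) : ℂ) / ((((n:ℝ) ^ σ : ℝ) : ℂ) * z⁻¹) = (c : ℂ) * z := by rw [← f1]; field_simp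
  have f3 : ((ArithmeticFunction.vonMangoldt n : ℝ) : ℂ) / ((((n:ℝ) ^ σ : ℝ) : ℂ) * z⁻¹ * z⁻¹) = (c : ℂ) * (z * z) := by rw [← f1]; field_simp
  rw [f1, f2, f3, re_ofReal_mul, re_ofReal_mul, ofReal_re, Complex.mul_re]
  have h4 : z.re ^ 2 + z.im ^ 2 = 1 := by
    have := sq_norm z; rw [hz, normSq_apply] at this; nlinarith
  have : 3 * c + 4 * (c * z.re) + c * (z.re * z.re - z.im * z.im) = c * (2 * (1 + z.re) ^ 2) := by
    have : z.im * z.im = 1 - z.re ^ 2 := by linarith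
    rw [this]; ring
  rw [this]; positivity

lemma zeta_real_bd (η : ℝ) (h0 : 0 < η) (h1 : η ≤ 1) : ‖riemannZeta ((1 + η : ℝ) : ℂ)‖ ≤ 8 / η := by
  have h := zeta_approx ((1 + η : ℝ) : ℂ) (by simp; linarith) (by norm_cast; linarith) 1 le_rfl
  have e1 : ‖((1 + η : ℝ) : ℂ) - 1‖ = η := by
    rw [← ofReal_one, ← ofReal_sub, norm_real, Real.norm_eq_abs, add_sub_cancel_left, abs_of_pos h0]
  rw [e1, norm_real, Real.norm_eq_abs, abs_of_pos (by linarith)] at h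
  simp at h
  have h2 : ((1:ℝ) + 1) ^ (-η) ≤ 1 := Real.rpow_le_one_of_one_le_of_nonpos (by norm_num) (by linarith)
  have h3 := norm_le_norm_add_norm_sub' (riemannZeta (1 + (η:ℂ))) 1
  push_cast
  rw [norm_one] at h3
  have h4 : ((1:ℝ) + 1) ^ (-η) / η ≤ 1 / η := by gcongr
  have h5 : 1 ≤ 1 / η := by rw [le_div_iff₀ h0]; linarith
  have e8 : 8 / η = 8 * (1 / η) := by ring
  rw [e8]; linarith

lemma zld_eq (s : ℂ) (hs : s ≠ 1) (h : riemannZeta₁ s ≠ 0) : deriv riemannZeta s / riemannZeta s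
    = - (s - 1)⁻¹ + (deriv riemannZeta₁ s) / (riemannZeta₁ s) := by
  have := sub_ne_zero.2 hs
  rw [deriv_riemannZeta_eq_neg_inv_sub_sq_mul_add hs, riemannZeta_eq_inv_sub_mul hs]
  field_simp

lemma z1_ne (s : ℂ) (hs : 1 ≤ s.re) : riemannZeta₁ s ≠ 0 := by
  rcases eq_or_ne s 1 with rfl | h
  · rw [riemannZeta₁_one]; exact one_ne_zero
  · intro h0; have := riemannZeta_ne_zero_of_one_le_re hs
    rw [riemannZeta_eq_inv_sub_mul h, h0, mul_zero] at this; exact this rfl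

lemma zld_real : ∃ C : ℝ, 0 ≤ C ∧ ∀ η : ℝ, 0 < η → η ≤ 1 →
    ‖deriv riemannZeta ((1 + η : ℝ) : ℂ) / riemannZeta ((1 + η : ℝ) : ℂ)‖ ≤ 1 / η + C := by
  have hc : ContinuousOn (fun η : ℝ => deriv riemannZeta₁ ((1 + η : ℝ) : ℂ) / riemannZeta₁ ((1 + η : ℝ) : ℂ)) (Set.Icc 0 1) := by
    refine ContinuousOn.div ?_ ?_ fun η hη => z1_ne _ (by simp; exact hη.1)
    · exact (differentiable_riemannZeta₁.deriv.continuous.comp (by fun_prop)).continuousOn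
    · exact (differentiable_riemannZeta₁.continuous.comp (by fun_prop)).continuousOn
  obtain ⟨C, hC⟩ := isCompact_Icc.exists_bound_of_continuousOn hc
  refine ⟨C, (norm_nonneg _).trans (hC 0 (by simp)), fun η h0 h1 => ?_⟩
  rw [zld_eq _ (by norm_cast; linarith) (z1_ne _ (by simp; linarith))]
  refine (norm_add_le _ _).trans (add_le_add ?_ (hC η ⟨h0.le, h1⟩))
  rw [norm_neg, norm_inv, ← ofReal_one, ← ofReal_sub, norm_real, Real.norm_eq_abs,
    add_sub_cancel_left, abs_of_pos h0, one_div]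

end VK

namespace VK

lemma zK_pos : 1 ≤ zK := by unfold zK; exact one_le_exp (by norm_num)

lemma zbd_abs (s : ℂ) (L : ℝ) (h1 : 1 / 2 ≤ s.re) (h3 : s.re ≤ 3) (ht : 3 ≤ |s.im|) (hL : log |s.im| ≤ L)
    (hs : 1 - s.re ≤ L ^ (-(2/3) : ℝ)) : ‖riemannZeta s‖ ≤ 20 * zK * L := by
  have hl : 1 ≤ log |s.im| := by
    rw [Real.le_log_iff_exp_le (by linarith)]; have := Real.exp_one_lt_d9; linarith
  have hb := zeta_bd s.re |s.im| h1 h3 hl (by linarith) (hs.trans (Real.rpow_le_rpow_of_nonpos (by linarith) hL (by norm_num)))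
  have h2 : ‖riemannZeta s‖ = ‖riemannZeta ⟨s.re, |s.im|⟩‖ := by
    rcases le_total 0 s.im with h | h
    · rw [abs_of_nonneg h]
    · rw [abs_of_nonpos h]
      have := riemannZeta_conj s
      have e : (starRingEnd ℂ) s = ⟨s.re, -s.im⟩ := by apply Complex.ext <;> simp
      rw [e] at this; rw [this, norm_conj]
  rw [h2]
  have := zK_pos
  exact hb.trans (by gcongr)

lemma ball_bd (η t L R M : ℝ) (hη : 0 < η) (hη1 : η ≤ 1) (ht : 4 ≤ |t|) (hL : log (|t| + 1) ≤ L) (hR : R ≤ L ^ (-(2/3) : ℝ) + η)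
    (hR1 : R ≤ 1 / 2) (hM : log (160 * zK * L / η) ≤ M) :
    DifferentiableOn ℂ (fun z => riemannZeta (⟨1 + η, t⟩ + z)) (Metric.closedBall 0 R) ∧
    ∀ z ∈ Metric.closedBall (0:ℂ) R, ‖riemannZeta (⟨1 + η, t⟩ + z)‖ ≤ ‖riemannZeta (⟨1 + η, t⟩ + 0)‖ * exp M := by
  have hzz : ∀ z ∈ Metric.closedBall (0:ℂ) R, |z.re| ≤ R ∧ |z.im| ≤ R := fun z hz => by
    rw [mem_closedBall_zero_iff] at hz
    exact ⟨(abs_re_le_norm z).trans hz, (abs_im_le_norm z).trans hz⟩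
  have him : ∀ z ∈ Metric.closedBall (0:ℂ) R, 3 ≤ |t + z.im| ∧ |t + z.im| ≤ |t| + 1 := fun z hz => by
    have h1 := (hzz z hz).2
    have h2 := abs_sub_abs_le_abs_sub t (-z.im)
    have h3 := abs_add_le t z.im
    rw [abs_neg, sub_neg_eq_add] at h2
    constructor <;> linarith
  have hL0 : 1 ≤ L := by
    refine le_trans ?_ hL
    rw [Real.le_log_iff_exp_le (by linarith)]; have := Real.exp_one_lt_d9; linarith
  have hzK := zK_pos
  constructor
  · intro z hz
    have hne : (⟨1 + η, t⟩ + z : ℂ) ≠ 1 := by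
      intro h; have := congrArg Complex.im h; simp at this
      have h2 := (him z hz).1; rw [this] at h2; norm_num at h2
    exact ((differentiableAt_riemannZeta hne).comp z (by fun_prop)).differentiableWithinAt
  · intro z hz
    have h1 := hzz z hz
    have h2 := him z hz
    have h4 := abs_le.1 h1.1
    have hb := zbd_abs (⟨1 + η, t⟩ + z) L (by simp; linarith) (by simp; linarith) (by simpa using h2.1)
      (by rw [add_im]; exact (log_le_log (by linarith) h2.2).trans hL) (by simp; linarith)
    have h5 := zeta_inv_le ⟨1 + η, t⟩ (by simp; linarith)
    have h6 := zeta_real_bd η hη hη1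
    rw [add_zero]
    have h7 : 1 ≤ ‖riemannZeta ⟨1 + η, t⟩‖ * (8 / η) := h5.trans (by gcongr)
    have h8 : 160 * zK * L / η ≤ exp M := by rwa [← Real.log_le_iff_le_exp (by positivity)]
    calc _ ≤ 20 * zK * L * 1 := by rw [mul_one]; exact hb
      _ ≤ 20 * zK * L * (‖riemannZeta ⟨1 + η, t⟩‖ * (8 / η)) := by gcongr
      _ = ‖riemannZeta ⟨1 + η, t⟩‖ * (160 * zK * L / η) := by ring
      _ ≤ _ := by gcongr

lemma zl_zero (η t : ℝ) (hη : 0 < η) : deriv (fun z => riemannZeta (⟨1 + η, t⟩ + z)) 0 = deriv riemannZeta ⟨1 + η, t⟩ ∧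
    riemannZeta (⟨1 + η, t⟩ + 0) ≠ 0 ∧ ∀ z : ℂ, riemannZeta (⟨1 + η, t⟩ + z) = 0 → z.re ≤ 0 := by
  refine ⟨by rw [deriv_comp_const_add, add_zero], riemannZeta_ne_zero_of_one_le_re (by simp; linarith), fun z hz => ?_⟩
  by_contra h
  exact riemannZeta_ne_zero_of_one_le_re (s := ⟨1 + η, t⟩ + z) (by simp; linarith) hz

/-- the parameter smallness condition -/
def Lgood (δ C L : ℝ) : Prop := 16 ≤ L ∧ 3 * C * L ^ (-δ) + 240 * (log (320 * zK) + 2 * log L) * L ^ (-δ) + 36 * L ^ (-δ) < 5 / 72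

lemma Lgood_ev (δ C : ℝ) (hδ : 0 < δ) : ∀ᶠ L in atTop, Lgood δ C L := by
  refine (eventually_ge_atTop 16).and ?_
  have h1 : Tendsto (fun L : ℝ => L ^ (-δ)) atTop (nhds 0) := tendsto_rpow_neg_atTop hδ
  have h2 : Tendsto (fun L : ℝ => log L * L ^ (-δ)) atTop (nhds 0) := by
    have := (isLittleO_log_rpow_atTop hδ).tendsto_div_nhds_zero
    refine this.congr' ?_
    filter_upwards [eventually_gt_atTop 0] with L hL
    rw [Real.rpow_neg hL.le, div_eq_mul_inv]
  have h3 := ((h1.const_mul (3 * C + 240 * log (320 * zK) + 36)).add (h2.const_mul 480))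
  simp only [mul_zero, add_zero] at h3
  filter_upwards [h3.eventually (gt_mem_nhds (by norm_num : (0:ℝ) < 5 / 72))] with L hL
  linarith

lemma Lgood_M (δ C L : ℝ) (hδ : δ ≤ 1 / 6) (h : Lgood δ C L) :
    log (320 * zK * L / L ^ (-(2/3) - δ)) ≤ log (320 * zK) + 2 * log L ∧ 1 ≤ log (320 * zK) + 2 * log L ∧ L ^ (-(2/3):ℝ) ≤ 1 / 4 := by
  have hL := h.1
  have hz := zK_pos
  have hl : 1 ≤ log L := by
    rw [Real.le_log_iff_exp_le (by linarith)]; have := Real.exp_one_lt_d9; linarith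
  have h1 : 0 ≤ log (320 * zK) := log_nonneg (by linarith)
  refine ⟨?_, by linarith, ?_⟩
  · rw [log_div (by positivity) (by positivity), log_mul (by positivity) (by positivity), Real.log_rpow (by linarith)]
    nlinarith
  · calc L ^ (-(2/3):ℝ) ≤ 8 ^ (-(2/3):ℝ) := Real.rpow_le_rpow_of_nonpos (by norm_num) (by linarith) (by norm_num)
      _ = 1 / 4 := by
        rw [show (8:ℝ) = 2 ^ (3:ℝ) by norm_num, ← Real.rpow_mul (by norm_num), show (3:ℝ) * (-(2/3)) = -2 by norm_num,
          Real.rpow_neg (by norm_num)]; norm_num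

theorem zero_free (δ C L : ℝ) (hδ0 : 0 < δ) (hδ : δ ≤ 1 / 6) (hC0 : 0 ≤ C) (hC : ∀ η : ℝ, 0 < η → η ≤ 1 →
    ‖deriv riemannZeta ((1 + η : ℝ) : ℂ) / riemannZeta ((1 + η : ℝ) : ℂ)‖ ≤ 1 / η + C) (hLg : Lgood δ C L)
    (s : ℂ) (ht : 4 ≤ |s.im|) (htL : log (2 * |s.im| + 1) ≤ L) (hs : 1 - L ^ (-(2/3) - δ) ≤ s.re) : riemannZeta s ≠ 0 := by
  intro h0
  obtain ⟨hM, hM1, hR4⟩ := Lgood_M δ C L hδ hLg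
  obtain ⟨hL16, hsm⟩ := hLg
  set M := log (320 * zK) + 2 * log L
  set w := L ^ (-(2/3) - δ) with hw
  set R := L ^ (-(2/3):ℝ) with hR
  set q := L ^ (-δ) with hq
  have hwq : w = R * q := by rw [hw, hR, hq, ← Real.rpow_add (by linarith)]; ring_nf
  have hR0 : 0 < R := by positivity
  have hq0 : 0 < q := by positivity
  have hw0 : 0 < w := by positivity
  have hz := zK_pos
  have hq1 : q < 1 / 400 := by nlinarith
  have hβ : s.re < 1 := by
    by_contra h; exact riemannZeta_ne_zero_of_one_le_re (not_lt.1 h) h0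
  have hη : 0 < 8 * w := by linarith
  have hwR : w ≤ R / 400 := by rw [hwq]; nlinarith
  have hη1 : 8 * w ≤ 1 := by linarith
  have hMb : log (160 * zK * L / (8 * w)) ≤ M := by
    refine (log_le_log (by positivity) ?_).trans hM
    rw [div_le_div_iff₀ (by positivity) hw0]
    have : 0 < zK * L * w := by positivity
    nlinarith
  have hM0 : 0 < M := by linarith
  have b1 := ball_bd (8 * w) s.im L R M hη hη1 ht ((log_le_log (by linarith) (by linarith)).trans htL) (by linarith) (by linarith) hMb
  have b2 := ball_bd (8 * w) (2 * s.im) L R M hη hη1 (by rw [abs_mul, abs_two]; linarith) (by rw [abs_mul, abs_two]; exact htL)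
    (by linarith) (by linarith) hMb
  have z1 := zl_zero (8 * w) s.im hη
  have z2 := zl_zero (8 * w) (2 * s.im) hη
  have l2 := landau R M hR0 hM0 _ b2.1 b2.2 z2.2.1 (fun z _ hz => z2.2.2 z hz)
  have l1 := landau' R M hR0 hM0 _ b1.1 b1.2 z1.2.1 (fun z _ hz => z1.2.2 z hz) (1 + 8 * w - s.re) (by linarith) (by linarith) (by
    rw [← h0]; congr 1; apply Complex.ext <;> simp)
  rw [z1.1, add_zero] at l1
  rw [z2.1, add_zero] at l2
  have h341 := tfo (1 + 8 * w) s.im (by linarith)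
  have l3 := (neg_le_abs _).trans ((abs_re_le_norm _).trans (hC (8 * w) hη hη1))
  have e1 : 1 / (9 * w) ≤ 1 / (1 + 8 * w - s.re) := one_div_le_one_div_of_le (by linarith) (by linarith)
  have e2 : (1 + 8 * w - s.re) / R ^ 2 ≤ 9 * w / R ^ 2 := by gcongr; linarith
  have e3 : 0 ≤ 3 * (1 / (8 * w) + C) + 4 * (48 * M / R - 1 / (9 * w) + 9 * w / R ^ 2) + 48 * M / R := by linarith
  have e4 : (3 * (1 / (8 * w) + C) + 4 * (48 * M / R - 1 / (9 * w) + 9 * w / R ^ 2) + 48 * M / R) * w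
      = 3 * C * w + 240 * M * q + 36 * q ^ 2 - 5 / 72 := by
    rw [hwq]; field_simp; ring
  have e5 := mul_nonneg e3 hw0.le
  rw [e4] at e5
  have e6 : C * w ≤ C * q := by rw [hwq]; gcongr; nlinarith
  nlinarith

end VK

namespace VK

noncomputable def GG (s : ℂ) : ℂ := -(deriv riemannZeta₁ s / riemannZeta₁ s) - riemannZeta₀ s

lemma z01 (s : ℂ) (hs : s ≠ 1) : riemannZeta s = (s - 1)⁻¹ + riemannZeta₀ s ∧ riemannZeta₁ s = (s - 1) * riemannZeta s := by
  have h : riemannZeta₀ s = riemannZeta s - (s - 1)⁻¹ := by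
    simp [riemannZeta₀, hs]
  have h1 : s - 1 ≠ 0 := sub_ne_zero.2 hs
  refine ⟨by rw [h]; ring, ?_⟩
  rw [riemannZeta₁, h]; field_simp; ring

lemma GG_eq (s : ℂ) (hs : s ≠ 1) (h1 : riemannZeta₁ s ≠ 0) : GG s = -(deriv riemannZeta s / riemannZeta s) - riemannZeta s := by
  rw [zld_eq s hs h1, GG, (z01 s hs).1]; ring

lemma GG_one : GG 1 = -2 * (Real.eulerMascheroniConstant : ℂ) := by
  rw [GG, deriv_riemannZeta₁_one, riemannZeta₁_one, riemannZeta₀_one]; ring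

lemma GG_diff (s : ℂ) (h1 : riemannZeta₁ s ≠ 0) : DifferentiableAt ℂ GG s := by
  unfold GG
  have := (differentiable_riemannZeta₁.contDiff (n := 2)).differentiable_deriv_two s
  exact ((this.div (differentiable_riemannZeta₁ s) h1).neg).sub (differentiable_riemannZeta₀ s)

lemma GG_low : ∃ κ B : ℝ, 0 < κ ∧ 0 ≤ B ∧ ∀ s : ℂ, |s.re - 1| ≤ κ → |s.im| ≤ 5 → riemannZeta₁ s ≠ 0 ∧ ‖GG s‖ ≤ B := by
  have hK : ∃ κ > 0, ∀ s : ℂ, |s.re - 1| ≤ κ → |s.im| ≤ 5 → riemannZeta₁ s ≠ 0 := by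
    by_contra hcon
    push Not at hcon
    choose! f hf using fun n : ℕ => hcon (1 / (n + 1 : ℝ)) (by positivity)
    have hb : ∀ n, f n ∈ Metric.closedBall (0:ℂ) 7 := fun n => by
      rw [mem_closedBall_zero_iff]
      have h1 := (hf n).1
      have h2 : 1 / ((n:ℝ) + 1) ≤ 1 := by rw [div_le_one (by positivity)]; linarith [(Nat.cast_nonneg n : (0:ℝ) ≤ n)]
      have h3 := norm_le_abs_re_add_abs_im (f n)
      have h4 := abs_le.1 (h1.trans h2)
      have h5 : |(f n).re| ≤ 2 := abs_le.2 ⟨by linarith, by linarith⟩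
      linarith [(hf n).2.1]
    obtain ⟨s, -, φ, hφ, hlim⟩ := (isCompact_closedBall (0:ℂ) 7).tendsto_subseq hb
    have hz : riemannZeta₁ s = 0 := by
      have h1 := (differentiable_riemannZeta₁.continuous.tendsto s).comp hlim
      refine tendsto_nhds_unique h1 (tendsto_const_nhds.congr fun n => ?_)
      exact ((hf (φ n)).2.2).symm
    have hre : s.re = 1 := by
      have h1 := (continuous_re.tendsto s).comp hlim
      have h2 : Tendsto (fun n => (f (φ n)).re) atTop (nhds 1) := by
        rw [tendsto_iff_dist_tendsto_zero]
        refine squeeze_zero (fun _ => dist_nonneg) (fun n => ?_) (tendsto_one_div_add_atTop_nhds_zero_nat.comp hφ.tendsto_atTop)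
        rw [Real.dist_eq]; exact (hf (φ n)).1
      exact tendsto_nhds_unique h1 h2
    exact z1_ne s hre.ge hz
  obtain ⟨κ, hκ, hne⟩ := hK
  have hc : IsCompact {s : ℂ | |s.re - 1| ≤ κ ∧ |s.im| ≤ 5} := by
    refine Metric.isCompact_of_isClosed_isBounded ?_ ?_
    · exact IsClosed.inter (s₁ := {s : ℂ | |s.re - 1| ≤ κ}) (s₂ := {s : ℂ | |s.im| ≤ 5})
        (isClosed_le (by fun_prop) (by fun_prop)) (isClosed_le (by fun_prop) (by fun_prop))
    · refine (Metric.isBounded_closedBall (x := (0:ℂ)) (r := κ + 6)).subset fun s hs => ?_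
      rw [mem_closedBall_zero_iff]
      have h3 := norm_le_abs_re_add_abs_im s
      have h4 := abs_le.1 hs.1
      have h5 : |s.re| ≤ κ + 1 := abs_le.2 ⟨by linarith, by linarith⟩
      linarith [hs.2]
  obtain ⟨B, hB⟩ := hc.exists_bound_of_continuousOn (f := GG) fun s hs =>
    (GG_diff s (hne s hs.1 hs.2)).continuousAt.continuousWithinAt
  exact ⟨κ, max B 0, hκ, le_max_right _ _, fun s h1 h2 => ⟨hne s h1 h2, (hB s ⟨h1, h2⟩).trans (le_max_left _ _)⟩⟩

theorem G_bd (δ : ℝ) (hδ0 : 0 < δ) (hδ : δ ≤ 1 / 6) : ∃ B : ℝ, 0 ≤ B ∧ ∀ᶠ L : ℝ in atTop, ∀ s : ℂ,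
    |s.re - 1| ≤ L ^ (-(2/3) - δ) / 4 → |s.im| ≤ exp L / 4 → riemannZeta₁ s ≠ 0 ∧ ‖GG s‖ ≤ B * L := by
  obtain ⟨C, hC0, hC⟩ := zld_real
  obtain ⟨κ, B, hκ, hB0, hB⟩ := GG_low
  have hzK := zK_pos
  refine ⟨B + 20 * zK + 2, by positivity, ?_⟩
  have hw0 : ∀ᶠ L : ℝ in atTop, L ^ (-(2/3) - δ) < κ := by
    have := (tendsto_rpow_neg_atTop (y := 2/3 + δ) (by linarith)).eventually_lt_const hκ
    filter_upwards [this] with L hL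
    rwa [show -(2/3) - δ = -(2/3 + δ) by ring]
  filter_upwards [Lgood_ev δ C hδ0, hw0] with L hLg hwκ s hre him
  obtain ⟨hM, hM1, hR4⟩ := Lgood_M δ C L hδ hLg
  have hLg' := hLg
  obtain ⟨hL16, hsm⟩ := hLg
  set M := log (320 * zK) + 2 * log L
  set w := L ^ (-(2/3) - δ) with hw
  have hw00 : 0 < w := by positivity
  have hwR : w ≤ L ^ (-(2/3):ℝ) := Real.rpow_le_rpow_of_exponent_le (by linarith) (by linarith)
  rcases le_total |s.im| 5 with h5 | h5
  · have := hB s (by linarith) h5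
    refine ⟨this.1, this.2.trans ?_⟩
    calc B = B * 1 := by ring
      _ ≤ _ := by gcongr <;> linarith
  · have hs1 : s ≠ 1 := by rintro rfl; norm_num at h5
    have hz0 := z01 s hs1
    have hr := abs_le.1 hre
    have hT : log (2 * (|s.im| + 1) + 1) ≤ L := by
      rw [Real.log_le_iff_le_exp (by positivity)]
      linarith
    have hzne : riemannZeta s ≠ 0 := zero_free δ C L hδ0 hδ hC0 hC hLg' s (by linarith)
      ((log_le_log (by positivity) (by linarith)).trans hT) (by linarith)
    have hz1 : riemannZeta₁ s ≠ 0 := by rw [hz0.2]; exact mul_ne_zero (sub_ne_zero.2 hs1) hzne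
    refine ⟨hz1, ?_⟩
    have hbb := ball_bd (w / 2) s.im L (3 * w / 2) M (by positivity) (by linarith) (by linarith)
      ((log_le_log (by positivity) (by linarith)).trans hT) (by linarith) (by linarith)
      (by rw [show 160 * zK * L / (w / 2) = 320 * zK * L / w by field_simp; norm_num]; exact hM)
    have hnv := nv_bd (fun z => riemannZeta (⟨1 + w / 2, s.im⟩ + z)) (3 * w / 2) M (by positivity) (by linarith)
      (hbb.1.mono Metric.ball_subset_closedBall) (fun z hz => ?_) (fun z hz => hbb.2 z (Metric.ball_subset_closedBall hz))
      ((s.re - 1 - w / 2 : ℝ) : ℂ) (by rw [norm_real, Real.norm_eq_abs, abs_le]; constructor <;> linarith)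
    · rw [deriv_comp_const_add] at hnv
      have e : (⟨1 + w / 2, s.im⟩ + ((s.re - 1 - w / 2 : ℝ) : ℂ) : ℂ) = s := by
        apply Complex.ext
        · simp
        · simp
      rw [e] at hnv
      rw [GG_eq s hs1 hz1]
      have hzb := zbd_abs s L (by linarith) (by linarith) (by linarith)
        ((log_le_log (by linarith) (by linarith)).trans hT) (by linarith)
      have hM2 : 24 * M / (3 * w / 2) ≤ L := by
        have h1 : M * L ^ (-δ) ≤ 1 / 16 := by
          have : 0 ≤ C * L ^ (-δ) := by positivity
          have : 0 ≤ L ^ (-δ) := by positivity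
          nlinarith
        rw [show 24 * M / (3 * w / 2) = 16 * M / w by field_simp; ring, div_le_iff₀ hw00]
        have h2 : L * w = L ^ (δ) * L ^ (1/3 - 2 * δ) := by
          rw [hw, ← Real.rpow_add (by linarith), ← Real.rpow_one_add' (by linarith) (by linarith)]; ring_nf
        have h3 : 1 ≤ L ^ (1/3 - 2 * δ) := Real.one_le_rpow (by linarith) (by linarith)
        have h4 : L ^ (-δ) * L ^ δ = 1 := by rw [← Real.rpow_add (by linarith)]; simp
        have h5 : 0 < L ^ δ := by positivity
        have h6 : M = M * L ^ (-δ) * L ^ δ := by rw [mul_assoc, h4, mul_one]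
        rw [h2]
        calc 16 * M = 16 * (M * L ^ (-δ)) * L ^ δ := by rw [mul_assoc, ← h6]
          _ ≤ 1 * L ^ δ := by gcongr; linarith
          _ ≤ L ^ δ * L ^ (1/3 - 2 * δ) := by rw [one_mul]; exact le_mul_of_one_le_right h5.le h3
      calc _ ≤ ‖deriv riemannZeta s / riemannZeta s‖ + ‖riemannZeta s‖ := by
            refine (norm_sub_le _ _).trans ?_; rw [norm_neg]
        _ ≤ L + 20 * zK * L := by linarith
        _ ≤ _ := by nlinarith
    · rw [mem_ball_zero_iff] at hz
      have h1 := (abs_re_le_norm z).trans hz.le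
      have h2 := (abs_im_le_norm z).trans hz.le
      have h4 := abs_le.1 h1
      have h6 := abs_sub_abs_le_abs_sub s.im (-z.im)
      have h3 := abs_add_le s.im z.im
      rw [abs_neg, sub_neg_eq_add] at h6
      refine zero_free δ C L hδ0 hδ hC0 hC hLg' _ (by rw [add_im]; simp only; linarith)
        (le_trans (log_le_log (by positivity) ?_) hT) ?_
      · rw [add_im]; simp only; linarith
      · rw [add_re]; simp only; linarith

end VK

namespace VK
open MeasureTheory

lemma kint (c : ℝ) (hc : 0 < c) : Integrable (fun t : ℝ => 1 / ((c:ℂ) + t * I) ^ 2) := by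
  have h1 : Integrable (fun t : ℝ => (1 + 1 / c ^ 2) * (1 + t ^ 2)⁻¹) := integrable_inv_one_add_sq.const_mul _
  refine h1.mono' (Continuous.aestronglyMeasurable ?_) (Eventually.of_forall fun t => ?_)
  · refine Continuous.div continuous_const (by fun_prop) fun t => pow_ne_zero _ fun h => ?_
    have := congrArg Complex.re h; simp at this; linarith
  · rw [norm_div, norm_one, norm_pow, sq_norm, normSq_apply]
    simp
    rw [← sub_nonneg]
    have : (1 + (c ^ 2)⁻¹) * (1 + t ^ 2)⁻¹ - (c * c + t * t)⁻¹ = (c ^ 2 * c ^ 2 + t ^ 2) / (c ^ 2 * (1 + t ^ 2) * (c * c + t * t)) := by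
      field_simp; ring
    rw [this]
    have : 0 < c * c + t * t := by nlinarith
    positivity

noncomputable def lk (u : ℝ) : ℂ := (Set.Ioc (0:ℝ) 1).indicator (fun u => -((log u : ℝ) : ℂ)) u

lemma lk_mellin (s : ℂ) (hs : 0 < s.re) : MellinConvergent lk s ∧ mellin lk s = 1 / s ^ 2 := by
  have hlk : lk = fun t => -(log t • (Set.Ioc (0:ℝ) 1).indicator (fun _ => (1:ℂ)) t) := by
    ext t; unfold lk; by_cases h : t ∈ Set.Ioc (0:ℝ) 1 <;> simp [Set.indicator, h]
  have h1 := mellin_hasDerivAt_of_isBigO_rpow (a := s.re + 1) (b := 0) (f := (Set.Ioc (0:ℝ) 1).indicator (fun _ => (1:ℂ))) (s := s) ?_ ?_ (by linarith) ?_ hs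
  · have h2 : HasDerivAt (mellin ((Set.Ioc (0:ℝ) 1).indicator (fun _ => (1:ℂ)))) (-1 / s ^ 2) s := by
      have hs0 : s ≠ 0 := by rintro rfl; simp at hs
      have h3 : HasDerivAt (fun s : ℂ => s⁻¹) (-(s ^ 2)⁻¹) s := hasDerivAt_inv hs0
      refine (h3.congr_deriv (by rw [neg_div, one_div])).congr_of_eventuallyEq ?_
      filter_upwards [(isOpen_lt continuous_const continuous_re).mem_nhds hs] with z hz
      rw [(hasMellin_one_Ioc hz).2, one_div]
    have h4 := h1.2.unique h2
    have h5 := h1.1.const_smul (-1:ℂ)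
    rw [hlk]
    constructor
    · convert h5 using 2; simp
    · have h6 := mellin_const_smul (fun t => log t • (Set.Ioc (0:ℝ) 1).indicator (fun _ => (1:ℂ)) t) s (-1:ℂ)
      rw [h4] at h6
      convert h6 using 1
      · congr 1; ext t; simp
      · simp; ring
  · exact ((integrable_indicator_iff measurableSet_Ioc).2 (integrableOn_const (by simp))).locallyIntegrable.locallyIntegrableOn _
  · refine Asymptotics.IsBigO.of_bound 0 ?_
    filter_upwards [eventually_gt_atTop 1] with t ht
    rw [Set.indicator_of_notMem (by simp [ht])]; simp
  · refine Asymptotics.IsBigO.of_bound 1 (Eventually.of_forall fun t => ?_)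
    refine (norm_indicator_le_norm_self (fun _ => (1:ℂ)) t).trans ?_
    simp

lemma lk_cont (x : ℝ) (hx : 0 < x) : ContinuousAt lk x := by
  have h : ContinuousAt (fun u : ℝ => -((min (log u) 0 : ℝ) : ℂ)) x := by
    have := (continuousAt_log hx.ne').min (continuousAt_const (y := (0:ℝ)))
    exact (Complex.continuous_ofReal.continuousAt.comp this).neg
  refine h.congr ?_
  filter_upwards [eventually_gt_nhds hx] with u hu
  unfold lk
  by_cases h1 : u ≤ 1
  · rw [Set.indicator_of_mem (Set.mem_Ioc.2 ⟨hu, h1⟩), min_eq_left (log_nonpos hu.le h1)]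
  · rw [Set.indicator_of_notMem (by simp [h1]), min_eq_right (log_nonneg (by linarith))]; simp

lemma lk_inv (c : ℝ) (hc : 0 < c) (x : ℝ) (hx : 0 < x) :
    ∫ t : ℝ, (x:ℂ) ^ ((c:ℂ) + t * I) / ((c:ℂ) + t * I) ^ 2 = 2 * π * lk (1 / x) := by
  have hre : ∀ t : ℝ, 0 < ((c:ℂ) + t * I).re := fun t => by simp [hc]
  have h := mellinInv_mellin_eq c lk (x := 1 / x) (by positivity) (lk_mellin c (by simpa)).1
    (by
      refine (kint c hc).congr (Eventually.of_forall fun t => ?_)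
      exact ((lk_mellin _ (hre t)).2).symm) (lk_cont _ (by positivity))
  rw [← h, mellinInv]
  have e : ∀ t : ℝ, ((1 / x : ℝ) : ℂ) ^ (-((c:ℂ) + t * I)) • mellin lk ((c:ℂ) + t * I) =
      (x:ℂ) ^ ((c:ℂ) + t * I) / ((c:ℂ) + t * I) ^ 2 := fun t => by
    rw [(lk_mellin _ (hre t)).2, cpow_neg, one_div x, Complex.ofReal_inv, Complex.inv_cpow, inv_inv, smul_eq_mul, mul_one_div]
    rw [Complex.arg_ofReal_of_nonneg hx.le]; exact pi_pos.ne
  simp_rw [e]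
  rw [Complex.real_smul, ← mul_assoc]; push_cast
  have := Complex.ofReal_ne_zero.2 pi_pos.ne'
  rw [mul_one_div_cancel (mul_ne_zero two_ne_zero this), one_mul]

lemma perron (b : ℕ → ℂ) (c : ℝ) (hc : 0 < c) (hb : LSeriesSummable b c) (x : ℝ) (hx : 0 < x) :
    ∫ t : ℝ, LSeries b ((c:ℂ) + t * I) * ((x:ℂ) ^ ((c:ℂ) + t * I) / ((c:ℂ) + t * I) ^ 2) =
    2 * π * ∑ n ∈ Icc 1 ⌊x⌋₊, b n * ((log (x / n) : ℝ) : ℂ) := by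
  have hs0 : ∀ t : ℝ, ((c:ℂ) + t * I) ≠ 0 := fun t h => by
    have := congrArg Complex.re h; simp at this; linarith
  have hcont : ∀ u : ℝ, 0 < u → Continuous fun t : ℝ => (u:ℂ) ^ ((c:ℂ) + t * I) := fun u hu =>
    (by fun_prop : Continuous fun t : ℝ => (c:ℂ) + t * I).const_cpow (Or.inl (Complex.ofReal_ne_zero.2 hu.ne'))
  have hki := (kint c hc)
  have hterm : ∀ (n : ℕ) (t : ℝ), LSeries.term b ((c:ℂ) + t * I) n * ((x:ℂ) ^ ((c:ℂ) + t * I) / ((c:ℂ) + t * I) ^ 2)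
      = if n = 0 then 0 else b n * (((x / n : ℝ):ℂ) ^ ((c:ℂ) + t * I) / ((c:ℂ) + t * I) ^ 2) := fun n t => by
    rw [LSeries.term_def]
    split_ifs with h
    · simp
    · push_cast
      have := Complex.div_cpow_ofReal_nonneg hx.le (Nat.cast_nonneg n : (0:ℝ) ≤ n) ((c:ℂ) + t * I)
      push_cast at this
      rw [this]; ring
  have hnorm : ∀ (n : ℕ) (t : ℝ), ‖LSeries.term b ((c:ℂ) + t * I) n * ((x:ℂ) ^ ((c:ℂ) + t * I) / ((c:ℂ) + t * I) ^ 2)‖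
      = ‖LSeries.term b c n‖ * x ^ c * ‖1 / ((c:ℂ) + t * I) ^ 2‖ := fun n t => by
    rw [norm_mul, norm_div, norm_div, norm_one, norm_cpow_eq_rpow_re_of_pos hx, LSeries.norm_term_eq, LSeries.norm_term_eq]
    simp; ring
  have hI : ∀ n, Integrable (fun t : ℝ => LSeries.term b ((c:ℂ) + t * I) n * ((x:ℂ) ^ ((c:ℂ) + t * I) / ((c:ℂ) + t * I) ^ 2)) := fun n => by
    refine (hki.norm.const_mul (‖LSeries.term b c n‖ * x ^ c)).mono' (Continuous.aestronglyMeasurable ?_) (Eventually.of_forall fun t => (hnorm n t).le)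
    simp_rw [hterm]
    split_ifs with h
    · exact continuous_const
    · exact continuous_const.mul ((hcont _ (by positivity)).div (by fun_prop) fun t => pow_ne_zero _ (hs0 t))
  have hS := hasSum_integral_of_summable_integral_norm hI (by
    simp_rw [hnorm, integral_const_mul]
    exact (hb.norm.mul_right _).mul_right _)
  simp_rw [tsum_mul_right] at hS
  change HasSum _ (∫ t : ℝ, LSeries b ((c:ℂ) + t * I) * _) at hS
  refine hS.unique ?_
  have hv : ∀ n : ℕ, (∫ t : ℝ, LSeries.term b ((c:ℂ) + t * I) n * ((x:ℂ) ^ ((c:ℂ) + t * I) / ((c:ℂ) + t * I) ^ 2))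
      = if n ∈ Icc 1 ⌊x⌋₊ then 2 * π * (b n * ((log (x / n) : ℝ) : ℂ)) else 0 := fun n => by
    simp_rw [hterm]
    by_cases h0 : n = 0
    · simp [h0]
    · have hn : (0:ℝ) < n := by exact_mod_cast Nat.pos_of_ne_zero h0
      simp only [h0, if_false]
      rw [integral_const_mul, lk_inv c hc _ (by positivity)]
      have : n ∈ Icc 1 ⌊x⌋₊ ↔ 1 / (x / n) ∈ Set.Ioc (0:ℝ) 1 := by
        rw [mem_Icc, Nat.le_floor_iff hx.le, Set.mem_Ioc, one_div_div, div_le_one hx]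
        exact ⟨fun h => ⟨by positivity, h.2⟩, fun h => ⟨Nat.pos_of_ne_zero h0, h.2⟩⟩
      unfold lk
      split_ifs with h
      · rw [Set.indicator_of_mem (this.1 h), one_div, Real.log_inv]; push_cast; ring
      · rw [Set.indicator_of_notMem (fun h' => h (this.2 h'))]; simp
  simp_rw [hv]
  rw [mul_sum]
  rw [← sum_congr rfl fun n hn => if_pos hn]
  exact hasSum_sum_of_ne_finset_zero fun n hn => if_neg hn

end VK

namespace VK
open MeasureTheory

lemma tail_int (T : ℝ) (hT : 1 ≤ T) (g : ℝ → ℂ) (X : ℝ) (hg : ∀ t, T ≤ |t| → ‖g t‖ ≤ X / t ^ 2) (hX : 0 ≤ X) :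
    ‖∫ t in Set.Iic (-T), g t‖ ≤ 2 * X / T ∧ ‖∫ t in Set.Ioi T, g t‖ ≤ 2 * X / T := by
  have hat : π / 2 - arctan T ≤ 1 / T := by
    have h1 := Real.arctan_inv_of_pos (x := T) (by linarith)
    rw [← h1, one_div]; 
    have h2 := Real.le_tan (Real.arctan_nonneg.2 (by positivity : 0 ≤ T⁻¹)) (Real.arctan_lt_pi_div_two _)
    rwa [Real.tan_arctan] at h2
  have hb : ∀ t : ℝ, T ≤ |t| → ‖g t‖ ≤ 2 * X * (1 + t ^ 2)⁻¹ := fun t ht => by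
    refine (hg t ht).trans ?_
    have h1 : 1 ≤ t ^ 2 := by rw [← sq_abs]; nlinarith
    rw [← div_eq_mul_inv, div_le_div_iff₀ (by linarith) (by linarith)]
    nlinarith
  have hi : ∀ S : Set ℝ, IntegrableOn (fun t : ℝ => 2 * X * (1 + t ^ 2)⁻¹) S := fun S => (integrable_inv_one_add_sq.const_mul _).integrableOn
  constructor
  · refine (norm_integral_le_of_norm_le (hi (Set.Iic (-T))) ?_).trans ?_
    · filter_upwards [ae_restrict_mem measurableSet_Iic] with t ht
      exact hb t (by rw [Set.mem_Iic] at ht; rw [abs_of_nonpos (by linarith)]; linarith)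
    · rw [integral_const_mul, integral_Iic_inv_one_add_sq, Real.arctan_neg]
      calc _ = 2 * X * (π / 2 - arctan T) := by ring
        _ ≤ 2 * X * (1 / T) := by gcongr
        _ = _ := by ring
  · refine (norm_integral_le_of_norm_le (hi (Set.Ioi T)) ?_).trans ?_
    · filter_upwards [ae_restrict_mem measurableSet_Ioi] with t ht
      exact hb t (by rw [Set.mem_Ioi] at ht; rw [abs_of_nonneg (by linarith)]; linarith)
    · rw [integral_const_mul, integral_Ioi_inv_one_add_sq]
      calc _ ≤ 2 * X * (1 / T) := by gcongr
        _ = _ := by ring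

lemma shift (F : ℂ → ℂ) (c d T A X x : ℝ) (hc : 0 < c) (hd : 0 < d) (hT : 1 ≤ T) (hx : 1 ≤ x) (hA : 0 ≤ A) (hX : 0 ≤ X)
    (hF0 : F 0 = 0) (hF1 : deriv F 0 = 0)
    (hF : ∀ s : ℂ, -d ≤ s.re → s.re ≤ c → |s.im| ≤ T → DifferentiableAt ℂ F s ∧ ‖F s‖ ≤ A)
    (hFc : ∀ t : ℝ, ‖F (c + t * I)‖ ≤ X) :
    ‖∫ t : ℝ, F (c + t * I) * ((x:ℂ) ^ ((c:ℂ) + t * I) / ((c:ℂ) + t * I) ^ 2)‖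
      ≤ 4 * (X * x ^ c) / T + 2 * (A * x ^ c / T ^ 2 * (c + d)) + A * x ^ (-d) / d ^ 2 * (2 * T) := by
  have hx0 : 0 < x := by linarith
  set h : ℂ → ℂ := fun s => dslope (dslope F 0) 0 s * (x:ℂ) ^ s with hh
  have hne : ∀ s : ℂ, s ≠ 0 → h s = F s * ((x:ℂ) ^ s / s ^ 2) := fun s hs => by
    rw [hh]; simp only
    rw [dslope_of_ne _ hs, slope_def_field, dslope_same, hF1, dslope_of_ne _ hs, slope_def_field, hF0]
    simp only [sub_zero]; field_simp
  have hR : DifferentiableOn ℂ h (Set.uIcc (-d) c ×ℂ Set.uIcc (-T) T) := by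
    have hFd : DifferentiableOn ℂ F (Set.uIcc (-d) c ×ℂ Set.uIcc (-T) T) := fun s hs => by
      rw [Complex.mem_reProdIm, Set.uIcc_of_le (by linarith), Set.uIcc_of_le (by linarith)] at hs
      exact (hF s hs.1.1 hs.1.2 (abs_le.2 hs.2)).1.differentiableWithinAt
    have hn : (Set.uIcc (-d) c ×ℂ Set.uIcc (-T) T) ∈ nhds (0:ℂ) := by
      rw [Set.uIcc_of_le (by linarith), Set.uIcc_of_le (by linarith)]
      refine Filter.inter_mem (continuous_re.continuousAt.preimage_mem_nhds ?_) (Complex.continuous_im.continuousAt.preimage_mem_nhds ?_)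
      · exact Icc_mem_nhds (by simp; linarith) (by simp; linarith)
      · exact Icc_mem_nhds (by simp; linarith) (by simp; linarith)
    have h2 := (differentiableOn_dslope hn).2 ((differentiableOn_dslope hn).2 hFd)
    refine h2.mul (Differentiable.differentiableOn ?_)
    exact fun s => (differentiableAt_id.const_cpow (Or.inl (Complex.ofReal_ne_zero.2 hx0.ne')))
  have hrect := Complex.integral_boundary_rect_eq_zero_of_differentiableOn h ⟨-d, -T⟩ ⟨c, T⟩ hR
  simp only at hrect
  have hnb : ∀ s : ℂ, -d ≤ s.re → s.re ≤ c → |s.im| ≤ T → s ≠ 0 → ∀ m : ℝ, 0 < m → m ≤ ‖s‖ → ‖h s‖ ≤ A * x ^ s.re / m ^ 2 := fun s h1 h2 h3 h4 m hm0 hm => by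
    rw [hne s h4, norm_mul, norm_div, norm_pow, norm_cpow_eq_rpow_re_of_pos hx0, ← mul_div_assoc]
    gcongr
    exact (hF s h1 h2 h3).2
  have hhor : ∀ τ : ℝ, |τ| = T → ‖∫ r : ℝ in (-d)..c, h (r + τ * I)‖ ≤ A * x ^ c / T ^ 2 * (c + d) := fun τ hτ => by
    have := intervalIntegral.norm_integral_le_of_norm_le_const (a := -d) (b := c) (f := fun r : ℝ => h (r + τ * I)) (C := A * x ^ c / T ^ 2) (fun r hr => ?_)
    · rwa [abs_of_nonneg (by linarith), sub_neg_eq_add] at this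
    · rw [Set.uIoc_of_le (by linarith)] at hr
      have e1 : ((r:ℂ) + τ * I).re = r := by simp
      have e2 : ((r:ℂ) + τ * I).im = τ := by simp
      have hn : T ≤ ‖(r:ℂ) + τ * I‖ := by
        have := abs_im_le_norm ((r:ℂ) + τ * I); rwa [e2, hτ] at this
      have := hnb (r + τ * I) (by rw [e1]; exact hr.1.le) (by rw [e1]; exact hr.2) (by rw [e2]; exact hτ.le)
        (by rw [← norm_pos_iff]; linarith) T (by linarith) hn
      rw [e1] at this
      refine this.trans ?_
      gcongr
      · exact hr.2
  have hleft : ‖∫ t : ℝ in (-T)..T, h ((-d : ℝ) + t * I)‖ ≤ A * x ^ (-d) / d ^ 2 * (2 * T) := by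
    have := intervalIntegral.norm_integral_le_of_norm_le_const (a := -T) (b := T) (f := fun t : ℝ => h ((-d : ℝ) + t * I)) (C := A * x ^ (-d) / d ^ 2) (fun t ht => ?_)
    · rwa [abs_of_nonneg (by linarith), show T - -T = 2 * T by ring] at this
    · rw [Set.uIoc_of_le (by linarith)] at ht
      have e1 : (((-d : ℝ):ℂ) + t * I).re = -d := by simp
      have e2 : (((-d : ℝ):ℂ) + t * I).im = t := by simp
      have hn : d ≤ ‖((-d : ℝ):ℂ) + t * I‖ := by
        have := abs_re_le_norm (((-d : ℝ):ℂ) + t * I); rwa [e1, abs_neg, abs_of_pos hd] at this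
      have := hnb ((-d : ℝ) + t * I) (by rw [e1]) (by rw [e1]; linarith) (by rw [e2]; exact abs_le.2 ⟨ht.1.le, ht.2⟩)
        (by rw [← norm_pos_iff]; linarith) d hd hn
      rwa [e1] at this
  have hmid : ‖∫ t : ℝ in (-T)..T, h (c + t * I)‖ ≤ 2 * (A * x ^ c / T ^ 2 * (c + d)) + A * x ^ (-d) / d ^ 2 * (2 * T) := by
    have h1 := hhor (-T) (by rw [abs_neg, abs_of_nonneg (by linarith)])
    have h2 := hhor T (abs_of_nonneg (by linarith))
    set I1 := ∫ r : ℝ in (-d)..c, h (r + ((-T : ℝ):ℂ) * I)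
    set I2 := ∫ r : ℝ in (-d)..c, h (r + (T:ℂ) * I)
    set I3 := ∫ t : ℝ in (-T)..T, h (c + t * I)
    set I4 := ∫ t : ℝ in (-T)..T, h ((-d : ℝ) + t * I)
    have e : I * I3 = I2 - I1 + I * I4 := by
      simp only [smul_eq_mul] at hrect
      linear_combination hrect
    have : ‖I3‖ = ‖I2 - I1 + I * I4‖ := by rw [← e, norm_mul, norm_I, one_mul]
    rw [this]
    refine (norm_add_le _ _).trans ?_
    have := norm_sub_le I2 I1
    rw [norm_mul, norm_I, one_mul]
    linarith
  set g : ℝ → ℂ := fun t => F (c + t * I) * ((x:ℂ) ^ ((c:ℂ) + t * I) / ((c:ℂ) + t * I) ^ 2) with hg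
  have hs0 : ∀ t : ℝ, ((c:ℂ) + t * I) ≠ 0 := fun t h => by
    have := congrArg Complex.re h; simp at this; linarith
  have hgh : ∀ t : ℝ, h (c + t * I) = g t := fun t => hne _ (hs0 t)
  simp_rw [hgh] at hmid
  have htail := tail_int T hT g (X * x ^ c) (fun t ht => ?_) (by positivity)
  · by_cases hint : Integrable g
    · have e1 : ∫ t, g t = (∫ t in Set.Iic (-T), g t) + ((∫ t : ℝ in (-T)..T, g t) + ∫ t in Set.Ioi T, g t) := by
        rw [intervalIntegral.integral_of_le (by linarith), ← setIntegral_union (Set.Ioc_disjoint_Ioi le_rfl) measurableSet_Ioi hint.integrableOn hint.integrableOn,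
          Set.Ioc_union_Ioi_eq_Ioi (by linarith), intervalIntegral.integral_Iic_add_Ioi hint.integrableOn hint.integrableOn]
      rw [e1]
      refine (norm_add_le _ _).trans ?_
      have := norm_add_le (∫ t : ℝ in (-T)..T, g t) (∫ t in Set.Ioi T, g t)
      have e3 : 4 * (X * x ^ c) / T = 2 * (X * x ^ c) / T + 2 * (X * x ^ c) / T := by ring
      rw [e3]; linarith [htail.1, htail.2]
    · rw [integral_undef hint, norm_zero]; positivity
  · rw [hg]; simp only
    rw [norm_mul, norm_div, norm_pow, norm_cpow_eq_rpow_re_of_pos hx0, ← mul_div_assoc]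
    have e1 : ((c:ℂ) + t * I).re = c := by simp
    have e2 : ((c:ℂ) + t * I).im = t := by simp
    rw [e1, ← sq_abs t]
    have h5 := abs_im_le_norm ((c:ℂ) + t * I)
    rw [e2] at h5
    have : 0 < |t| := by linarith
    gcongr
    exact hFc t

end VK

namespace VK
open MeasureTheory
local notation "Λ" => ArithmeticFunction.vonMangoldt

noncomputable def cb : ℂ := deriv GG 1 / (log 2 : ℝ)
noncomputable def ca : ℂ := -GG 1 - cb
noncomputable def HH (s : ℂ) : ℂ := GG (1 + s) + ca + cb * (2:ℂ) ^ (-s)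
noncomputable def bb (n : ℕ) : ℂ := ((Λ n : ℝ) - 1 : ℂ) / n + ((if n = 1 then ca else 0) + (if n = 2 then cb else 0))

lemma HH_zero : HH 0 = 0 := by simp [HH, ca]; ring

lemma HH_diff (s : ℂ) (h : riemannZeta₁ (1 + s) ≠ 0) : HasDerivAt HH (deriv GG (1 + s) + cb * (-((log 2 : ℝ) * (2:ℂ) ^ (-s)))) s := by
  have h1 : HasDerivAt (fun s => GG (1 + s)) (deriv GG (1 + s)) s := by
    simpa using (GG_diff _ h).hasDerivAt.comp_const_add 1 s
  have h2 : HasDerivAt (fun s : ℂ => (2:ℂ) ^ (-s)) (-((log 2 : ℝ) * (2:ℂ) ^ (-s))) s := by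
    have := (hasDerivAt_neg s).const_cpow (c := (2:ℂ)) (Or.inl two_ne_zero)
    convert this using 1
    rw [Complex.ofReal_log (by norm_num)]; push_cast; ring
  exact (h1.add_const ca).add (h2.const_mul cb)

lemma HH_deriv : deriv HH 0 = 0 := by
  rw [(HH_diff 0 (by simp)).deriv, cb]
  have : ((log 2 : ℝ) : ℂ) ≠ 0 := Complex.ofReal_ne_zero.2 (log_pos (by norm_num)).ne'
  rw [add_zero, neg_zero, Complex.cpow_zero]; field_simp; ring

lemma single_term (m : ℕ) (hm : m ≠ 0) (v : ℂ) (s : ℂ) :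
    HasSum (LSeries.term (fun n => if n = m then v else 0) s) (v * (m:ℂ) ^ (-s)) := by
  have h := hasSum_single (f := LSeries.term (fun n => if n = m then v else 0) s) m (fun n hn => by
    rw [LSeries.term_def]; simp [hn])
  convert h using 1
  rw [LSeries.term_of_ne_zero hm, if_pos rfl, cpow_neg, div_eq_mul_inv]

lemma bb_sum (s : ℂ) (hs : 0 < s.re) : HasSum (LSeries.term bb s) (HH s) := by
  have h1 : 1 < (1 + s).re := by simp; linarith
  have hL := ArithmeticFunction.LSeriesSummable_vonMangoldt h1
  have hV : HasSum (LSeries.term (fun n => ((Λ n : ℝ) : ℂ)) (1 + s)) (-deriv riemannZeta (1 + s) / riemannZeta (1 + s)) := by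
    rw [← vM_eq _ h1]; exact hL.hasSum
  have hO : HasSum (LSeries.term 1 (1 + s)) (riemannZeta (1 + s)) := by
    rw [← LSeries_one_eq_riemannZeta h1]
    exact (LSeriesSummable_one_iff.2 h1).hasSum
  have hA := single_term 1 one_ne_zero ca s
  have hB := single_term 2 two_ne_zero cb s
  have := ((hV.sub hO).add hA).add hB
  have hne : (1 + s) ≠ 1 := by intro h; rw [h] at h1; simp at h1
  have key : ∀ n, LSeries.term bb s n = LSeries.term (fun n => ((Λ n : ℝ) : ℂ)) (1 + s) n - LSeries.term 1 (1 + s) n +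
      LSeries.term (fun n => if n = 1 then ca else 0) s n + LSeries.term (fun n => if n = 2 then cb else 0) s n := fun n => by
    rw [LSeries.term_def, LSeries.term_def, LSeries.term_def, LSeries.term_def, LSeries.term_def]
    by_cases h0 : n = 0
    · simp [h0]
    · simp only [h0, if_false]
      have hn : (n:ℂ) ≠ 0 := Nat.cast_ne_zero.2 h0
      rw [cpow_add _ _ hn, Complex.cpow_one, bb]
      have : (n:ℂ) ^ s ≠ 0 := by simp [Complex.cpow_eq_zero_iff, hn]
      simp only [Pi.one_apply]
      field_simp
      ring
  rw [funext key]
  have e : HH s = -deriv riemannZeta (1 + s) / riemannZeta (1 + s) - riemannZeta (1 + s) + ca * ((1:ℕ):ℂ) ^ (-s) + cb * ((2:ℕ):ℂ) ^ (-s) := by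
    unfold HH; rw [GG_eq _ hne (z1_ne _ h1.le)]
    simp; ring
  rw [e]; exact this

lemma HH_triv : ∃ X : ℝ, 0 ≤ X ∧ ∀ c : ℝ, 0 < c → c ≤ 1 → ∀ t : ℝ, ‖HH (c + t * I)‖ ≤ X / c := by
  obtain ⟨C, hC0, hC⟩ := zld_real
  refine ⟨9 + C + ‖ca‖ + ‖cb‖, by positivity, fun c hc hc1 t => ?_⟩
  have e : (1 + ((c:ℂ) + t * I)).re = 1 + c := by simp
  have h1 : 1 < (1 + ((c:ℂ) + t * I)).re := by rw [e]; linarith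
  have hne : (1 + ((c:ℂ) + t * I)) ≠ 1 := by intro h; rw [h] at h1; simp at h1
  have h2 := zld_le_re _ h1
  have h3 := zeta_le_re _ h1
  rw [e] at h2 h3
  have h4 := h2.trans (hC c hc hc1)
  have h5 := h3.trans (zeta_real_bd c hc hc1)
  have h6 : ‖(2:ℂ) ^ (-((c:ℂ) + t * I))‖ ≤ 1 := by
    have := norm_cpow_eq_rpow_re_of_pos (x := 2) (by norm_num) (-((c:ℂ) + t * I))
    push_cast at this
    rw [this]; apply Real.rpow_le_one_of_one_le_of_nonpos (by norm_num); simp; exact hc.le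
  rw [HH, GG_eq _ hne (z1_ne _ h1.le)]
  have h7 := norm_add₃_le (a := -(deriv riemannZeta (1 + ((c:ℂ) + t * I)) / riemannZeta (1 + ((c:ℂ) + t * I))) - riemannZeta (1 + ((c:ℂ) + t * I)))
    (b := ca) (c := cb * (2:ℂ) ^ (-((c:ℂ) + t * I)))
  have h8 := norm_sub_le (-(deriv riemannZeta (1 + ((c:ℂ) + t * I)) / riemannZeta (1 + ((c:ℂ) + t * I)))) (riemannZeta (1 + ((c:ℂ) + t * I)))
  rw [norm_neg] at h8
  rw [norm_mul cb] at h7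
  have h9 : ‖cb‖ * ‖(2:ℂ) ^ (-((c:ℂ) + t * I))‖ ≤ ‖cb‖ * 1 := by gcongr
  have h10 : 1 ≤ 1 / c := by rw [le_div_iff₀ hc]; linarith
  have h11 : (C + ‖ca‖ + ‖cb‖) * 1 ≤ (C + ‖ca‖ + ‖cb‖) * (1 / c) := by gcongr
  calc _ ≤ 1 / c + C + 8 / c + ‖ca‖ + ‖cb‖ := by linarith
    _ ≤ _ := by
      rw [show (9 + C + ‖ca‖ + ‖cb‖) / c = 1 / c + 8 / c + (C + ‖ca‖ + ‖cb‖) * (1 / c) by ring]; linarith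

lemma HH_bd (δ : ℝ) (hδ0 : 0 < δ) (hδ : δ ≤ 1 / 6) : ∃ B : ℝ, 0 ≤ B ∧ ∀ᶠ L : ℝ in atTop, ∀ s : ℂ,
    |s.re| ≤ L ^ (-(2/3) - δ) / 4 → |s.im| ≤ exp L / 4 → DifferentiableAt ℂ HH s ∧ ‖HH s‖ ≤ B * L := by
  obtain ⟨B, hB0, hB⟩ := G_bd δ hδ0 hδ
  refine ⟨B + ‖ca‖ + 2 * ‖cb‖, by positivity, ?_⟩
  filter_upwards [hB, eventually_ge_atTop 1] with L h hL1 s hre him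
  obtain ⟨h1, h2⟩ := h (1 + s) (by simpa using hre) (by simpa using him)
  refine ⟨(HH_diff s h1).differentiableAt, ?_⟩
  have hw : L ^ (-(2/3) - δ) ≤ 1 := Real.rpow_le_one_of_one_le_of_nonpos hL1 (by linarith)
  have h6 : ‖(2:ℂ) ^ (-s)‖ ≤ 2 := by
    have := norm_cpow_eq_rpow_re_of_pos (x := 2) (by norm_num) (-s)
    push_cast at this
    rw [this]
    have h7 : (-s).re ≤ 1 := by have := (abs_le.1 hre).1; simp; linarith
    calc (2:ℝ) ^ (-s).re ≤ 2 ^ (1:ℝ) := Real.rpow_le_rpow_of_exponent_le (by norm_num) h7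
      _ = 2 := by norm_num
  have h7 := norm_add₃_le (a := GG (1 + s)) (b := ca) (c := cb * (2:ℂ) ^ (-s))
  rw [norm_mul] at h7
  have h9 : ‖cb‖ * ‖(2:ℂ) ^ (-s)‖ ≤ ‖cb‖ * 2 := by gcongr
  have h11 : (‖ca‖ + 2 * ‖cb‖) * 1 ≤ (‖ca‖ + 2 * ‖cb‖) * L := by gcongr
  rw [HH]; linarith

end VK

namespace VK
open MeasureTheory
local notation "Λ" => ArithmeticFunction.vonMangoldt

lemma bb_fin (x : ℝ) (hx : 2 ≤ x) : ∑ n ∈ Icc 1 ⌊x⌋₊, bb n * ((log (x / n) : ℝ) : ℂ) =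
    ((∑ n ∈ Icc 1 ⌊x⌋₊, (Λ n - 1) / n * log (x / n) + 2 * eulerMascheroniConstant * log x : ℝ) : ℂ) - deriv GG 1 := by
  have h2 : 2 ≤ ⌊x⌋₊ := Nat.le_floor (by exact_mod_cast hx)
  have h3 : (1:ℕ) ∈ Icc 1 ⌊x⌋₊ := by rw [mem_Icc]; omega
  have h4 : (2:ℕ) ∈ Icc 1 ⌊x⌋₊ := by rw [mem_Icc]; omega
  have hl2 : ((log 2 : ℝ) : ℂ) ≠ 0 := Complex.ofReal_ne_zero.2 (log_pos (by norm_num)).ne'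
  simp only [bb, add_mul, sum_add_distrib, ite_mul, zero_mul, Finset.sum_ite_eq', h3, h4, if_true]
  rw [Nat.cast_one, div_one, Nat.cast_ofNat, Real.log_div (by linarith) two_ne_zero]
  rw [Complex.ofReal_add, ofReal_sum, add_sub_assoc]
  congr 1
  · refine sum_congr rfl fun n _ => ?_
    push_cast; rfl
  · rw [ca, GG_one, cb]
    push_cast
    field_simp
    ring

lemma ev_params (δ K : ℝ) (hδ0 : 0 < δ) (hδ : δ ≤ 1 / 6) : ∀ᶠ l : ℝ in atTop, 1 ≤ l ^ (3/5 - δ) ∧ l ≤ (l ^ (3/5 - δ)) ^ 3 ∧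
    8 * l ^ (3/5 - δ) ≤ l * (l ^ (3/5 - δ)) ^ (-(2/3) - δ) ∧ K * (l ^ (3/5 - δ)) ^ 3 ≤ exp (l ^ (3/5 - δ) / 2) := by
  have ht : Tendsto (fun l : ℝ => l ^ (3/5 - δ)) atTop atTop := tendsto_rpow_atTop (by linarith)
  have hk : ∀ᶠ L : ℝ in atTop, K * L ^ 3 ≤ exp (L / 2) := by
    have h1 := ((tendsto_pow_mul_exp_neg_atTop_nhds_zero 3).const_mul (8 * K)).comp (tendsto_id.atTop_div_const (two_pos (α := ℝ)))
    rw [mul_zero] at h1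
    filter_upwards [h1.eventually_le_const one_pos] with L hL
    simp only [Function.comp_apply, id] at hL
    have h2 := mul_le_mul_of_nonneg_right hL (exp_pos (L / 2)).le
    have h3 : exp (-(L / 2)) * exp (L / 2) = 1 := by rw [← exp_add]; simp
    calc K * L ^ 3 = 8 * K * ((L / 2) ^ 3 * (exp (-(L / 2)) * exp (L / 2))) := by rw [h3]; ring
      _ = 8 * K * ((L / 2) ^ 3 * exp (-(L / 2))) * exp (L / 2) := by ring
      _ ≤ _ := by rwa [one_mul] at h2
  have h8 : ∀ᶠ l : ℝ in atTop, 8 ≤ l ^ (16 * δ / 15 + δ ^ 2) := (tendsto_rpow_atTop (by positivity)).eventually_ge_atTop 8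
  filter_upwards [ht.eventually hk, ht.eventually_ge_atTop 1, h8, eventually_ge_atTop 1] with l h1 h2 h3 h4
  refine ⟨h2, ?_, ?_, h1⟩
  · rw [← Real.rpow_natCast, ← Real.rpow_mul (by linarith)]
    calc l = l ^ (1:ℝ) := (Real.rpow_one l).symm
      _ ≤ _ := Real.rpow_le_rpow_of_exponent_le h4 (by push_cast; linarith)
  · rw [← Real.rpow_mul (by linarith), ← Real.rpow_one_add' (by linarith) (by nlinarith)]
    calc 8 * l ^ (3/5 - δ) ≤ l ^ (16 * δ / 15 + δ ^ 2) * l ^ (3/5 - δ) := by gcongr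
      _ = _ := by rw [← Real.rpow_add (by linarith)]; congr 1; ring

theorem B_bd (δ : ℝ) (hδ0 : 0 < δ) (hδ : δ ≤ 1 / 6) : ∃ κ : ℝ, ∀ᶠ x : ℝ in atTop,
    |∑ n ∈ Icc 1 ⌊x⌋₊, (Λ n - 1) / n * log (x / n) + 2 * eulerMascheroniConstant * log x - κ| ≤ exp (-(log x ^ (3/5 - δ) / 2)) := by
  obtain ⟨X, hX0, hX⟩ := HH_triv
  obtain ⟨B, hB0, hB⟩ := HH_bd δ hδ0 hδ
  set K := 16 * (exp 1 * X) + 64 * (B * exp 1) + 8 * B with hK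
  have hLt : Tendsto (fun l : ℝ => l ^ (3/5 - δ)) atTop atTop := tendsto_rpow_atTop (by linarith)
  refine ⟨(deriv GG 1).re, ?_⟩
  filter_upwards [tendsto_log_atTop.eventually (ev_params δ K hδ0 hδ), tendsto_log_atTop.eventually (hLt.eventually hB),
    tendsto_log_atTop.eventually (hLt.eventually_ge_atTop 4), eventually_ge_atTop 3] with x hp hF hL4 hx3
  obtain ⟨hL1, hl3, hlw, hKe⟩ := hp
  set l := log x with hl
  set L := l ^ (3/5 - δ) with hL
  set w := L ^ (-(2/3) - δ) with hw
  have hx0 : 0 < x := by linarith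
  have hl1 : 1 < l := by
    rw [hl, Real.lt_log_iff_exp_lt hx0]; have := Real.exp_one_lt_d9; linarith
  have hw0 : 0 < w := by positivity
  have hw1 : w ≤ 1 := Real.rpow_le_one_of_one_le_of_nonpos hL1 (by linarith)
  have hcd : 1 / l ≤ w / 4 := by
    rw [div_le_iff₀ (by linarith)]; nlinarith
  have hT1 : 1 ≤ exp L / 4 := by have := add_one_le_exp L; linarith
  have hsh := shift HH (1 / l) (w / 4) (exp L / 4) (B * L) (X * l) x (by positivity) (by positivity) hT1 (by linarith) (by positivity) (by positivity)
    HH_zero HH_deriv (fun s h1 h2 h3 => hF s (abs_le.2 ⟨by linarith, by linarith⟩) h3)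
    (fun t => by
      have := hX (1 / l) (by positivity) (by rw [div_le_one (by linarith)]; exact hl1.le) t
      rwa [div_div_eq_mul_div, div_one] at this)
  have hP := perron bb (1 / l) (by positivity) (bb_sum _ (by simp; linarith)).summable x hx0
  have e0 : ∀ t : ℝ, LSeries bb (((1 / l : ℝ):ℂ) + t * I) = HH (((1 / l : ℝ):ℂ) + t * I) := fun t =>
    (bb_sum _ (by simp; linarith)).tsum_eq
  simp_rw [e0] at hP
  rw [hP, bb_fin x (by linarith)] at hsh
  set S := ∑ n ∈ Icc 1 ⌊x⌋₊, (Λ n - 1) / n * log (x / n) + 2 * eulerMascheroniConstant * log x with hS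
  have hxc : x ^ (1 / l) = exp 1 := by
    rw [Real.rpow_def_of_pos hx0, ← hl, mul_one_div_cancel (by linarith)]
  have hxd : x ^ (-(w / 4)) ≤ exp (-(2 * L)) := by
    rw [Real.rpow_def_of_pos hx0, ← hl, exp_le_exp]; linarith
  rw [hxc] at hsh
  have hre : |S - (deriv GG 1).re| ≤ ‖(S:ℂ) - deriv GG 1‖ := by
    have := abs_re_le_norm ((S:ℂ) - deriv GG 1)
    simpa using this
  have hw2 : 1 / w ^ 2 ≤ L ^ 2 := by
    rw [div_le_iff₀ (by positivity), ← mul_pow]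
    refine one_le_pow₀ ?_
    rw [hw, ← Real.rpow_one_add' (by linarith) (by linarith)]
    exact Real.one_le_rpow hL1 (by linarith)
  have e1 : exp (-(2 * L)) * exp L = exp (-L) := by rw [← exp_add]; ring_nf
  have e2 : exp (-L) * exp L = 1 := by rw [← exp_add]; simp
  have he := exp_pos (-L)
  have heL := exp_pos L
  have t1 : 4 * (X * l * exp 1) / (exp L / 4) ≤ 16 * (exp 1 * X) * L ^ 3 * exp (-L) := by
    rw [div_le_iff₀ (by positivity)]
    calc 4 * (X * l * exp 1) ≤ 4 * (X * L ^ 3 * exp 1) := by gcongr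
      _ = 4 * (X * L ^ 3 * exp 1) * (exp (-L) * exp L) := by rw [e2, mul_one]
      _ = _ := by ring
  have t2 : 2 * (B * L * exp 1 / (exp L / 4) ^ 2 * (1 / l + w / 4)) ≤ 64 * (B * exp 1) * L ^ 3 * exp (-L) := by
    have : B * L * exp 1 / (exp L / 4) ^ 2 ≤ 16 * (B * L * exp 1) * exp (-L) := by
      rw [div_le_iff₀ (by positivity)]
      calc B * L * exp 1 = B * L * exp 1 * 1 := by ring
        _ ≤ B * L * exp 1 * exp L := by gcongr; exact one_le_exp (by linarith)
        _ = B * L * exp 1 * (exp (-L) * exp L) * exp L := by rw [e2, mul_one]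
        _ = _ := by ring
    calc _ ≤ 2 * (16 * (B * L * exp 1) * exp (-L) * 1) := by gcongr; linarith
      _ = 32 * (B * exp 1) * L * exp (-L) := by ring
      _ ≤ 64 * (B * exp 1) * L ^ 3 * exp (-L) := by
        have : L ≤ L ^ 3 := by nlinarith [sq_nonneg (L - 1)]
        gcongr; norm_num
  have t3 : B * L * x ^ (-(w / 4)) / (w / 4) ^ 2 * (2 * (exp L / 4)) ≤ 8 * B * L ^ 3 * exp (-L) := by
    calc _ = B * L * x ^ (-(w / 4)) * (1 / w ^ 2) * (8 * exp L) := by ring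
      _ ≤ B * L * exp (-(2 * L)) * L ^ 2 * (8 * exp L) := by gcongr
      _ = 8 * B * L ^ 3 * (exp (-(2 * L)) * exp L) := by ring
      _ = _ := by rw [e1]
  rw [norm_mul] at hsh
  have hpi : 1 ≤ ‖(2 * π : ℂ)‖ := by
    rw [norm_mul, norm_real, Real.norm_of_nonneg pi_pos.le]; simp; linarith [Real.pi_gt_three]
  have h6 : ‖(S:ℂ) - deriv GG 1‖ ≤ ‖(2 * π : ℂ)‖ * ‖(S:ℂ) - deriv GG 1‖ := le_mul_of_one_le_left (norm_nonneg _) hpi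
  calc |S - (deriv GG 1).re| ≤ K * L ^ 3 * exp (-L) := by rw [hK]; linarith
    _ ≤ exp (L / 2) * exp (-L) := by gcongr
    _ = _ := by rw [← exp_add]; congr 1; ring

end VK

namespace VK
local notation "Λ" => ArithmeticFunction.vonMangoldt

lemma diff_bd (a : ℕ → ℝ) (ha : ∀ n, 0 ≤ a n) (x h : ℝ) (hx : 0 < x) (hh : 0 ≤ h) :
    h * ∑ n ∈ Icc 1 ⌊x⌋₊, a n ≤ ∑ n ∈ Icc 1 ⌊x * exp h⌋₊, a n * log (x * exp h / n) - ∑ n ∈ Icc 1 ⌊x⌋₊, a n * log (x / n) ∧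
    ∑ n ∈ Icc 1 ⌊x * exp h⌋₊, a n * log (x * exp h / n) - ∑ n ∈ Icc 1 ⌊x⌋₊, a n * log (x / n) ≤ h * ∑ n ∈ Icc 1 ⌊x * exp h⌋₊, a n := by
  have h1 : x ≤ x * exp h := le_mul_of_one_le_right hx.le (one_le_exp hh)
  have hsub : Icc 1 ⌊x⌋₊ ⊆ Icc 1 ⌊x * exp h⌋₊ := Icc_subset_Icc_right (Nat.floor_mono h1)
  have e : ∀ n ∈ Icc 1 ⌊x⌋₊, a n * log (x * exp h / n) = a n * log (x / n) + h * a n := fun n hn => by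
    have : (n:ℝ) ≠ 0 := by rw [mem_Icc] at hn; exact_mod_cast (by omega : n ≠ 0)
    rw [mul_div_right_comm, Real.log_mul (by positivity) (exp_pos h).ne', Real.log_exp]; ring
  have es := sum_congr rfl e
  rw [sum_add_distrib, ← mul_sum] at es
  have e2 := sum_sdiff (f := fun n => a n * log (x * exp h / n)) hsub
  have e3 := sum_sdiff (f := a) hsub
  have hpos : ∀ n ∈ Icc 1 ⌊x * exp h⌋₊ \ Icc 1 ⌊x⌋₊, 0 ≤ log (x * exp h / n) ∧ log (x * exp h / n) ≤ h := fun n hn => by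
    rw [Finset.mem_sdiff, mem_Icc, mem_Icc, Nat.le_floor_iff (by positivity), Nat.le_floor_iff hx.le] at hn
    have hn0 : (0:ℝ) < n := by exact_mod_cast hn.1.1
    have hn1 : x < n := by by_contra hc; exact hn.2 ⟨hn.1.1, not_lt.1 hc⟩
    refine ⟨log_nonneg (by rw [le_div_iff₀ hn0]; linarith [hn.1.2]), ?_⟩
    rw [Real.log_le_iff_le_exp (by positivity), div_le_iff₀ hn0]
    nlinarith [exp_pos h]
  have h5 : 0 ≤ ∑ n ∈ Icc 1 ⌊x * exp h⌋₊ \ Icc 1 ⌊x⌋₊, a n * log (x * exp h / n) :=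
    sum_nonneg fun n hn => mul_nonneg (ha n) (hpos n hn).1
  have h6 : ∑ n ∈ Icc 1 ⌊x * exp h⌋₊ \ Icc 1 ⌊x⌋₊, a n * log (x * exp h / n) ≤ h * ∑ n ∈ Icc 1 ⌊x * exp h⌋₊ \ Icc 1 ⌊x⌋₊, a n := by
    rw [mul_sum]
    exact sum_le_sum fun n hn => by rw [mul_comm h]; exact mul_le_mul_of_nonneg_left (hpos n hn).2 (ha n)
  constructor
  · linarith
  · rw [← e3, mul_add]; linarith

lemma harm_bd (x : ℝ) (hx : 1 ≤ x) : |∑ n ∈ Icc 1 ⌊x⌋₊, 1 / (n:ℝ) - log x - eulerMascheroniConstant| ≤ 2 / x := by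
  have hn : 1 ≤ ⌊x⌋₊ := Nat.le_floor (by exact_mod_cast hx)
  set N := ⌊x⌋₊ with hN
  have hN1 : (1:ℝ) ≤ N := by exact_mod_cast hn
  have h1 : (N:ℝ) ≤ x := Nat.floor_le (by linarith)
  have h2 : x < N + 1 := Nat.lt_floor_add_one x
  have e : ∑ n ∈ Icc 1 N, 1 / (n:ℝ) = (harmonic N : ℝ) := by
    rw [harmonic_eq_sum_Icc]; push_cast; exact sum_congr rfl fun n _ => one_div _
  have h3 := Real.eulerMascheroniSeq_lt_eulerMascheroniConstant N
  have h4 := Real.eulerMascheroniConstant_lt_eulerMascheroniSeq' N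
  rw [Real.eulerMascheroniSeq] at h3
  rw [Real.eulerMascheroniSeq', if_neg (by omega)] at h4
  rw [e]
  have h5 : log (N + 1) - log N ≤ 1 / N := by
    rw [← Real.log_div (by linarith) (by linarith)]
    have := Real.log_le_sub_one_of_pos (x := ((N:ℝ) + 1) / N) (by positivity)
    rwa [show ((N:ℝ) + 1) / N - 1 = 1 / N by field_simp; ring] at this
  have h6 : 1 / (N:ℝ) ≤ 2 / x := by rw [div_le_div_iff₀ (by linarith) (by linarith)]; linarith
  have h7 : log N ≤ log x := log_le_log (by linarith) h1
  have h8 : log x ≤ log (N + 1) := log_le_log (by linarith) h2.le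
  rw [abs_le]; constructor <;> linarith

noncomputable def rr (x : ℝ) : ℝ := ∑ n ∈ Icc 1 ⌊x⌋₊, Λ n / n - log x + eulerMascheroniConstant

lemma ralg (S l h γ E q X a b κ Hu Hz B1x B1u B1z B2x B2u B2z : ℝ) (hh0 : 0 < h) (hEh : E = q * h) (hhe : h ≤ q) (hxe : X ≤ q)
    (d1 : -E ≤ B1x - B2x + 2 * γ * l - κ ∧ B1x - B2x + 2 * γ * l - κ ≤ E)
    (d2 : -E ≤ B1u - B2u + 2 * γ * (l + h) - κ ∧ B1u - B2u + 2 * γ * (l + h) - κ ≤ E)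
    (d3 : -E ≤ B1z - B2z + 2 * γ * (l - h) - κ ∧ B1z - B2z + 2 * γ * (l - h) - κ ≤ E)
    (u1 : h * S ≤ B1u - B1x) (u2 : B2u - B2x ≤ h * Hu) (u3 : Hu ≤ l + h + γ + a)
    (v1 : B1x - B1z ≤ h * S) (v2 : h * Hz ≤ B2x - B2z) (v3 : l - h + γ - b ≤ Hz) (u4 : a ≤ 2 * X) (v4 : b ≤ 6 * X) :
    |S - l + γ| ≤ 9 * q := by
  obtain ⟨p1, p2⟩ := d1
  obtain ⟨p3, p4⟩ := d2
  obtain ⟨p5, p6⟩ := d3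
  rw [abs_le]
  constructor
  · have k2 : h * (l - h + γ - b) ≤ h * Hz := by gcongr
    have k3 : h * (l - h - γ - b - 2 * q) ≤ h * S := by rw [hEh] at *; linarith
    have k4 := le_of_mul_le_mul_left k3 hh0
    linarith
  · have k2 : h * Hu ≤ h * (l + h + γ + a) := by gcongr
    have k3 : h * S ≤ h * (l + h - γ + a + 2 * q) := by rw [hEh] at *; linarith
    have k4 := le_of_mul_le_mul_left k3 hh0
    linarith

lemma r_bd1 (δ : ℝ) (hδ0 : 0 < δ) (hδ : δ ≤ 1 / 6) : ∀ᶠ x : ℝ in atTop, |rr x| ≤ 9 * exp (-(log x ^ (3/5 - δ) / 8)) := by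
  obtain ⟨κ, hκ⟩ := B_bd δ hδ0 hδ
  obtain ⟨x0, hx0⟩ := eventually_atTop.1 hκ
  filter_upwards [eventually_ge_atTop (max 1 x0 * exp 1), tendsto_log_atTop.eventually_ge_atTop 4] with x hx hl4
  have hm : 1 ≤ max 1 x0 := le_max_left _ _
  have he1 : 1 ≤ exp 1 := one_le_exp (by norm_num)
  have hx1 : 1 ≤ x := by nlinarith
  have hxx : x0 ≤ x := (le_max_right 1 x0).trans (by nlinarith)
  set l := log x with hl
  set P := l ^ (3/5 - δ) with hP
  have hP1 : 1 ≤ P := Real.one_le_rpow (by linarith) (by linarith)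
  have hPl : P ≤ l := by
    calc P ≤ l ^ (1:ℝ) := Real.rpow_le_rpow_of_exponent_le (by linarith) (by linarith)
      _ = l := Real.rpow_one l
  set h := exp (-(P / 4)) with hh
  have hh0 : 0 < h := exp_pos _
  have hh1 : h ≤ 1 := by rw [hh, exp_le_one_iff]; linarith
  have hEmono : ∀ z, l - 1 ≤ log z → exp (-(log z ^ (3/5 - δ) / 2)) ≤ exp (-(3 / 8 * P)) := fun z hz => by
    rw [exp_le_exp]
    have h1 : 3 / 4 * P ≤ log z ^ (3/5 - δ) := by
      calc 3 / 4 * P ≤ (3/4:ℝ) ^ (3/5 - δ) * P := by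
            gcongr
            calc (3/4:ℝ) = (3/4:ℝ) ^ (1:ℝ) := (Real.rpow_one _).symm
              _ ≤ _ := Real.rpow_le_rpow_of_exponent_ge (by norm_num) (by norm_num) (by linarith)
        _ = (3/4 * l) ^ (3/5 - δ) := by rw [hP, Real.mul_rpow (by norm_num) (by linarith)]
        _ ≤ _ := Real.rpow_le_rpow (by linarith) (by linarith) (by linarith)
    linarith
  set B1 : ℝ → ℝ := fun x => ∑ n ∈ Icc 1 ⌊x⌋₊, Λ n / n * log (x / n) with hB1
  set B2 : ℝ → ℝ := fun x => ∑ n ∈ Icc 1 ⌊x⌋₊, 1 / (n:ℝ) * log (x / n) with hB2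
  set E := exp (-(3 / 8 * P)) with hE
  have hD : ∀ z, x0 ≤ z → l - 1 ≤ log z → |B1 z - B2 z + 2 * eulerMascheroniConstant * log z - κ| ≤ E := fun z h1 h2 => by
    refine le_trans ?_ ((hx0 z h1).trans (hEmono z h2))
    rw [hB1, hB2]; simp only
    rw [← sum_sub_distrib]
    apply le_of_eq; congr 4; ext n; ring
  have hEh : E = exp (-(P / 8)) * h := by rw [hE, hh, ← exp_add]; congr 1; ring
  have hhe : h ≤ exp (-(P / 8)) := by rw [hh, exp_le_exp]; linarith
  have hxe : 1 / x ≤ exp (-(P / 8)) := by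
    rw [one_div, ← Real.exp_log (by linarith : 0 < x), ← exp_neg, exp_le_exp, ← hl]; linarith
  have hLa : ∀ n : ℕ, 0 ≤ Λ n / (n:ℝ) := fun n => div_nonneg ArithmeticFunction.vonMangoldt_nonneg (Nat.cast_nonneg n)
  have hOn : ∀ n : ℕ, 0 ≤ 1 / (n:ℝ) := fun n => by positivity
  have hx1' : x ≤ x * exp h := le_mul_of_one_le_right (by linarith) (one_le_exp hh0.le)
  have hlu : log (x * exp h) = l + h := by rw [Real.log_mul (by linarith) (exp_pos h).ne', Real.log_exp]
  have hD0 := abs_le.1 (hD x hxx (by linarith))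
  have hDu := abs_le.1 (hD (x * exp h) (hxx.trans hx1') (by rw [hlu]; linarith))
  have u1 := (diff_bd _ hLa x h (by linarith) hh0.le).1
  have u2 := (diff_bd _ hOn x h (by linarith) hh0.le).2
  have u3 := (abs_le.1 (harm_bd (x * exp h) (by linarith))).2
  have u4 : 2 / (x * exp h) ≤ 2 / x := by gcongr
  have hxd : x = x * exp (-h) * exp h := by rw [mul_assoc, ← exp_add]; simp
  set z := x * exp (-h) with hz
  have hzx : x ≤ z * exp 1 := by
    rw [hz, mul_assoc, ← exp_add]; exact le_mul_of_one_le_right (by linarith) (one_le_exp (by linarith))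
  have hz1 : max 1 x0 ≤ z := by nlinarith [exp_pos 1]
  have hlz : log z = l - h := by rw [hz, Real.log_mul (by linarith) (exp_pos _).ne', Real.log_exp]; ring
  have hDz := abs_le.1 (hD z ((le_max_right _ _).trans hz1) (by rw [hlz]; linarith))
  have v1 := (diff_bd _ hLa z h (by linarith) hh0.le).2
  have v2 := (diff_bd _ hOn z h (by linarith) hh0.le).1
  have v3 := (abs_le.1 (harm_bd z (by linarith))).1
  have v4 : 2 / z ≤ 6 / x := by
    have := Real.exp_one_lt_d9
    rw [div_le_div_iff₀ (by linarith) (by linarith)]; nlinarith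
  rw [← hxd] at v1 v2
  rw [hlu] at hDu u3
  rw [hlz] at hDz v3
  have e6 : 6 / x = 6 * (1 / x) := by ring
  have e2 : 2 / x = 2 * (1 / x) := by ring
  set q := exp (-(P / 8))
  set γ := eulerMascheroniConstant
  set S := ∑ n ∈ Icc 1 ⌊x⌋₊, Λ n / (n:ℝ) with hS
  have hb1 : ∀ z, B1 z = ∑ n ∈ Icc 1 ⌊z⌋₊, Λ n / n * log (z / n) := fun z => rfl
  have hb2 : ∀ z, B2 z = ∑ n ∈ Icc 1 ⌊z⌋₊, 1 / (n:ℝ) * log (z / n) := fun z => rfl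
  rw [← hb1, ← hb1] at u1 v1
  rw [← hb2, ← hb2] at u2 v2
  have hrr : rr x = S - l + γ := rfl
  rw [← hl] at hD0
  rw [hrr]
  exact ralg S l h γ E q (1 / x) _ _ κ _ _ (B1 x) (B1 (x * exp h)) (B1 z) (B2 x) (B2 (x * exp h)) (B2 z) hh0 hEh hhe hxe hD0 hDu hDz u1 u2 (by linarith) v1 v2 (by linarith)
    (u4.trans e2.le) (v4.trans e6.le)

theorem r_bd (δ : ℝ) (hδ0 : 0 < δ) (hδ : δ ≤ 1 / 6) : ∃ C : ℝ, 1 ≤ C ∧ ∀ x : ℝ, 1 ≤ x → |rr x| ≤ C * exp (-(log x ^ (3/5 - δ))) := by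
  have hev : ∀ᶠ l : ℝ in atTop, 8 * l ^ (3/5 - δ) + 32 ≤ l ^ (3/5 - δ/2) := by
    have h1 : ∀ᶠ l : ℝ in atTop, 40 ≤ l ^ (δ/2) := (tendsto_rpow_atTop (by positivity)).eventually_ge_atTop 40
    filter_upwards [h1, eventually_ge_atTop 1] with l h2 h3
    have h4 : 1 ≤ l ^ (3/5 - δ) := Real.one_le_rpow h3 (by linarith)
    rw [show 3/5 - δ/2 = δ/2 + (3/5 - δ) by ring, Real.rpow_add (by linarith)]
    nlinarith
  obtain ⟨X, hX⟩ := eventually_atTop.1 ((r_bd1 (δ/2) (by positivity) (by linarith)).and (tendsto_log_atTop.eventually hev))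
  set Y := max X 1
  have hS0 : 0 ≤ ∑ n ∈ Icc 1 ⌊Y⌋₊, Λ n / (n:ℝ) := sum_nonneg fun n _ => div_nonneg ArithmeticFunction.vonMangoldt_nonneg (Nat.cast_nonneg n)
  have hlY : 0 ≤ log Y := log_nonneg (le_max_right _ _)
  have hg0 := Real.one_half_lt_eulerMascheroniConstant
  have hg1 := Real.eulerMascheroniConstant_lt_two_thirds
  refine ⟨1 + (∑ n ∈ Icc 1 ⌊Y⌋₊, Λ n / (n:ℝ) + log Y + 1) * exp (log Y ^ (3/5 - δ)), le_add_of_nonneg_right (by positivity), fun x hx => ?_⟩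
  rcases le_total Y x with h | h
  · obtain ⟨h1, h2⟩ := hX x ((le_max_left _ _).trans h)
    refine h1.trans ?_
    have h9 : (9:ℝ) ≤ exp 4 := by
      have := Real.add_one_le_exp (2:ℝ)
      rw [show (4:ℝ) = 2 + 2 by norm_num, exp_add]; nlinarith
    calc 9 * exp (-(log x ^ (3/5 - δ/2) / 8)) ≤ exp 4 * exp (-(log x ^ (3/5 - δ/2) / 8)) := by gcongr
      _ ≤ exp (-(log x ^ (3/5 - δ))) := by rw [← exp_add, exp_le_exp]; linarith
      _ ≤ _ := le_mul_of_one_le_left (exp_pos _).le (le_add_of_nonneg_right (by positivity))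
  · have h1 : ∑ n ∈ Icc 1 ⌊x⌋₊, Λ n / (n:ℝ) ≤ ∑ n ∈ Icc 1 ⌊Y⌋₊, Λ n / (n:ℝ) :=
      sum_le_sum_of_subset_of_nonneg (Icc_subset_Icc_right (Nat.floor_mono h)) fun n _ _ => div_nonneg ArithmeticFunction.vonMangoldt_nonneg (Nat.cast_nonneg n)
    have h2 : 0 ≤ ∑ n ∈ Icc 1 ⌊x⌋₊, Λ n / (n:ℝ) := sum_nonneg fun n _ => div_nonneg ArithmeticFunction.vonMangoldt_nonneg (Nat.cast_nonneg n)
    have h3 : log x ≤ log Y := log_le_log (by linarith) h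
    have h4 : 0 ≤ log x := log_nonneg hx
    have h5 : |rr x| ≤ ∑ n ∈ Icc 1 ⌊Y⌋₊, Λ n / (n:ℝ) + log Y + 1 := by
      rw [rr, abs_le]; constructor <;> linarith
    have h6 : log x ^ (3/5 - δ) ≤ log Y ^ (3/5 - δ) := Real.rpow_le_rpow h4 h3 (by linarith)
    have h7 : 1 ≤ exp (log Y ^ (3/5 - δ)) * exp (-(log x ^ (3/5 - δ))) := by rw [← exp_add]; exact one_le_exp (by linarith)
    set K := ∑ n ∈ Icc 1 ⌊Y⌋₊, Λ n / (n:ℝ) + log Y + 1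
    have hK : 0 ≤ K := by positivity
    calc _ ≤ K * 1 := by rw [mul_one]; exact h5
      _ ≤ K * (exp (log Y ^ (3/5 - δ)) * exp (-(log x ^ (3/5 - δ)))) := by gcongr
      _ ≤ _ := by have := exp_pos (-(log x ^ (3/5 - δ))); nlinarith

end VK

namespace VK

structure Dick (R : ℝ → ℝ) : Prop where
  cont : Continuous R
  one : ∀ t, t ≤ 1 → R t = 1
  eq : ∀ t ≥ (1 : ℝ), R t = 1 - ∫ v in (1 : ℝ)..t, R (v - 1) / v

namespace Dick

lemma hd {R : ℝ → ℝ} (h : Dick R) (t : ℝ) (ht : 1 < t) : HasDerivAt R (-(R (t - 1) / t)) t := by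
  have hc : ContinuousOn (fun v => R (v - 1) / v) (Set.Ioi 0) := fun v hv =>
    ((h.cont.comp (by fun_prop : Continuous fun v : ℝ => v - 1)).continuousAt.div continuousAt_id (ne_of_gt hv)).continuousWithinAt
  have h1 : HasDerivAt (fun t => 1 - ∫ v in (1 : ℝ)..t, R (v - 1) / v) (-(R (t - 1) / t)) t := by
    refine HasDerivAt.const_sub 1 ?_
    refine intervalIntegral.integral_hasDerivAt_right ((hc.mono fun v hv => ?_).intervalIntegrable)
      (hc.stronglyMeasurableAtFilter isOpen_Ioi t (by simp; linarith)) (hc.continuousAt (Ioi_mem_nhds (by linarith)))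
    rw [Set.uIcc_of_le ht.le] at hv; exact lt_of_lt_of_le one_pos hv.1
  refine h1.congr_of_eventuallyEq ?_
  filter_upwards [Ioi_mem_nhds ht] with v hv using h.eq v (le_of_lt hv)

lemma mulR {R : ℝ → ℝ} (h : Dick R) (u : ℝ) (hu : 1 ≤ u) : u * R u = ∫ v in (u - 1)..u, R v := by
  set F : ℝ → ℝ := fun t => ∫ v in (0:ℝ)..t, R v
  have hF : ∀ t, HasDerivAt F (R t) t := fun t => intervalIntegral.integral_hasDerivAt_right (h.cont.intervalIntegrable _ _)
    (h.cont.stronglyMeasurableAtFilter _ _) h.cont.continuousAt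
  have hFc : Continuous F := continuous_iff_continuousAt.2 fun t => (hF t).continuousAt
  have e : ∀ t, ∫ v in (t - 1)..t, R v = F t - F (t - 1) := fun t =>
    (intervalIntegral.integral_interval_sub_left (h.cont.intervalIntegrable _ _) (h.cont.intervalIntegrable _ _)).symm
  have hG : ContinuousOn (fun t => t * R t - (F t - F (t - 1))) (Set.Icc 1 u) := by
    have := h.cont
    fun_prop
  have hd : ∀ t ∈ Set.Ioo 1 u, HasDerivAt (fun t => t * R t - (F t - F (t - 1))) 0 t := fun t ht => by
    have h1 := ((hasDerivAt_id t).mul (h.hd t ht.1)).sub ((hF t).sub ((hF (t - 1)).comp_sub_const t 1))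
    refine h1.congr_deriv ?_
    have : t ≠ 0 := by linarith [ht.1]
    simp only [id]; field_simp; ring
  rw [e]
  rcases hu.eq_or_lt with rfl | hu1
  · rw [← e, intervalIntegral.integral_congr (g := fun _ => (1:ℝ)) (fun v hv => ?_)]
    · simp [h.one 1 le_rfl]
    · rw [Set.uIcc_of_le (by norm_num)] at hv; exact h.one v hv.2
  · obtain ⟨c, hc, hc2⟩ := exists_hasDerivAt_eq_slope (fun t => t * R t - (F t - F (t - 1))) (fun _ => 0) hu1 hG hd
    rw [eq_comm, div_eq_zero_iff] at hc2
    have h2 : (1:ℝ) * R 1 - (F 1 - F (1 - 1)) = 0 := by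
      rw [← e, intervalIntegral.integral_congr (g := fun _ => (1:ℝ)) (fun v hv => ?_)]
      · simp [h.one 1 le_rfl]
      · rw [Set.uIcc_of_le (by norm_num)] at hv; exact h.one v hv.2
    rcases hc2 with h3 | h3 <;> linarith

lemma pos {R : ℝ → ℝ} (h : Dick R) (t : ℝ) : 0 < R t := by
  by_contra hc
  push Not at hc
  set S := {t | R t ≤ 0} with hS
  have hcl : IsClosed S := isClosed_le h.cont continuous_const
  have hb : BddBelow S := ⟨1, fun s hs => by
    by_contra hs1
    have h1 : R s ≤ 0 := hs
    rw [h.one s (by linarith)] at h1; linarith⟩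
  have hm := hcl.csInf_mem ⟨t, hc⟩ hb
  set t0 := sInf S
  have hm0 : R t0 ≤ 0 := hm
  have ht1 : 1 < t0 := by
    by_contra hs1
    rw [h.one t0 (by linarith)] at hm0; linarith
  have hlt : ∀ s < t0, 0 < R s := fun s hs => by
    by_contra hs1
    exact absurd (csInf_le hb (show s ∈ S from not_lt.1 hs1)) (not_le.2 hs)
  have h2 := h.mulR t0 ht1.le
  have h3 : 0 < ∫ v in (t0 - 1)..t0, R v :=
    intervalIntegral.intervalIntegral_pos_of_pos_on (h.cont.intervalIntegrable _ _) (fun s hs => hlt s hs.2) (by linarith)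
  nlinarith

lemma anti {R : ℝ → ℝ} (h : Dick R) : Antitone R := by
  have h1 : AntitoneOn R (Set.Ici 1) := by
    refine antitoneOn_of_deriv_nonpos (convex_Ici 1) h.cont.continuousOn ?_ ?_
    · intro t ht; rw [interior_Ici] at ht; exact (h.hd t ht).differentiableAt.differentiableWithinAt
    · intro t ht; rw [interior_Ici] at ht; rw [(h.hd t ht).deriv]
      have := h.pos (t - 1)
      have : (0:ℝ) < t := lt_trans one_pos ht
      simp only [Left.neg_nonpos_iff]; positivity
  intro a b hab
  rcases le_total b 1 with hb | hb
  · rw [h.one a (hab.trans hb), h.one b hb]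
  · rcases le_total a 1 with ha | ha
    · rw [h.one a ha, ← h.one 1 le_rfl]; exact h1 (Set.mem_Ici.2 le_rfl) hb hb
    · exact h1 ha hb hab

lemma le_one {R : ℝ → ℝ} (h : Dick R) (t : ℝ) : R t ≤ 1 := by
  rcases le_total t 1 with ht | ht
  · exact (h.one t ht).le
  · rw [← h.one 1 le_rfl]; exact h.anti ht

lemma half {R : ℝ → ℝ} (h : Dick R) (t : ℝ) (ht : 1 ≤ t) : R (t - 1/2) ≤ 2 * t * R t := by
  have h1 := h.mulR t ht
  have h2 : ∫ v in (t - 1)..(t - 1/2), R v ≥ ∫ v in (t - 1)..(t - 1/2), R (t - 1/2) :=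
    intervalIntegral.integral_mono_on (by linarith) (by simp) (h.cont.intervalIntegrable _ _) fun v hv => h.anti hv.2
  have h3 : 0 ≤ ∫ v in (t - 1/2)..t, R v := intervalIntegral.integral_nonneg (by linarith) fun v _ => (h.pos v).le
  rw [← intervalIntegral.integral_add_adjacent_intervals (h.cont.intervalIntegrable (t - 1) (t - 1/2)) (h.cont.intervalIntegrable (t - 1/2) t)] at h1
  rw [intervalIntegral.integral_const, smul_eq_mul] at h2
  linarith

lemma unit {R : ℝ → ℝ} (h : Dick R) (t : ℝ) (ht : 1 ≤ t) : R t ≤ (2 * (t + 1)) ^ 2 * R (t + 1) := by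
  have h1 := h.half (t + 1) (by linarith)
  have h2 := h.half (t + 1 - 1/2) (by linarith)
  rw [show t + 1 - 1/2 - 1/2 = t by ring] at h2
  have := h.pos (t + 1)
  have h3 := h.pos (t + 1 - 1/2)
  calc R t ≤ 2 * (t + 1 - 1/2) * R (t + 1 - 1/2) := h2
    _ ≤ 2 * (t + 1) * (2 * (t + 1) * R (t + 1)) := by gcongr; linarith
    _ = _ := by ring

end Dick

end VK

namespace VK

noncomputable def dq (R : ℝ → ℝ) (t : ℝ) : ℝ := R (t - 1) / (t * R t)

namespace Dick

lemma qpos {R : ℝ → ℝ} (h : Dick R) (t : ℝ) (ht : 1 ≤ t) : 0 < dq R t := by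
  have := h.pos t; have := h.pos (t - 1); unfold dq; positivity

lemma qR {R : ℝ → ℝ} (h : Dick R) (t : ℝ) : dq R t * R t = R (t - 1) / t := by
  have := (h.pos t).ne'; unfold dq
  by_cases h0 : t = 0
  · simp [h0]
  · field_simp

lemma qcont {R : ℝ → ℝ} (h : Dick R) : ContinuousOn (dq R) (Set.Ici 1) := by
  have hc := h.cont
  unfold dq
  refine ContinuousOn.div (by fun_prop) (by fun_prop) fun t ht => ?_
  have := h.pos t
  have : (0:ℝ) < t := lt_of_lt_of_le one_pos ht
  positivity

lemma hd' {R : ℝ → ℝ} (h : Dick R) (t : ℝ) (ht : 1 < t) : HasDerivAt R (-(dq R t * R t)) t := by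
  rw [h.qR]; exact h.hd t ht

lemma qmono12 {R : ℝ → ℝ} (h : Dick R) : StrictMonoOn (dq R) (Set.Icc 1 2) := by
  have hc := h.cont
  have h1 : StrictAntiOn (fun t => t * R t) (Set.Icc 1 2) := by
    refine strictAntiOn_of_deriv_neg (convex_Icc 1 2) (by fun_prop) fun t ht => ?_
    rw [interior_Icc] at ht
    have h2 : HasDerivAt (fun t => t * R t) (1 * R t + t * -(R (t - 1) / t)) t := (hasDerivAt_id t).mul (h.hd t ht.1)
    rw [h2.deriv, h.one (t - 1) (by linarith [ht.2])]
    have h3 : R t < 1 := by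
      have h4 : StrictAntiOn R (Set.Ici 1) := by
        refine strictAntiOn_of_deriv_neg (convex_Ici 1) hc.continuousOn fun s hs => ?_
        rw [interior_Ici] at hs
        rw [(h.hd s hs).deriv]
        have := h.pos (s - 1)
        have : (0:ℝ) < s := lt_trans one_pos hs
        simp only [Left.neg_neg_iff]; positivity
      have := h4 (Set.mem_Ici.2 le_rfl) (Set.mem_Ici.2 ht.1.le) ht.1
      rwa [h.one 1 le_rfl] at this
    have : t ≠ 0 := by linarith [ht.1]
    field_simp; linarith
  intro a ha b hb hab
  have := h1 ha hb hab
  simp only at this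
  unfold dq
  rw [h.one (a - 1) (by linarith [ha.2]), h.one (b - 1) (by linarith [hb.2])]
  have h0 : 0 < b * R b := mul_pos (by linarith [hb.1]) (h.pos b)
  exact one_div_lt_one_div_of_lt h0 this

lemma gint {R : ℝ → ℝ} (h : Dick R) (t : ℝ) (ht : 2 ≤ t) :
    R (t - 1) - R t - dq R (t - 1) * (t * R t) = ∫ s in (t-1)..t, (dq R s - dq R (t - 1)) * R s := by
  have hc := h.cont
  have hci : ContinuousOn (fun s => dq R s * R s) (Set.Icc (t-1) t) :=
    (h.qcont.mono fun s hs => by simp only [Set.mem_Ici]; linarith [hs.1]).mul hc.continuousOn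
  have hi : IntervalIntegrable (fun s => dq R s * R s) MeasureTheory.volume (t-1) t :=
    ContinuousOn.intervalIntegrable_of_Icc (by linarith) hci
  have h1 : ∫ s in (t-1)..t, -(dq R s * R s) = R t - R (t - 1) := by
    refine intervalIntegral.integral_eq_sub_of_hasDerivAt_of_le (by linarith) hc.continuousOn (fun s hs => h.hd' s (by linarith [hs.1])) hi.neg
  rw [intervalIntegral.integral_neg] at h1
  simp_rw [sub_mul]
  rw [intervalIntegral.integral_sub hi ((hc.intervalIntegrable _ _).const_mul _), intervalIntegral.integral_const_mul, ← h.mulR t (by linarith)]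
  linarith

lemma gpos_of {R : ℝ → ℝ} (h : Dick R) (t : ℝ) (ht : 2 ≤ t) (hq : StrictMonoOn (dq R) (Set.Icc 1 t)) :
    0 < R (t - 1) - R t - dq R (t - 1) * (t * R t) := by
  rw [h.gint t ht]
  refine intervalIntegral.intervalIntegral_pos_of_pos_on ?_ (fun s hs => ?_) (by linarith)
  · refine ContinuousOn.intervalIntegrable_of_Icc (by linarith) ?_
    exact ((h.qcont.mono fun s hs => by simp only [Set.mem_Ici]; linarith [hs.1]).sub continuousOn_const).mul h.cont.continuousOn
  · have := hq (a := t - 1) (b := s) ⟨by linarith, by linarith⟩ ⟨by linarith [hs.1], hs.2.le⟩ hs.1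
    exact mul_pos (by linarith) (h.pos s)

lemma qmono_of {R : ℝ → ℝ} (h : Dick R) (T : ℝ) (hT : 2 ≤ T)
    (hg : ∀ t, 2 ≤ t → t < T → 0 < R (t - 1) - R t - dq R (t - 1) * (t * R t)) : StrictMonoOn (dq R) (Set.Icc 1 T) := by
  have h2 : StrictMonoOn (dq R) (Set.Icc 2 T) := by
    refine strictMonoOn_of_deriv_pos (convex_Icc 2 T) (h.qcont.mono fun s hs => by simp only [Set.mem_Ici]; linarith [hs.1]) fun t ht => ?_
    rw [interior_Icc] at ht
    have ht2 := ht.1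
    have hR := h.pos t
    have hR1 := h.pos (t-1)
    have ht0 : 0 < t := by linarith
    have a1 : HasDerivAt (fun t => R (t - 1)) (-(dq R (t-1) * R (t-1))) t := (h.hd' (t - 1) (by linarith)).comp_sub_const t 1
    have a2 : HasDerivAt (fun t => t * R t) (1 * R t + t * -(R (t - 1) / t)) t := (hasDerivAt_id t).mul (h.hd t (by linarith))
    have a3 : HasDerivAt (dq R) _ t := a1.div a2 (by positivity)
    rw [a3.deriv]
    have := hg t ht2.le ht.2
    apply div_pos _ (by positivity)
    have e : -(dq R (t - 1) * R (t - 1)) * (t * R t) - R (t - 1) * (1 * R t + t * -(R (t - 1) / t)) =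
      R (t - 1) * (R (t - 1) - R t - dq R (t - 1) * (t * R t)) := by field_simp; ring
    rw [e]; positivity
  have := h.qmono12.union h2 (isGreatest_Icc (by norm_num)) (isLeast_Icc hT)
  rwa [Set.Icc_union_Icc_eq_Icc (by norm_num) hT] at this

lemma gpos {R : ℝ → ℝ} (h : Dick R) (t : ℝ) (ht : 2 ≤ t) : 0 < R (t - 1) - R t - dq R (t - 1) * (t * R t) := by
  by_contra hcon
  have hc := h.cont
  have hqc : ContinuousOn (fun t => dq R (t - 1)) (Set.Ici 2) :=
    h.qcont.comp (by fun_prop) fun s hs => by simp only [Set.mem_Ici] at hs ⊢; linarith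
  have hgc : ContinuousOn (fun t => R (t - 1) - R t - dq R (t - 1) * (t * R t)) (Set.Ici 2) := by fun_prop
  set S := {s | s ∈ Set.Ici (2:ℝ) ∧ R (s - 1) - R s - dq R (s - 1) * (s * R s) ≤ 0} with hS
  have hcl : IsClosed S := by
    have := hgc.preimage_isClosed_of_isClosed isClosed_Ici (isClosed_Iic (a := (0:ℝ)))
    exact this
  have hb : BddBelow S := ⟨2, fun s hs => hs.1⟩
  have hm := hcl.csInf_mem ⟨t, ht, not_lt.1 hcon⟩ hb
  set T := sInf S
  have hT := hm.1
  have := h.gpos_of T hT (h.qmono_of T hT fun s hs hsT => by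
    by_contra hs1
    exact absurd (csInf_le hb (show s ∈ S from ⟨hs, not_lt.1 hs1⟩)) (not_le.2 hsT))
  linarith [hm.2]

lemma qmono {R : ℝ → ℝ} (h : Dick R) (a b : ℝ) (ha : 1 ≤ a) (hab : a ≤ b) : dq R a ≤ dq R b :=
  (h.qmono_of (b + 1) (by linarith) fun t ht _ => h.gpos t ht).monotoneOn ⟨ha, by linarith⟩ ⟨by linarith, by linarith⟩ hab

lemma expd {R : ℝ → ℝ} (h : Dick R) (k s : ℝ) (hs : 1 < s) :
    HasDerivAt (fun s => R s * exp (k * s)) ((k - dq R s) * (R s * exp (k * s))) s := by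
  have h1 : HasDerivAt (fun s => exp (k * s)) (exp (k * s) * (k * 1)) s := ((hasDerivAt_id s).const_mul k).exp
  refine ((h.hd' s hs).mul h1).congr_deriv ?_
  ring

lemma expc {R : ℝ → ℝ} (h : Dick R) (k : ℝ) : Continuous (fun s => R s * exp (k * s)) := by
  have := h.cont
  fun_prop

lemma up {R : ℝ → ℝ} (h : Dick R) (a b : ℝ) (ha : 1 ≤ a) (hab : a ≤ b) : R a ≤ R b * exp (dq R b * (b - a)) := by
  have h1 : MonotoneOn (fun s => R s * exp (dq R b * s)) (Set.Icc a b) := by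
    refine monotoneOn_of_deriv_nonneg (convex_Icc a b) (h.expc _).continuousOn ?_ ?_ <;> intro t ht <;> rw [interior_Icc] at ht
    · exact (h.expd _ t (by linarith [ht.1])).differentiableAt.differentiableWithinAt
    · rw [(h.expd _ t (by linarith [ht.1])).deriv]
      have := h.qmono t b (by linarith [ht.1]) ht.2.le
      have := h.pos t
      exact mul_nonneg (by linarith) (by positivity)
  have := h1 ⟨le_rfl, hab⟩ ⟨hab, le_rfl⟩ hab
  simp only at this
  rw [mul_sub, exp_sub, mul_div_assoc', le_div_iff₀ (exp_pos _)]; exact this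

lemma dn {R : ℝ → ℝ} (h : Dick R) (a b : ℝ) (ha : 1 ≤ a) (hab : a ≤ b) : R b * exp (dq R a * (b - a)) ≤ R a := by
  have h1 : AntitoneOn (fun s => R s * exp (dq R a * s)) (Set.Icc a b) := by
    refine antitoneOn_of_deriv_nonpos (convex_Icc a b) (h.expc _).continuousOn ?_ ?_ <;> intro t ht <;> rw [interior_Icc] at ht
    · exact (h.expd _ t (by linarith [ht.1])).differentiableAt.differentiableWithinAt
    · rw [(h.expd _ t (by linarith [ht.1])).deriv]
      have := h.qmono a t ha ht.1.le
      have := h.pos t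
      exact mul_nonpos_of_nonpos_of_nonneg (by linarith) (by positivity)
  have := h1 ⟨le_rfl, hab⟩ ⟨hab, le_rfl⟩ hab
  simp only at this
  rw [mul_sub, exp_sub, mul_div_assoc', div_le_iff₀ (exp_pos _)]; exact this

lemma qle {R : ℝ → ℝ} (h : Dick R) (t : ℝ) (ht : 1 ≤ t) : dq R t ≤ 2 * log (2 * (t + 1)) := by
  have h1 := (h.dn t (t + 1) ht (by linarith)).trans (h.unit t ht)
  have h2 := h.pos (t + 1)
  rw [show t + 1 - t = 1 by ring, mul_one, mul_comm] at h1
  have h3 := le_of_mul_le_mul_right h1 h2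
  have h4 := log_le_log (exp_pos _) h3
  rwa [log_exp, log_pow] at h4

lemma Rv {R : ℝ → ℝ} (h : Dick R) (u v Q : ℝ) (hv : 0 ≤ v) (hu : 1 ≤ u - v) (hQ : 2 * log (2 * (u + 1)) ≤ Q) :
    R (u - v) ≤ exp (Q * v) * R u := by
  have h1 := h.up (u - v) u hu (by linarith)
  have h2 := h.qle u (by linarith)
  have := h.pos u
  rw [sub_sub_cancel] at h1
  refine h1.trans ?_
  rw [mul_comm]; gcongr; linarith

lemma wv {R : ℝ → ℝ} (h : Dick R) (u v Q : ℝ) (hv : 0 ≤ v) (hu : 1 ≤ u - v) (hQ : 2 * log (2 * (u + 1)) ≤ Q) :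
    R (u - v - 1) / (u - v) ≤ Q * exp (Q * v) * R u := by
  have h1 := h.Rv u v Q hv hu hQ
  have h2 := h.qle u (by linarith)
  have h3 := h.qmono (u - v) u hu (by linarith)
  have := h.qpos (u - v) hu
  have := h.pos (u - v)
  rw [← h.qR, mul_assoc]
  have : 0 ≤ Q := by linarith
  gcongr; linarith

end Dick

end VK

namespace VK
section
open MeasureTheory
local notation "Λ" => ArithmeticFunction.vonMangoldt

lemma lcake {ι : Type*} (s : Finset ι) (a p : ι → ℝ) (w : ℝ → ℝ) (B : ℝ) (hp : ∀ n ∈ s, 0 ≤ p n ∧ p n ≤ B)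
    (hB : 0 ≤ B) (hw : ContinuousOn w (Set.Icc 0 B)) :
    IntervalIntegrable (fun v => w v * ∑ n ∈ s with p n ≤ v, a n) volume 0 B ∧
    ∑ n ∈ s, a n * (∫ v in (p n)..B, w v) = ∫ v in (0:ℝ)..B, w v * ∑ n ∈ s with p n ≤ v, a n := by
  have hwi : IntervalIntegrable w volume 0 B := hw.intervalIntegrable_of_Icc hB
  have e : ∀ v, w v * ∑ n ∈ s with p n ≤ v, a n = ∑ n ∈ s, a n * (Set.Ici (p n)).indicator w v := fun v => by
    rw [sum_filter, mul_sum]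
    refine sum_congr rfl fun n _ => ?_
    by_cases h : p n ≤ v <;> simp [Set.indicator, h, mul_comm]
  have hi : ∀ n, IntervalIntegrable ((Set.Ici (p n)).indicator w) volume 0 B := fun n => by
    rw [intervalIntegrable_iff] at hwi ⊢
    exact hwi.indicator measurableSet_Ici
  simp_rw [e]
  constructor
  · have := IntervalIntegrable.sum (μ := volume) (a := 0) (b := B) s (f := fun n v => a n * (Set.Ici (p n)).indicator w v) (fun n _ => (hi n).const_mul _)
    refine this.congr ?_
    intro v _
    simp
  · rw [intervalIntegral.integral_finsetSum fun n _ => (hi n).const_mul _]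
    refine sum_congr rfl fun n hn => ?_
    rw [intervalIntegral.integral_const_mul]
    congr 1
    obtain ⟨h0, h1⟩ := hp n hn
    rw [intervalIntegral.integral_of_le h1, intervalIntegral.integral_of_le hB, setIntegral_indicator measurableSet_Ici, ← integral_Icc_eq_integral_Ioc]
    refine setIntegral_congr_set ?_
    have : (Set.Ioc 0 B ∩ Set.Ici (p n) : Set ℝ) =ᵐ[volume] (Set.Icc 0 B ∩ Set.Ici (p n) : Set ℝ) := Ioc_ae_eq_Icc.inter (ae_eq_refl _)
    refine EventuallyEq.trans ?_ this.symm
    rw [show Set.Icc 0 B ∩ Set.Ici (p n) = Set.Icc (p n) B by ext v; simp; constructor <;> intro h <;> constructorm* _ ∧ _ <;> grind]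
    exact EventuallyEq.rfl

lemma expz (z : ℝ) (hz : 0 < z) : exp (-(z / 2)) ≤ 2 / z := by
  rw [exp_neg, inv_eq_one_div, div_le_div_iff₀ (exp_pos _) hz]
  linarith [add_one_le_exp (z / 2)]

lemma ierr (a l : ℝ) (ha : 0 < a) (ha1 : a ≤ 3/5) (hl : 0 < l) :
    ∫ v in (0:ℝ)..1, exp (-((v * l) ^ a / 2)) ≤ 5 * l ^ (-a) := by
  have h1 : IntervalIntegrable (fun v : ℝ => 2 * l ^ (-a) * v ^ (-a)) volume 0 1 :=
    (intervalIntegral.intervalIntegrable_rpow' (by linarith)).const_mul _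
  have h2 : ∫ v in (0:ℝ)..1, exp (-((v * l) ^ a / 2)) ≤ ∫ v in (0:ℝ)..1, 2 * l ^ (-a) * v ^ (-a) := by
    refine intervalIntegral.integral_mono_on_of_le_Ioo (by norm_num) ?_ h1 fun v hv => ?_
    · exact (by fun_prop (disch := exact ha.le) : Continuous fun v : ℝ => exp (-((v * l) ^ a / 2))).intervalIntegrable _ _
    · have hv0 := hv.1
      refine (expz _ (by positivity)).trans (le_of_eq ?_)
      rw [mul_rpow hv0.le hl.le, rpow_neg hv0.le, rpow_neg hl.le]
      field_simp
  refine h2.trans ?_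
  rw [intervalIntegral.integral_const_mul, integral_rpow (Or.inl (by linarith))]
  have h3 : (0:ℝ) < -a + 1 := by linarith
  rw [one_rpow, zero_rpow h3.ne']
  have : (1 - 0) / (-a + 1) ≤ 5/2 := by rw [div_le_div_iff₀ h3 (by norm_num)]; linarith
  have : 0 < l ^ (-a) := rpow_pos_of_pos hl _
  nlinarith

lemma Aeq (x : ℝ) : ∑ n ∈ Icc 1 ⌊x⌋₊, Λ n / n = rr x + log x - eulerMascheroniConstant := by
  unfold rr; ring

lemma main_sum {R : ℝ → ℝ} (h : Dick R) (C a : ℝ) (ha : 0 < a) (ha1 : a ≤ 3/5) (hC : 1 ≤ C)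
    (hr : ∀ t, 1 ≤ t → |rr t| ≤ C * exp (-(log t ^ a))) (y u Q : ℝ) (hy : 1 < y) (hu : 2 < u)
    (hQ : 2 * log (2 * (u + 1)) ≤ Q) (hl : 100 * (C * (5 * Q + 2)) ≤ log y ^ a) :
    R u * (u * log y - eulerMascheroniConstant - 1/100) ≤
      ∑ d ∈ Icc 1 ⌊y⌋₊, Λ d / d * R (u - log d / log y) := by
  have hl0 : 0 < log y := log_pos hy
  have hy0 : 0 < y := by linarith
  set l := log y with hldef
  have hc := h.cont
  have hRu := h.pos u
  have hQ0 : 0 ≤ Q := le_trans (by have := log_nonneg (show 1 ≤ 2 * (u + 1) by linarith); linarith) hQ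
  set w : ℝ → ℝ := fun v => R (u - v - 1) / (u - v) with hw
  have hwc : ContinuousOn w (Set.Icc 0 1) := by
    refine ContinuousOn.div (by fun_prop) (by fun_prop) fun v hv => ?_
    have := hv.2; intro h0; linarith
  have hφd : ∀ v ∈ Set.Icc (0:ℝ) 1, HasDerivAt (fun v => R (u - v)) (w v) v := fun v hv => by
    have := (h.hd (u - v) (by linarith [hv.2])).comp_const_sub u v
    simpa [hw] using this
  have hwi : ∀ a b, a ∈ Set.Icc (0:ℝ) 1 → b ∈ Set.Icc (0:ℝ) 1 → IntervalIntegrable w volume a b := fun a b ha hb =>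
    (hwc.mono (Set.OrdConnected.uIcc_subset Set.ordConnected_Icc ha hb)).intervalIntegrable
  have hft : ∀ p ∈ Set.Icc (0:ℝ) 1, ∫ v in p..1, w v = R (u - 1) - R (u - p) := fun p hp => by
    refine intervalIntegral.integral_eq_sub_of_hasDerivAt (f := fun v => R (u - v)) (fun v hv => hφd v ?_) (hwi _ _ hp (by simp))
    rw [Set.uIcc_of_le hp.2] at hv; exact ⟨hp.1.trans hv.1, hv.2⟩
  have hp : ∀ d ∈ Icc 1 ⌊y⌋₊, 0 ≤ log (d:ℝ) / l ∧ log (d:ℝ) / l ≤ 1 := fun d hd => by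
    rw [mem_Icc] at hd
    have h1 : (1:ℝ) ≤ d := by exact_mod_cast hd.1
    have h2 : (d:ℝ) ≤ y := (Nat.le_floor_iff hy0.le).1 hd.2
    refine ⟨div_nonneg (log_nonneg h1) hl0.le, (div_le_one hl0).2 (log_le_log (by linarith) h2)⟩
  obtain ⟨hSi, hS⟩ := lcake (Icc 1 ⌊y⌋₊) (fun d => Λ d / d) (fun d => log (d:ℝ) / l) w 1 hp zero_le_one hwc
  have hSv : ∀ v ∈ Set.Icc (0:ℝ) 1, ∑ d ∈ Icc 1 ⌊y⌋₊ with log ((d:ℕ):ℝ) / l ≤ v, Λ d / d =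
      rr (exp (v * l)) + v * l - eulerMascheroniConstant := fun v hv => by
    have := Aeq (exp (v * l))
    rw [log_exp] at this
    rw [← this]
    refine sum_congr ?_ fun _ _ => rfl
    ext d
    simp only [mem_filter, mem_Icc, Nat.le_floor_iff hy0.le, Nat.le_floor_iff (exp_pos (v * l)).le]
    have key : 1 ≤ d → (log (d:ℝ) / l ≤ v ↔ (d:ℝ) ≤ exp (v * l)) := fun hd => by
      rw [div_le_iff₀ hl0, log_le_iff_le_exp (by exact_mod_cast hd)]
    have key2 : exp (v * l) ≤ y := by
      rw [← le_log_iff_exp_le hy0]; nlinarith [hv.2]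
    constructor
    · rintro ⟨⟨h1, h2⟩, h3⟩; exact ⟨h1, (key h1).1 h3⟩
    · rintro ⟨h1, h2⟩; exact ⟨⟨h1, h2.trans key2⟩, (key h1).2 h2⟩
  have hrv : ∀ v, 0 ≤ v → rr (exp (v * l)) ≤ C * exp (-((v * l) ^ a)) := fun v hv => by
    have := hr (exp (v * l)) (one_le_exp (by positivity))
    rw [log_exp] at this
    exact (le_abs_self _).trans this
  have hsum : ∑ d ∈ Icc 1 ⌊y⌋₊, Λ d / d * R (u - log d / l) =
      (rr y + l - eulerMascheroniConstant) * R (u - 1) - ∫ v in (0:ℝ)..1, w v * ∑ d ∈ Icc 1 ⌊y⌋₊ with log ((d:ℕ):ℝ) / l ≤ v, Λ d / d := by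
    rw [← hS, hldef, ← Aeq, sum_mul, ← sum_sub_distrib]
    refine sum_congr rfl fun d hd => ?_
    rw [hft _ (hp d hd)]; ring
  have hcE : Continuous fun v : ℝ => exp (-((v * l) ^ a / 2)) := by fun_prop (disch := exact ha.le)
  have hbd : ∀ v ∈ Set.Icc (0:ℝ) 1, w v * ∑ d ∈ Icc 1 ⌊y⌋₊ with log ((d:ℕ):ℝ) / l ≤ v, Λ d / d ≤
      (w v * v * l - w v * eulerMascheroniConstant) + (C * Q * R u) * exp (-((v * l) ^ a / 2)) := fun v hv => by
    have h0 := hv.1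
    have h1 : 0 ≤ w v := div_nonneg (h.pos _).le (by linarith [hv.2])
    have h2 := h.wv u v Q hv.1 (by linarith [hv.2]) hQ
    rw [hSv v hv]
    have h3 := mul_le_mul_of_nonneg_left (hrv v hv.1) h1
    have h4 : w v * (C * exp (-((v * l) ^ a))) ≤ (C * Q * R u) * exp (-((v * l) ^ a / 2)) := by
      calc w v * (C * exp (-((v * l) ^ a))) ≤ (Q * exp (Q * v) * R u) * (C * exp (-((v * l) ^ a))) := by gcongr
        _ = (C * Q * R u) * exp (Q * v - (v * l) ^ a) := by rw [sub_eq_add_neg, exp_add]; ring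
        _ ≤ _ := by
          gcongr
          have h5 : v * l ^ a ≤ (v * l) ^ a := by
            rw [mul_rpow h0 hl0.le]; gcongr
            rcases h0.eq_or_lt with h6 | h6
            · rw [← h6, zero_rpow ha.ne']
            · nth_rw 1 [← rpow_one v]; exact rpow_le_rpow_of_exponent_ge h6 hv.2 (by linarith)
          have h7 : Q ≤ l ^ a / 2 := by nlinarith
          nlinarith
    linarith
  have i1 : IntervalIntegrable (fun v => w v * v * l) volume 0 1 := by
    refine ContinuousOn.intervalIntegrable_of_Icc zero_le_one ?_
    fun_prop
  have i2 := (hwi 0 1 (by simp) (by simp)).mul_const eulerMascheroniConstant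
  have i3 : IntervalIntegrable (fun v => (C * Q * R u) * exp (-((v * l) ^ a / 2))) volume 0 1 := (hcE.intervalIntegrable _ _).const_mul _
  have hint := intervalIntegral.integral_mono_on zero_le_one hSi ((i1.sub i2).add i3) hbd
  rw [intervalIntegral.integral_add (i1.sub i2) i3, intervalIntegral.integral_sub i1 i2, intervalIntegral.integral_mul_const,
    intervalIntegral.integral_mul_const, intervalIntegral.integral_const_mul, hft 0 (by simp), sub_zero] at hint
  have hparts : ∫ v in (0:ℝ)..1, w v * v = R (u - 1) - u * R u := by
    have h1 : ∫ v in (0:ℝ)..1, (R (u - v) + w v * v) = 1 * R (u - 1) - 0 * R (u - 0) := by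
      refine intervalIntegral.integral_eq_sub_of_hasDerivAt (f := fun v => v * R (u - v)) (fun v hv => ?_) ?_
      · rw [Set.uIcc_of_le zero_le_one] at hv
        refine ((hasDerivAt_id v).mul (hφd v hv)).congr_deriv ?_
        simp [mul_comm]
      · refine ContinuousOn.intervalIntegrable_of_Icc zero_le_one ?_
        fun_prop
    rw [intervalIntegral.integral_add ((by fun_prop : Continuous fun v => R (u - v)).intervalIntegrable _ _)
      (ContinuousOn.intervalIntegrable_of_Icc zero_le_one (by fun_prop)), intervalIntegral.integral_comp_sub_left, sub_zero, ← h.mulR u (by linarith)] at h1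
    linarith
  rw [hparts] at hint
  have hE := ierr a l ha ha1 hl0
  have hry : -(C * exp (-(l ^ a))) ≤ rr y := neg_le_of_abs_le (hr y hy.le)
  have hR1 := h.Rv u 1 Q zero_le_one (by linarith) hQ
  have hla : 0 < l ^ a := rpow_pos_of_pos hl0 _
  have h8 : C * exp (-(l ^ a)) * R (u - 1) ≤ 2 * C * l ^ (-a) * R u := by
    calc C * exp (-(l ^ a)) * R (u - 1) ≤ C * exp (-(l ^ a)) * (exp (Q * 1) * R u) := by gcongr
      _ = C * exp (Q - l ^ a) * R u := by rw [sub_eq_add_neg, exp_add, mul_one]; ring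
      _ ≤ C * exp (-(l ^ a / 2)) * R u := by
        gcongr
        have h7 : Q ≤ l ^ a / 2 := by nlinarith
        linarith
      _ ≤ C * (2 / l ^ a) * R u := by gcongr; exact expz _ hla
      _ = _ := by rw [rpow_neg hl0.le]; ring
  have h9 : C * Q * R u * (5 * l ^ (-a)) + 2 * C * l ^ (-a) * R u ≤ R u * (1/100) := by
    rw [rpow_neg hl0.le, show C * Q * R u * (5 * (l ^ a)⁻¹) + 2 * C * (l ^ a)⁻¹ * R u = R u * ((C * (5 * Q + 2)) / l ^ a) by ring]
    refine mul_le_mul_of_nonneg_left ?_ hRu.le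
    rw [div_le_div_iff₀ hla (by norm_num)]; linarith
  have h10 : C * Q * R u * ∫ v in (0:ℝ)..1, exp (-((v * l) ^ a / 2)) ≤ C * Q * R u * (5 * l ^ (-a)) := by gcongr
  have h11 : -(C * exp (-(l ^ a))) * R (u - 1) ≤ rr y * R (u - 1) := by have := h.pos (u - 1); gcongr
  rw [hsum]
  linarith

end
end VK

namespace VK
section
open MeasureTheory
local notation "Λ" => ArithmeticFunction.vonMangoldt

open Classical in
noncomputable def Fr (x y : ℝ) : Finset ℕ := (Icc 1 ⌊x⌋₊).filter fun n => ∀ p : ℕ, p.Prime → p ∣ n → (p : ℝ) ≤ y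

lemma mem_Fr (x y : ℝ) (hx : 0 ≤ x) (n : ℕ) : n ∈ Fr x y ↔ 1 ≤ n ∧ (n : ℝ) ≤ x ∧ ∀ p : ℕ, p.Prime → p ∣ n → (p : ℝ) ≤ y := by
  simp [Fr, Nat.le_floor_iff hx, and_assoc]

lemma Psi_eq (x y : ℝ) (hx : 0 ≤ x) : Psi x y = (Fr x y).card := by
  unfold Psi
  rw [← Set.ncard_coe_finset]
  congr 1
  ext n
  simp [mem_Fr x y hx]

lemma Psi_union (x y : ℝ) (hx : 0 ≤ x) (hy : 0 ≤ y) :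
    (⌊x⌋₊ : ℝ) - ∑ n ∈ Ioc ⌊y⌋₊ ⌊x⌋₊, Λ n / log n * ((⌊x⌋₊ / n : ℕ) : ℝ) ≤ Psi x y := by
  classical
  rw [Psi_eq x y hx]
  set N := ⌊x⌋₊
  set P := (Ioc ⌊y⌋₊ N).filter Nat.Prime
  have h1 : Ioc 0 N ⊆ Fr x y ∪ P.biUnion fun p => (Ioc 0 N).filter fun m => p ∣ m := by
    intro n hn
    rw [mem_Ioc] at hn
    by_cases h : n ∈ Fr x y
    · exact Finset.mem_union_left _ h
    · refine Finset.mem_union_right _ ?_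
      simp only [Fr, mem_filter, mem_Icc, not_and, not_forall, not_le] at h
      obtain ⟨p, hp, hpn, hpy⟩ := h ⟨hn.1, hn.2⟩
      rw [Finset.mem_biUnion]
      refine ⟨p, ?_, ?_⟩
      · rw [mem_filter, mem_Ioc]
        exact ⟨⟨(Nat.floor_lt hy).2 hpy, (Nat.le_of_dvd hn.1 hpn).trans hn.2⟩, hp⟩
      · rw [mem_filter, mem_Ioc]; exact ⟨hn, hpn⟩
  have h2 := (card_le_card h1).trans ((Finset.card_union_le _ _).trans (Nat.add_le_add_left Finset.card_biUnion_le _))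
  simp only [Nat.Ioc_filter_dvd_card_eq_div, Nat.card_Ioc, Nat.sub_zero] at h2
  have h3 : (∑ p ∈ P, ((N / p : ℕ) : ℝ)) ≤ ∑ n ∈ Ioc ⌊y⌋₊ N, Λ n / log n * ((N / n : ℕ) : ℝ) := by
    rw [sum_filter]
    refine sum_le_sum fun n hn => ?_
    split_ifs with hp
    · rw [ArithmeticFunction.vonMangoldt_apply_prime hp, div_self, one_mul]
      exact (log_pos (by exact_mod_cast hp.one_lt)).ne'
    · have : 0 ≤ Λ n := ArithmeticFunction.vonMangoldt_nonneg
      have : 0 ≤ log (n:ℝ) := log_natCast_nonneg n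
      positivity
  have h4 : (N:ℝ) ≤ (Fr x y).card + ∑ p ∈ P, ((N / p : ℕ) : ℝ) := by exact_mod_cast h2
  linarith

lemma Adiff (a b : ℝ) (hab : a ≤ b) :
    ∑ n ∈ Ioc ⌊a⌋₊ ⌊b⌋₊, Λ n / n = rr b - rr a + log b - log a := by
  have h1 := Aeq a
  have h2 := Aeq b
  have e : ∀ N : ℕ, Icc 1 N = Ioc 0 N := fun N => by ext; simp [mem_Icc, mem_Ioc, Nat.succ_le_iff]
  rw [e] at h1 h2
  have h3 : Ioc 0 ⌊b⌋₊ = Ioc 0 ⌊a⌋₊ ∪ Ioc ⌊a⌋₊ ⌊b⌋₊ :=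
    (Ioc_union_Ioc_eq_Ioc (Nat.zero_le _) (Nat.floor_mono hab)).symm
  rw [h3, sum_union (by
    rw [disjoint_left]; intro n hn hn'
    rw [mem_Ioc] at hn hn'; omega)] at h2
  linarith

lemma sumW (x y η : ℝ) (hy : 1 < y) (hxy : y ≤ x) (hη : ∀ t, y ≤ t → |rr t| ≤ η) :
    ∑ n ∈ Ioc ⌊y⌋₊ ⌊x⌋₊, Λ n / n / log n ≤ log (log x / log y) + 2 * η / log y := by
  have hl0 : 0 < log y := log_pos hy
  have hy0 : 0 < y := by linarith
  have hx0 : 0 < x := by linarith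
  have hlx : log y ≤ log x := log_le_log hy0 hxy
  set l := log y with hldef
  set B := log x - l with hBdef
  set s := Ioc ⌊y⌋₊ ⌊x⌋₊ with hs
  have hB : 0 ≤ B := by linarith
  have hmem : ∀ n ∈ s, y < (n:ℝ) ∧ (n:ℝ) ≤ x := fun n hn => by
    rw [hs, mem_Ioc, Nat.floor_lt hy0.le, Nat.le_floor_iff hx0.le] at hn
    exact hn
  have hp : ∀ n ∈ s, 0 ≤ log (n:ℝ) - l ∧ log (n:ℝ) - l ≤ B := fun n hn => by
    have := hmem n hn
    have h1 := log_le_log hy0 this.1.le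
    have h2 := log_le_log (by linarith) this.2
    constructor <;> linarith
  have hne : ∀ v ∈ Set.Icc 0 B, 0 < l + v := fun v hv => by linarith [hv.1]
  set w : ℝ → ℝ := fun v => 1 / (l + v) ^ 2 with hw
  have hwc : ContinuousOn w (Set.Icc 0 B) := by
    refine ContinuousOn.div (by fun_prop) (by fun_prop) fun v hv => ?_
    have := hne v hv; positivity
  obtain ⟨hSi, hS⟩ := lcake s (fun d => Λ d / d) (fun d => log (d:ℝ) - l) w B hp hB hwc
  have hft : ∀ n ∈ s, ∫ v in (log (n:ℝ) - l)..B, w v = 1 / log n - 1 / log x := fun n hn => by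
    obtain ⟨p0, p1⟩ := hp n hn
    have h1 : ∫ v in (log (n:ℝ) - l)..B, w v = -(l + B)⁻¹ - -(l + (log (n:ℝ) - l))⁻¹ := by
      refine intervalIntegral.integral_eq_sub_of_hasDerivAt (f := fun v => -(l + v)⁻¹) (fun v hv => ?_) ?_
      · rw [Set.uIcc_of_le p1] at hv
        have h2 := hne v ⟨p0.trans hv.1, hv.2⟩
        have := (((hasDerivAt_id v).const_add l).inv h2.ne').neg
        refine this.congr_deriv ?_
        simp [hw, neg_div]
      · refine (hwc.mono ?_).intervalIntegrable_of_Icc p1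
        exact Set.Icc_subset_Icc_left p0
    rw [h1, hBdef]; simp [one_div]; ring
  have hSv : ∀ v ∈ Set.Icc 0 B, ∑ d ∈ s with log ((d:ℕ):ℝ) - l ≤ v, Λ d / d ≤ v + 2 * η := fun v hv => by
    have h1 := Adiff y (exp (l + v)) (by rw [exp_add, exp_log hy0]; nlinarith [one_le_exp hv.1])
    have h2 : s.filter (fun d => log ((d:ℕ):ℝ) - l ≤ v) = Ioc ⌊y⌋₊ ⌊exp (l + v)⌋₊ := by
      ext d
      simp only [hs, mem_filter, mem_Ioc, Nat.le_floor_iff hx0.le, Nat.floor_lt hy0.le, Nat.le_floor_iff (exp_pos (l + v)).le]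
      have key : y < d → (log (d:ℝ) - l ≤ v ↔ (d:ℝ) ≤ exp (l + v)) := fun hd => by
        rw [sub_le_iff_le_add', log_le_iff_le_exp (by linarith)]
      have key2 : exp (l + v) ≤ x := by
        rw [← le_log_iff_exp_le hx0]; linarith [hv.2]
      constructor
      · rintro ⟨⟨h1, h2⟩, h3⟩; exact ⟨h1, (key h1).1 h3⟩
      · rintro ⟨h1, h2⟩; exact ⟨⟨h1, h2.trans key2⟩, (key h1).2 h2⟩
    rw [h2, h1, log_exp]
    have h3 := abs_le.1 (hη y le_rfl)
    have h4 := abs_le.1 (hη (exp (l + v)) (by rw [exp_add, exp_log hy0]; nlinarith [one_le_exp hv.1]))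
    linarith
  have e1 : ∑ n ∈ s, Λ n / n / log n = (∑ n ∈ s, Λ n / n) / log x + ∫ v in (0:ℝ)..B, w v * ∑ n ∈ s with log ((n:ℕ):ℝ) - l ≤ v, Λ n / n := by
    rw [← hS, Finset.sum_div, ← sum_add_distrib]
    refine sum_congr rfl fun n hn => ?_
    rw [hft n hn]; ring
  have ic : ContinuousOn (fun v => w v * (v + 2 * η)) (Set.Icc 0 B) := by fun_prop
  have ii := ic.intervalIntegrable_of_Icc (μ := volume) hB
  have hint := intervalIntegral.integral_mono_on hB hSi ii fun v hv =>
    mul_le_mul_of_nonneg_left (hSv v hv) (by have := hne v hv; positivity)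
  have e2 : ∫ v in (0:ℝ)..B, w v * (v + 2 * η) = (log (l + B) - (B + 2 * η) / (l + B)) - (log (l + 0) - (0 + 2 * η) / (l + 0)) := by
    refine intervalIntegral.integral_eq_sub_of_hasDerivAt (f := fun v => log (l + v) - (v + 2 * η) / (l + v)) (fun v hv => ?_) ii
    rw [Set.uIcc_of_le hB] at hv
    have h2 := hne v hv
    have hd := (hasDerivAt_id v).const_add l
    have := (hd.log h2.ne').sub (((hasDerivAt_id v).add_const (2 * η)).div hd h2.ne')
    refine this.congr_deriv ?_
    simp only [hw, id]
    field_simp; ring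
  have h5 := hSv B ⟨hB, le_rfl⟩
  rw [Finset.filter_true_of_mem fun n hn => (hp n hn).2] at h5
  have hlx0 : 0 < log x := by linarith
  have h6 : (∑ n ∈ s, Λ n / n) / log x ≤ (B + 2 * η) / log x := by gcongr
  rw [e2, show l + B = log x by rw [hBdef]; ring, add_zero, zero_add] at hint
  rw [e1, log_div hlx0.ne' hl0.ne']
  linarith

lemma base0 (x y η : ℝ) (hy : 1 < y) (hxy : y ≤ x) (hη : ∀ t, y ≤ t → |rr t| ≤ η) :
    x * (1 - log (log x / log y)) - 1 - 2 * η * x / log y ≤ Psi x y := by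
  have hx0 : 0 < x := by linarith
  have h1 := Psi_union x y hx0.le (by linarith)
  have h2 := sumW x y η hy hxy hη
  have h3 : ∑ n ∈ Ioc ⌊y⌋₊ ⌊x⌋₊, Λ n / log n * ((⌊x⌋₊ / n : ℕ) : ℝ) ≤ x * ∑ n ∈ Ioc ⌊y⌋₊ ⌊x⌋₊, Λ n / n / log n := by
    rw [mul_sum]
    refine sum_le_sum fun n _ => ?_
    have : 0 ≤ Λ n := ArithmeticFunction.vonMangoldt_nonneg
    have : 0 ≤ log (n:ℝ) := log_natCast_nonneg n
    have h4 : ((⌊x⌋₊ / n : ℕ) : ℝ) ≤ x / n := (Nat.cast_div_le).trans (by gcongr; exact Nat.floor_le hx0.le)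
    calc _ ≤ Λ n / log n * (x / n) := by gcongr
      _ = _ := by ring
  have h5 := Nat.sub_one_lt_floor x
  have h6 := mul_le_mul_of_nonneg_left h2 hx0.le
  have : x * (log (log x / log y) + 2 * η / log y) = x * log (log x / log y) + 2 * η * x / log y := by ring
  linarith

lemma base1_alg (x l y ε η : ℝ) (hl : 0 < l) (hε : 0 < ε) (hyx : y ≤ x) (hη1 : η ≤ ε ^ 2 / 96) (hyl : 48 * l ≤ ε ^ 2 * y) (hx0 : 0 < x) :
    1 + x * (2 * η / l) ≤ ε / 2 * (2 / 3 * x / (2 * l) * (ε / 4)) := by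
  have h9 : x * (2 * η / l) ≤ x * (2 * (ε ^ 2 / 96) / l) := by gcongr
  have h10 : 1 ≤ ε ^ 2 * x / (48 * l) := by
    rw [one_le_div (by positivity)]; nlinarith [sq_nonneg ε]
  have e1 : x * (2 * (ε ^ 2 / 96) / l) = ε ^ 2 * x / (48 * l) := by field_simp; ring
  have e2 : ε / 2 * (2 / 3 * x / (2 * l) * (ε / 4)) = 2 * (ε ^ 2 * x / (48 * l)) := by field_simp; ring
  linarith

set_option maxHeartbeats 800000 in
lemma base1 (x y η ε : ℝ) (hε : 0 < ε) (hε1 : ε ≤ 1/3) (hy : 1 < y) (hxy : y ≤ (1 - ε) * x) (hη : ∀ t, y ≤ t → |rr t| ≤ η)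
    (hη1 : η ≤ ε ^ 2 / 96) (hyl : 48 * log y ≤ ε ^ 2 * y) (hx2 : log x ≤ 2 * log y) :
    x * (1 - log (log x / log y)) ≤ Psi x y := by
  have hl0 : 0 < log y := log_pos hy
  have hx0 : 0 < x := by
    by_contra hc
    nlinarith
  have hyx : y ≤ x := by nlinarith
  have hlx0 : 0 < log x := log_pos (by linarith)
  have h1 := Psi_union x y hx0.le (by linarith)
  have h2 := sumW x y η hy hyx hη
  set s := Ioc ⌊y⌋₊ ⌊x⌋₊ with hs
  set s' := Ioc ⌊(1 - ε) * x⌋₊ ⌊(1 - ε/2) * x⌋₊ with hs'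
  have hss : s' ⊆ s := by
    refine Finset.Ioc_subset_Ioc (Nat.floor_mono hxy) (Nat.floor_mono (by nlinarith))
  have hmem : ∀ n ∈ s', (1 - ε) * x < (n:ℝ) ∧ (n:ℝ) ≤ (1 - ε/2) * x := fun n hn => by
    rw [hs', mem_Ioc, Nat.floor_lt (by linarith), Nat.le_floor_iff (by nlinarith)] at hn
    exact hn
  have h3 : ∑ n ∈ s, Λ n / log n * ((⌊x⌋₊ / n : ℕ) : ℝ) ≤ x * ∑ n ∈ s, Λ n / n / log n - ε / 2 * ∑ n ∈ s', Λ n / log n := by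
    have e0 : ∑ n ∈ s', Λ n / log n = ∑ n ∈ s, if n ∈ s' then Λ n / log n else 0 := by
      rw [← sum_filter, Finset.filter_mem_eq_inter, Finset.inter_eq_right.2 hss]
    rw [e0]
    rw [mul_sum, mul_sum, ← sum_sub_distrib]
    refine sum_le_sum fun n _ => ?_
    have : 0 ≤ Λ n := ArithmeticFunction.vonMangoldt_nonneg
    have : 0 ≤ log (n:ℝ) := log_natCast_nonneg n
    have h4 : ((⌊x⌋₊ / n : ℕ) : ℝ) ≤ x / n := (Nat.cast_div_le).trans (by gcongr; exact Nat.floor_le hx0.le)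
    split_ifs with hn
    · obtain ⟨m1, m2⟩ := hmem n hn
      have hn0 : (0:ℝ) < n := by linarith
      have h5 : ((⌊x⌋₊ / n : ℕ) : ℝ) ≤ x / n - ε / 2 := by
        have h6 : (⌊x⌋₊ / n : ℕ) < 2 := by
          have : ((⌊x⌋₊ / n : ℕ) : ℝ) < 2 := lt_of_le_of_lt h4 (by rw [div_lt_iff₀ hn0]; nlinarith)
          exact_mod_cast this
        have h7 : ((⌊x⌋₊ / n : ℕ) : ℝ) ≤ 1 := by exact_mod_cast Nat.lt_succ_iff.1 h6
        have h8 : 1 + ε / 2 ≤ x / n := by rw [le_div_iff₀ hn0]; nlinarith [mul_pos hε hε, mul_pos (mul_pos hε hε) hx0]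
        linarith
      calc _ ≤ Λ n / log n * (x / n - ε / 2) := by gcongr
        _ = _ := by ring
    · calc _ ≤ Λ n / log n * (x / n) := by gcongr
        _ = _ := by ring
  have h4 : 2 / 3 * x / log x * (ε / 4) ≤ ∑ n ∈ s', Λ n / log n := by
    have h5 := Adiff ((1 - ε) * x) ((1 - ε/2) * x) (by nlinarith)
    have h6 := abs_le.1 (hη ((1 - ε) * x) hxy)
    have h7 := abs_le.1 (hη ((1 - ε/2) * x) (by nlinarith))
    have h8 : ε / 2 ≤ log ((1 - ε/2) * x) - log ((1 - ε) * x) := by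
      rw [← log_div (by nlinarith) (by nlinarith), mul_div_mul_right _ _ hx0.ne']
      have h9 := one_sub_inv_le_log_of_pos (x := (1 - ε/2) / (1 - ε)) (div_pos (by linarith) (by linarith))
      refine le_trans ?_ h9
      rw [inv_div, le_sub_comm, div_le_iff₀ (by linarith)]
      nlinarith
    have h9 : ε / 4 ≤ ∑ n ∈ s', Λ n / n := by
      rw [h5]
      have : η ≤ ε / 16 := by nlinarith
      linarith
    calc 2 / 3 * x / log x * (ε / 4) ≤ 2 / 3 * x / log x * ∑ n ∈ s', Λ n / n := by gcongr
      _ = ∑ n ∈ s', 2 / 3 * x / log x * (Λ n / n) := mul_sum _ _ _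
      _ ≤ _ := by
        refine sum_le_sum fun n hn => ?_
        obtain ⟨m1, m2⟩ := hmem n hn
        have : 0 ≤ Λ n := ArithmeticFunction.vonMangoldt_nonneg
        have hn0 : (0:ℝ) < n := by linarith
        have hn1 : (1:ℝ) < n := by linarith
        have := log_pos hn1
        have h10 : log (n:ℝ) ≤ log x := log_le_log hn0 (by nlinarith)
        calc 2 / 3 * x / log x * (Λ n / n) = (2 / 3 * x / n) * (Λ n / log x) := by ring
          _ ≤ 1 * (Λ n / log n) := by
            gcongr
            rw [div_le_one hn0]; nlinarith
          _ = _ := one_mul _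
  have h5 := Nat.sub_one_lt_floor x
  have h6 := mul_le_mul_of_nonneg_left h2 hx0.le
  have h7 : 2 / 3 * x / (2 * log y) * (ε / 4) ≤ 2 / 3 * x / log x * (ε / 4) := by gcongr
  have h8 := base1_alg x (log y) y ε η hl0 hε hyx hη1 hyl hx0
  have h11 := mul_le_mul_of_nonneg_left (h7.trans h4) (by linarith : 0 ≤ ε / 2)
  linarith [mul_add x (log (log x / log y)) (2 * η / log y)]

lemma Dick.R12 {R : ℝ → ℝ} (h : Dick R) (t : ℝ) (h1 : 1 ≤ t) (h2 : t ≤ 2) : R t = 1 - log t := by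
  rw [h.eq t h1]
  congr 1
  rw [intervalIntegral.integral_congr (g := fun v => 1 / v) fun v hv => ?_, integral_one_div_of_pos one_pos (by linarith), div_one]
  rw [Set.uIcc_of_le h1] at hv
  simp only
  rw [h.one (v - 1) (by linarith [hv.2])]

end
end VK

namespace VK
section
local notation "Λ" => ArithmeticFunction.vonMangoldt

lemma Fr_dvd (x y : ℝ) (hx : 0 ≤ x) (d : ℕ) (hd : 1 ≤ d) (hdy : (d:ℝ) ≤ y) :
    Psi (x / d) y ≤ ((Fr x y).filter fun n => d ∣ n).card := by
  have hd0 : (0:ℝ) < d := by exact_mod_cast hd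
  rw [Psi_eq _ _ (by positivity)]
  refine card_le_card_of_injOn (fun m => d * m) (fun m hm => ?_) (fun a _ b _ hab => Nat.eq_of_mul_eq_mul_left hd hab)
  have hm' := (mem_Fr _ _ (by positivity) m).1 hm
  obtain ⟨h1, h2, h3⟩ := hm'
  rw [Finset.mem_coe, mem_filter, mem_Fr _ _ hx]
  refine ⟨⟨Nat.mul_pos hd h1, ?_, fun p hp hpd => ?_⟩, Dvd.intro _ rfl⟩
  · rw [le_div_iff₀ hd0] at h2; push_cast; linarith
  · rcases hp.dvd_mul.1 hpd with h | h
    · exact le_trans (by exact_mod_cast Nat.le_of_dvd hd h) hdy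
    · exact h3 p hp h

lemma logx_n (x n : ℝ) (hn : 0 < n) (hnx : n ≤ x) (J : ℕ) :
    (1/11 : ℝ) * ∑ j ∈ Icc 1 J, (if n ≤ x * (10/11) ^ j then (1:ℝ) else 0) ≤ log x - log n := by
  induction J with
  | zero => simp; exact log_le_log hn hnx
  | succ J ih =>
    by_cases h : n ≤ x * (10/11) ^ (J+1)
    · have h1 : ∑ j ∈ Icc 1 (J+1), (if n ≤ x * (10/11) ^ j then (1:ℝ) else 0) ≤ (J+1 : ℕ) := by
        calc _ ≤ ∑ j ∈ Icc 1 (J+1), (1:ℝ) := sum_le_sum fun j _ => by split_ifs <;> norm_num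
          _ = _ := by simp
      have h2 := log_le_log hn h
      rw [log_mul (by linarith) (by positivity), log_pow] at h2
      have h3 : log (10/11 : ℝ) ≤ 10/11 - 1 := log_le_sub_one_of_pos (by norm_num)
      have h4 : ((J+1:ℕ):ℝ) * log (10/11) ≤ ((J+1:ℕ):ℝ) * (10/11 - 1) := by gcongr
      linarith
    · rw [sum_Icc_succ_top (by omega), if_neg h, add_zero]; exact ih

lemma Psi_rec (x y : ℝ) (hx : 1 ≤ x) (hy : 0 ≤ y) :
    (1/11 : ℝ) * ∑ j ∈ Icc 1 20, (Psi (x * (10/11) ^ j) y : ℝ) + ∑ d ∈ Icc 1 ⌊y⌋₊, Λ d * (Psi (x / d) y : ℝ) ≤ Psi x y * log x := by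
  have hx0 : 0 ≤ x := by linarith
  have e1 : (Psi x y : ℝ) * log x = ∑ n ∈ Fr x y, (log x - log n) + ∑ n ∈ Fr x y, log n := by
    rw [← sum_add_distrib, Psi_eq x y hx0]; simp
  rw [e1]
  refine add_le_add ?_ ?_
  · have h1 : ∀ j, (Psi (x * (10/11) ^ j) y : ℝ) = ∑ n ∈ Fr x y, (if (n:ℝ) ≤ x * (10/11) ^ j then (1:ℝ) else 0) := fun j => by
      rw [Psi_eq _ _ (by positivity), Finset.sum_boole]
      congr 2
      ext n
      rw [mem_filter, mem_Fr _ _ (by positivity), mem_Fr _ _ hx0]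
      have : x * (10/11 : ℝ) ^ j ≤ x := mul_le_of_le_one_right hx0 (pow_le_one₀ (by norm_num) (by norm_num))
      constructor
      · rintro ⟨a, b, c⟩; exact ⟨⟨a, b.trans this, c⟩, b⟩
      · rintro ⟨⟨a, b, c⟩, d⟩; exact ⟨a, d, c⟩
    simp_rw [h1]
    rw [sum_comm, mul_sum]
    refine sum_le_sum fun n hn => ?_
    rw [mem_Fr _ _ hx0] at hn
    exact logx_n x n (by exact_mod_cast hn.1) hn.2.1 20
  · have h1 : ∑ n ∈ Fr x y, log (n:ℝ) ≥ ∑ n ∈ Fr x y, ∑ d ∈ Icc 1 ⌊y⌋₊, if d ∣ n then Λ d else 0 := by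
      refine sum_le_sum fun n hn => ?_
      rw [mem_Fr _ _ hx0] at hn
      rw [← ArithmeticFunction.vonMangoldt_sum, ← sum_filter]
      refine sum_le_sum_of_subset_of_nonneg (fun d hd => ?_) fun d _ _ => ArithmeticFunction.vonMangoldt_nonneg
      rw [mem_filter] at hd
      exact Nat.mem_divisors.2 ⟨hd.2, by omega⟩
    refine le_trans ?_ h1
    rw [sum_comm]
    refine sum_le_sum fun d hd => ?_
    rw [mem_Icc, Nat.le_floor_iff hy] at hd
    rw [← sum_filter, sum_const, nsmul_eq_mul, mul_comm]
    exact mul_le_mul_of_nonneg_right (by exact_mod_cast Fr_dvd x y hx0 d hd.1 hd.2) ArithmeticFunction.vonMangoldt_nonneg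

/-- The inductive step. -/
lemma step {R : ℝ → ℝ} (h : Dick R) (C a : ℝ) (ha : 0 < a) (ha1 : a ≤ 3/5) (hC : 1 ≤ C)
    (hr : ∀ t, 1 ≤ t → |rr t| ≤ C * exp (-(log t ^ a))) (x y Q θ : ℝ) (hy : 7 ≤ y) (hxy : y ^ 2 < x)
    (hQ : 2 * log (2 * (log x / log y + 1)) ≤ Q) (hl : 100 * (C * (5 * Q + 2)) ≤ log y ^ a)
    (hθ : 0 ≤ θ) (hθ1 : θ ≤ 1) (hθx : θ * (log x + 1) ≤ 1/20)
    (ih : ∀ z, x / y ≤ z → z ≤ x * (10/11) → (1 - θ) * (z * R (log z / log y)) ≤ Psi z y) :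
    x * R (log x / log y) ≤ Psi x y := by
  have hl0 : 0 < log y := log_pos (by linarith)
  have hx1 : 1 ≤ x := by nlinarith
  have hx0 : 0 < x := by linarith
  have hu : 2 < log x / log y := by
    rw [lt_div_iff₀ hl0]
    have := log_lt_log (by positivity) hxy
    rwa [log_pow] at this
  have hlx : 0 < log x := log_pos (by nlinarith)
  have h1 := Psi_rec x y hx1 (by linarith)
  set u := log x / log y with hudef
  have hul : u * log y = log x := div_mul_cancel₀ _ hl0.ne'
  have h2 := main_sum h C a ha ha1 hC hr y u Q (by linarith) hu hQ hl
  rw [hul] at h2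
  have hRu := h.pos u
  have h3 : (1 - θ) * (x * (R u * (log x - eulerMascheroniConstant - 1/100))) ≤ ∑ d ∈ Icc 1 ⌊y⌋₊, Λ d * (Psi (x / d) y : ℝ) := by
    refine (mul_le_mul_of_nonneg_left (mul_le_mul_of_nonneg_left h2 hx0.le) (by linarith)).trans ?_
    rw [mul_sum, mul_sum]
    refine sum_le_sum fun d hd => ?_
    rw [mem_Icc, Nat.le_floor_iff (by linarith)] at hd
    obtain ⟨d1, d2⟩ := hd
    rcases d1.eq_or_lt with rfl | d3
    · simp
    · have hd2 : (2:ℝ) ≤ d := by exact_mod_cast d3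
      have hd0 : (0:ℝ) < d := by linarith
      have h4 := ih (x / d) (by gcongr) (by rw [div_le_iff₀ hd0]; nlinarith)
      rw [log_div hx0.ne' hd0.ne', sub_div] at h4
      have h5 : 0 ≤ Λ d := ArithmeticFunction.vonMangoldt_nonneg
      calc _ = Λ d * ((1 - θ) * (x / d * R (u - log d / log y))) := by ring
        _ ≤ _ := by gcongr
  have h4 : (1 - θ) * (x * (R u * (77/100))) ≤ (1/11 : ℝ) * ∑ j ∈ Icc 1 20, (Psi (x * (10/11) ^ j) y : ℝ) := by
    have h5 : ∀ j ∈ Icc 1 20, (1 - θ) * (x * R u) * (10/11) ^ j ≤ (Psi (x * (10/11) ^ j) y : ℝ) := fun j hj => by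
      rw [mem_Icc] at hj
      have p1 : (10/11 : ℝ) ^ j ≤ (10/11) ^ 1 := pow_le_pow_of_le_one (by norm_num) (by norm_num) hj.1
      have p2 : (10/11 : ℝ) ^ 20 ≤ (10/11) ^ j := pow_le_pow_of_le_one (by norm_num) (by norm_num) hj.2
      have p3 : (1/7 : ℝ) ≤ (10/11) ^ 20 := by norm_num
      have p4 : (0:ℝ) < (10/11) ^ j := by positivity
      have h6 := ih (x * (10/11) ^ j) (by
        rw [div_eq_mul_inv]; gcongr
        calc y⁻¹ ≤ 7⁻¹ := by gcongr
          _ ≤ _ := by linarith) (by gcongr; simpa using p1)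
      have h7 : R u ≤ R (log (x * (10/11) ^ j) / log y) := by
        apply h.anti
        rw [hudef]; gcongr
        exact mul_le_of_le_one_right hx0.le (by linarith)
      refine le_trans ?_ h6
      have : 0 ≤ 1 - θ := by linarith
      calc (1 - θ) * (x * R u) * (10/11) ^ j = (1 - θ) * (x * (10/11) ^ j * R u) := by ring
        _ ≤ _ := by gcongr
    have h6 := sum_le_sum h5
    rw [← mul_sum] at h6
    have h7 : (77/100 : ℝ) ≤ 1/11 * ∑ j ∈ Icc 1 20, (10/11 : ℝ) ^ j := by
      simp only [sum_Icc_succ_top, sum_Icc_succ_top, Nat.reduceLeDiff, Finset.Icc_self, Finset.sum_singleton]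
      norm_num [sum_Icc_succ_top]
    have h8 : 0 ≤ (1 - θ) * (x * R u) := mul_nonneg (by linarith) (by positivity)
    calc _ = (1 - θ) * (x * R u) * (77/100) := by ring
      _ ≤ (1 - θ) * (x * R u) * (1/11 * ∑ j ∈ Icc 1 20, (10/11 : ℝ) ^ j) := by gcongr
      _ = 1/11 * ((1 - θ) * (x * R u) * ∑ j ∈ Icc 1 20, (10/11 : ℝ) ^ j) := by ring
      _ ≤ _ := by gcongr
  have hg := Real.eulerMascheroniConstant_lt_two_thirds
  have h9 : x * R u * log x ≤ Psi x y * log x := by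
    have h10 : x * R u * log x ≤ x * R u * ((1 - θ) * (log x - eulerMascheroniConstant - 1/100 + 77/100)) := by
      gcongr
      nlinarith
    nlinarith
  exact le_of_mul_le_mul_right h9 hlx

lemma fr_aux (y z ε : ℝ) (hy : 7 ≤ y) (hz : y ^ 2 ≤ z) (hε : ε ≤ 1/3) : y ≤ (1 - ε) * z := by
  have : 7 * y ≤ z := by nlinarith
  nlinarith

set_option maxHeartbeats 400000 in
lemma friable {R : ℝ → ℝ} (h : Dick R) (C a : ℝ) (ha : 0 < a) (ha1 : a ≤ 3/5) (hC : 1 ≤ C)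
    (hr : ∀ t, 1 ≤ t → |rr t| ≤ C * exp (-(log t ^ a))) (y Q U η ε : ℝ) (hy : 7 ≤ y)
    (hQ : 2 * log (2 * (U + 1)) ≤ Q) (hl : 100 * (C * (5 * Q + 2)) ≤ log y ^ a)
    (hε : 0 < ε) (hε1 : ε ≤ 1/3) (hη : ∀ t, y ≤ t → |rr t| ≤ η) (hη1 : η ≤ ε ^ 2 / 96) (hη2 : η ≤ 1/2000)
    (hyl : 48 * log y ≤ ε ^ 2 * y) (hyl2 : 2000 * log y ≤ y) (N : ℕ) :
    ∀ x, y ≤ (1 - ε) * x → log x ≤ U * log y → x < y ^ 2 * (11/10) ^ N → x * R (log x / log y) ≤ Psi x y := by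
  have hy0 : 0 < y := by linarith
  have hl1 : 1 ≤ log y := by
    rw [le_log_iff_exp_le hy0]; linarith [exp_one_lt_d9]
  have hl0 : 0 < log y := by linarith
  have hη0 : 0 ≤ η := (abs_nonneg _).trans (hη y le_rfl)
  have low : ∀ x, y ≤ (1 - ε) * x → x ≤ y ^ 2 → x * R (log x / log y) ≤ Psi x y := fun x hx1 hx2 => by
    have hx0 : 0 < x := by by_contra hc; nlinarith
    have hyx : y ≤ x := by nlinarith
    have h1 : log x ≤ 2 * log y := by
      have := log_le_log hx0 hx2; rwa [log_pow] at this
    rw [h.R12 _ ((one_le_div hl0).2 (log_le_log hy0 hyx)) ((div_le_iff₀ hl0).2 h1)]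
    exact base1 x y η ε hε hε1 (by linarith) hx1 hη hη1 hyl h1
  set θ := 4 * (1 / y + 2 * η / log y) with hθ
  have hθ0 : 0 ≤ θ := by positivity
  have hθl : θ * log y ≤ 1/160 := by
    have e : θ * log y = 4 * (log y / y + 2 * η) := by rw [hθ]; field_simp
    have : log y / y ≤ 1/2000 := by rw [div_le_iff₀ hy0]; linarith
    rw [e]; linarith
  have low2 : ∀ x, y ≤ x → x ≤ y ^ 2 → (1 - θ) * (x * R (log x / log y)) ≤ Psi x y := fun x hx1 hx2 => by
    have hx0 : 0 < x := by linarith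
    have h1 : log x ≤ 2 * log y := by
      have := log_le_log hx0 hx2; rwa [log_pow] at this
    have hu2 : log x / log y ≤ 2 := (div_le_iff₀ hl0).2 h1
    have hu1 : 1 ≤ log x / log y := (one_le_div hl0).2 (log_le_log hy0 hx1)
    rw [h.R12 _ hu1 hu2]
    have h2 := base0 x y η (by linarith) hx1 hη
    have h3 : log (log x / log y) ≤ 3/4 := by
      have := log_le_log (by linarith) hu2
      linarith [log_two_lt_d9]
    have h4 : 1 + 2 * η * x / log y ≤ θ * (x * (1/4)) := by
      have : 1 ≤ x / y := (one_le_div hy0).2 hx1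
      have e : θ * (x * (1/4)) = x / y + 2 * η * x / log y := by rw [hθ]; ring
      linarith
    have h5 : θ * (x * (1/4)) ≤ θ * (x * (1 - log (log x / log y))) := by gcongr; linarith
    linarith
  induction N with
  | zero =>
    intro x hx1 _ hx3
    exact low x hx1 (by simpa using hx3.le)
  | succ N ih =>
    intro x hx1 hx2 hx3
    rcases le_or_gt x (y ^ 2) with hx | hx
    · exact low x hx1 hx
    have hx0 : 0 < x := lt_trans (by positivity) hx
    have hQx : 2 * log (2 * (log x / log y + 1)) ≤ Q := by
      refine le_trans ?_ hQ
      have : log x / log y ≤ U := (div_le_iff₀ hl0).2 hx2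
      have h1x : 0 < log x := log_pos (by nlinarith)
      gcongr
    have hdown : ∀ z, 0 < z → z ≤ x * (10/11) → log z ≤ U * log y ∧ z < y ^ 2 * (11/10) ^ N := fun z hz0 hz => by
      refine ⟨(log_le_log hz0 (by linarith)).trans hx2, ?_⟩
      rw [pow_succ (11/10 : ℝ) N] at hx3; linarith
    rcases le_or_gt x (y ^ 3) with hx' | hx'
    · refine step h C a ha ha1 hC hr x y Q θ hy hx hQx hl hθ0 ?_ ?_ fun z hz1 hz2 => ?_
      · nlinarith
      · have := log_le_log hx0 hx'
        rw [log_pow] at this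
        have h2 : log x + 1 ≤ 4 * log y := by push_cast at this; linarith
        have := mul_le_mul_of_nonneg_left h2 hθ0
        linarith
      · have hyz : y ≤ z := by
          refine le_trans ?_ hz1
          rw [le_div_iff₀ hy0]; nlinarith
        have hz0 : 0 < z := by linarith
        rcases le_or_gt z (y ^ 2) with h1 | h1
        · exact low2 z hyz h1
        · obtain ⟨d1, d2⟩ := hdown z hz0 hz2
          have := ih z (fr_aux y z ε hy h1.le hε1) d1 d2
          refine le_trans ?_ this
          have := h.pos (log z / log y)
          have : 0 ≤ z * R (log z / log y) := by positivity
          exact mul_le_of_le_one_left this (by linarith)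
    · refine step h C a ha ha1 hC hr x y Q 0 hy hx hQx hl le_rfl zero_le_one (by norm_num) fun z hz1 hz2 => ?_
      have hyz : y ^ 2 ≤ z := by
        refine le_trans ?_ hz1
        rw [le_div_iff₀ hy0]; nlinarith
      have hz0 : 0 < z := lt_of_lt_of_le (by positivity) hyz
      obtain ⟨d1, d2⟩ := hdown z hz0 hz2
      rw [sub_zero, one_mul]
      exact ih z (fr_aux y z ε hy hyz hε1) d1 d2

end
end VK

namespace VK

lemma dick_of (ρ : ℝ → ℝ) (h1 : ContinuousOn ρ (Set.Ici 0)) (h2 : ∀ t ∈ Set.Icc (0 : ℝ) 1, ρ t = 1)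
    (h3 : ∀ t ≥ (1 : ℝ), ρ t = 1 - ∫ v in (1 : ℝ)..t, ρ (v - 1) / v) : Dick (fun t => ρ (max t 0)) := by
  refine ⟨h1.comp_continuous (by fun_prop) fun t => Set.mem_Ici.2 (le_max_right _ _), fun t ht => h2 _ ⟨le_max_right _ _, max_le ht zero_le_one⟩, fun t ht => ?_⟩
  rw [max_eq_left (by linarith), h3 t ht]
  congr 1
  refine intervalIntegral.integral_congr fun v hv => ?_
  rw [Set.uIcc_of_le ht] at hv
  have e : max (v - 1) 0 = v - 1 := max_eq_left (by linarith [hv.1])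
  simp only [e]

lemma ev_lin (A B k : ℝ) (hk : 1 < k) : ∀ᶠ t : ℝ in atTop, A * t + B ≤ t ^ k := by
  have h1 : ∀ᶠ t : ℝ in atTop, |A| + |B| ≤ t ^ (k - 1) := (tendsto_rpow_atTop (by linarith)).eventually_ge_atTop _
  filter_upwards [h1, eventually_ge_atTop 1] with t h1 h2
  have h3 : t ^ k = t * t ^ (k - 1) := by
    rw [rpow_sub_one (by linarith)]; field_simp
  rw [h3]
  have := mul_le_mul_of_nonneg_left h1 (by linarith : 0 ≤ t)
  nlinarith [le_abs_self A, le_abs_self B, abs_nonneg B]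

lemma ev_log (c : ℝ) (hc : 0 < c) : ∀ᶠ y : ℝ in atTop, log y ≤ c * y := by
  have h := isLittleO_log_id_atTop.bound hc
  filter_upwards [h, eventually_ge_atTop 1] with y h1 h2
  simp only [id, norm_eq_abs] at h1
  rwa [abs_of_nonneg (log_nonneg h2), abs_of_nonneg (by linarith)] at h1

lemma ev_eta (C a c : ℝ) (ha : 0 < a) (hc : 0 < c) : ∀ᶠ y : ℝ in atTop, C * exp (-(log y ^ a)) ≤ c := by
  have h : Tendsto (fun y : ℝ => C * exp (-(log y ^ a))) atTop (nhds (C * 0)) :=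
    (tendsto_exp_neg_atTop_nhds_zero.comp ((tendsto_rpow_atTop ha).comp tendsto_log_atTop)).const_mul C
  rw [mul_zero] at h
  filter_upwards [h.eventually_lt_const hc] with y hy using hy.le

lemma main_thm {R : ℝ → ℝ} (h : Dick R) (ε : ℝ) (hε0 : 0 < ε) (hε1 : ε < 1) :
    ∃ x₀ : ℝ, ∀ x ≥ x₀, ∀ y : ℝ, exp ((log (log x)) ^ ((5 : ℝ) / 3 + ε)) ≤ y → y ≤ (1 - ε) * x →
      x * R (log x / log y) ≤ (Psi x y : ℝ) := by
  obtain ⟨C, hC, hr⟩ := r_bd (ε / 10) (by linarith) (by linarith)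
  set a := 3/5 - ε/10 with hadef
  have ha : 0 < a := by linarith
  set β := (5:ℝ)/3 + ε with hβ
  set e := min ε (1/3) with he
  have he0 : 0 < e := lt_min hε0 (by norm_num)
  have hk : 1 < β * a := by rw [hβ, hadef]; nlinarith
  have E : ∀ᶠ y : ℝ in atTop, 7 ≤ y ∧ C * exp (-(log y ^ a)) ≤ e ^ 2 / 96 ∧ C * exp (-(log y ^ a)) ≤ 1/2000 ∧
      log y ≤ (e ^ 2 / 48) * y ∧ log y ≤ (1/2000) * y := by
    filter_upwards [eventually_ge_atTop 7, ev_eta C a (e ^ 2 / 96) ha (by positivity), ev_eta C a (1/2000) ha (by norm_num),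
      ev_log (e ^ 2 / 48) (by positivity), ev_log (1/2000) (by norm_num)] with y h1 h2 h3 h4 h5 using ⟨h1, h2, h3, h4, h5⟩
  obtain ⟨y0, hy0⟩ := eventually_atTop.1 E
  have hLL : Tendsto (fun x : ℝ => log (log x)) atTop atTop := tendsto_log_atTop.comp tendsto_log_atTop
  have hY : Tendsto (fun x : ℝ => exp ((log (log x)) ^ β)) atTop atTop :=
    tendsto_exp_atTop.comp ((tendsto_rpow_atTop (by positivity)).comp hLL)
  have X : ∀ᶠ x : ℝ in atTop, 1 ≤ x ∧ 1 ≤ log x ∧ 1 ≤ log (log x) ∧ y0 ≤ exp ((log (log x)) ^ β) ∧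
      (1000 * C) * log (log x) + 100 * C * (10 * log 4 + 2) ≤ (log (log x)) ^ (β * a) := by
    filter_upwards [eventually_ge_atTop 1, tendsto_log_atTop.eventually_ge_atTop 1, hLL.eventually_ge_atTop 1, hY.eventually_ge_atTop y0,
      hLL.eventually (ev_lin (1000 * C) (100 * C * (10 * log 4 + 2)) (β * a) hk)] with x h1 h2 h3 h4 h5 using ⟨h1, h2, h3, h4, h5⟩
  obtain ⟨x0, hx0⟩ := eventually_atTop.1 X
  refine ⟨x0, fun x hx y hy1 hy2 => ?_⟩
  obtain ⟨x1, x2, x3, x4, x5⟩ := hx0 x hx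
  obtain ⟨y1, y2, y3, y4, y5⟩ := hy0 y (x4.trans hy1)
  have hyp : 0 < y := by linarith
  have hl : (log (log x)) ^ β ≤ log y := (le_log_iff_exp_le hyp).2 hy1
  have hl1 : 1 ≤ log y := (one_le_rpow x3 (by positivity)).trans hl
  have hU1 : log x / log y ≤ log x := div_le_self (by linarith) hl1
  have hU0 : 0 < log x / log y := div_pos (by linarith) (by linarith)
  obtain ⟨N, hN⟩ := pow_unbounded_of_one_lt (x / y ^ 2) (show (1:ℝ) < 11/10 by norm_num)
  refine friable h C a ha (by linarith) hC hr y (2 * log (2 * (log x / log y + 1))) (log x / log y) (C * exp (-(log y ^ a))) e y1 le_rfl ?_ he0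
    (min_le_right _ _) (fun t ht => ?_) y2 y3 (by linarith) (by linarith) N x ?_ ?_ ?_
  · have h1 : log (2 * (log x / log y + 1)) ≤ log 4 + log (log x) := by
      rw [← log_mul (by norm_num) (by linarith)]
      exact log_le_log (by linarith) (by linarith)
    have h2 : (log (log x)) ^ (β * a) ≤ log y ^ a := by
      rw [rpow_mul (by linarith)]
      exact rpow_le_rpow (by positivity) hl ha.le
    have h3 : C * log (2 * (log x / log y + 1)) ≤ C * (log 4 + log (log x)) := by gcongr
    linarith
  · refine (hr t (by linarith)).trans ?_
    have : log y ≤ log t := log_le_log hyp ht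
    gcongr
  · refine hy2.trans ?_
    have : e ≤ ε := min_le_left _ _
    gcongr
  · rw [div_mul_cancel₀ _ (by linarith)]
  · rw [div_lt_iff₀ (by positivity)] at hN; linarith

end VK

/-- Unconditionally, `Ψ(x,y) ≥ x ρ(log x/log y)` for
`exp((log log x)^{5/3+ε}) ≤ y ≤ (1-ε)x` and `x` large.
The Dickman function `ρ` is characterized by the hypotheses. -/
theorem stmt1 (ρ : ℝ → ℝ) (hρ_cont : ContinuousOn ρ (Set.Ici 0))
    (hρ_one : ∀ t ∈ Set.Icc (0 : ℝ) 1, ρ t = 1)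
    (hρ_eq : ∀ t ≥ (1 : ℝ), ρ t = 1 - ∫ v in (1 : ℝ)..t, ρ (v - 1) / v)
    (ε : ℝ) (hε0 : 0 < ε) (hε1 : ε < 1) :
    ∃ x₀ : ℝ, ∀ x ≥ x₀, ∀ y : ℝ,
      Real.exp ((Real.log (Real.log x)) ^ ((5 : ℝ) / 3 + ε)) ≤ y → y ≤ (1 - ε) * x →
      x * ρ (Real.log x / Real.log y) ≤ (Psi x y : ℝ) := by
  obtain ⟨x0, h0⟩ := VK.main_thm (VK.dick_of ρ hρ_cont hρ_one hρ_eq) ε hε0 hε1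
  refine ⟨max x0 (Real.exp 1), fun x hx y hy1 hy2 => ?_⟩
  have h1 := h0 x ((le_max_left _ _).trans hx) y hy1 hy2
  have hx1 : Real.exp 1 ≤ x := (le_max_right _ _).trans hx
  have hlx : 1 ≤ Real.log x := (Real.le_log_iff_exp_le ((Real.exp_pos 1).trans_le hx1)).2 hx1
  have hy : 0 ≤ Real.log y := by
    refine Real.log_nonneg (le_trans (Real.one_le_exp ?_) hy1)
    exact Real.rpow_nonneg (Real.log_nonneg hlx) _
  have hle : 0 ≤ Real.log x / Real.log y := div_nonneg (by linarith) hy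
  simpa only [max_eq_left hle] using h1
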